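/- arXiv:2503.10295 — 3 statements merged into one kernel-verified Lean document; each statement's English description precedes it below -/
import Mathlib

section
/- Let k ≥ 2 be an integer. Every 3k-strong semicomplete digraph D with minimum out-degree δ⁺(D) ≥ 22k is k-linked. -/
/-- A simple digraph: an irreflexive adjacency relation (no loops, no parallel arcs). -/
structure Digr (V : Type) where
  Adj : V → V → Prop
  irrefl : ∀ v, ¬ Adj v v

namespace Digr

variable {V : Type}

/-- `p` is a directed path (as a list of distinct vertices) from `x` to `y`. -/
def IsPathFrom (G : Digr V) (p : List V) (x y : V) : Prop :=
  p.head? = some x ∧ p.getLast? = some y ∧ p.Chain' G.Adj ∧ p.Nodup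

/-- A path from `x` to `y` all of whose vertices lie in `A`. -/
def IsPathOn (G : Digr V) (A : Set V) (p : List V) (x y : V) : Prop :=
  G.IsPathFrom p x y ∧ ∀ v ∈ p, v ∈ A

/-- The digraph restricted to `A` is strongly connected. -/
def StronglyConnectedOn (G : Digr V) (A : Set V) : Prop :=
  ∀ x ∈ A, ∀ y ∈ A, x ≠ y → ∃ p, G.IsPathOn A p x y

/-- A digraph is strong if every ordered pair of distinct vertices is joined by a path. -/
def IsStrong (G : Digr V) : Prop :=
  ∀ x y : V, x ≠ y → ∃ p, G.IsPathFrom p x y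

/-- `G` is `k`-strong: at least `k+1` vertices, and deleting any at most `k-1`
vertices leaves a strongly connected digraph. -/
def KStrong [Fintype V] (G : Digr V) (k : ℕ) : Prop :=
  k + 1 ≤ Fintype.card V ∧
  ∀ S : Finset V, S.card ≤ k - 1 → G.StronglyConnectedOn ((↑S : Set V)ᶜ)

/-- `G` is `k`-linked. -/
def KLinked [Fintype V] (G : Digr V) (k : ℕ) : Prop :=
  2 * k ≤ Fintype.card V ∧
  ∀ x y : Fin k → V, Function.Injective (Sum.elim x y) →
    ∃ P : Fin k → List V,
      (∀ i, G.IsPathFrom (P i) (x i) (y i)) ∧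
      (∀ i j, i ≠ j → ∀ v, v ∈ P i → v ∉ P j)

/-- Semicomplete: at least one arc between any two distinct vertices. -/
def Semicomplete (G : Digr V) : Prop :=
  ∀ x y : V, x ≠ y → G.Adj x y ∨ G.Adj y x

/-- Out-degree of a vertex. -/
noncomputable def outDeg [Fintype V] (G : Digr V) (v : V) : ℕ :=
  Set.ncard {w | G.Adj v w}

/-- In-degree of a vertex. -/
noncomputable def inDeg [Fintype V] (G : Digr V) (v : V) : ℕ :=
  Set.ncard {w | G.Adj w v}

/-- `G` together with the surjection `φ : V → ι` realizes a composition `H[S₁,…,S_h]`: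
between distinct parts, the arcs of `G` are exactly those prescribed by `H`. -/
def IsCompositionOver {ι : Type} (G : Digr V) (H : Digr ι) (φ : V → ι) : Prop :=
  Function.Surjective φ ∧ ∀ u v : V, φ u ≠ φ v → (G.Adj u v ↔ H.Adj (φ u) (φ v))

end Digr

namespace Digr

variable {V : Type} {k : ℕ}

/-- `Q l` is a path inside `U` from `A` to `y l`, and the paths are pairwise disjoint. -/
def IsLinkage (G : Digr V) (U A : Finset V) (y : Fin k → V) (Q : Fin k → List V) : Prop :=
  (∀ l, (∃ a ∈ A, G.IsPathFrom (Q l) a (y l)) ∧ ∀ v ∈ Q l, v ∈ U) ∧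
    ∀ l m, l ≠ m → ∀ v ∈ Q l, v ∉ Q m

/-- A path starting outside `S` and ending inside `S` has an arc entering `S`. -/
theorem IsPathOn.exists_entering_arc {G : Digr V} {U : Set V} {p : List V} {a b : V}
    (h : G.IsPathOn U p a b) (S : Finset V) (ha : a ∉ S) (hb : b ∈ S) :
    ∃ u v, u ∉ S ∧ v ∈ S ∧ u ∈ U ∧ v ∈ U ∧ G.Adj u v := by
  obtain ⟨⟨h1, h2, h3, -⟩, h4⟩ := h
  replace h3 : List.IsChain G.Adj p := h3
  induction p generalizing a with
  | nil => simp at h1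
  | cons c p ih =>
    simp only [List.head?_cons, Option.some.injEq] at h1
    subst h1
    cases p with
    | nil =>
      simp only [List.getLast?_singleton, Option.some.injEq] at h2
      exact absurd (h2 ▸ hb) ha
    | cons d p =>
      rw [List.isChain_cons_cons] at h3
      by_cases hd : d ∈ S
      · exact ⟨c, d, ha, hd, h4 c (by simp), h4 d (by simp), h3.1⟩
      · exact ih hd (fun v hv => h4 v (List.mem_cons_of_mem _ hv)) rfl (by simpa using h2) h3.2

/-- Menger's theorem in linkage form: if no set of fewer than `k` vertices separates `A` from the
`k` vertices `y l`, then there are `k` disjoint paths from `A` to them. -/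
theorem exists_isLinkage [Fintype V] (G : Digr V) (U A : Finset V) (y : Fin k → V)
    (hy : Function.Injective y) (hyU : ∀ l, y l ∈ U)
    (hcut : ∀ C S : Finset V, C.card < k → Disjoint S A → (∃ l, y l ∈ S ∧ y l ∉ C) →
      ∃ u v, u ∉ S ∧ v ∈ S ∧ u ∉ C ∧ v ∉ C ∧ u ∈ U ∧ v ∈ U ∧ G.Adj u v) :
    ∃ Q : Fin k → List V, G.IsLinkage U A y Q := by
  classical
  set B : Finset V := Finset.univ.image y with hB
  have hBcard : B.card = k := by simp [hB, Finset.card_image_of_injective _ hy]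
  let t : {v // v ∉ A} → Finset V := fun v => Finset.univ.filter fun u =>
    (u = v.1 ∨ (u ∈ U ∧ G.Adj u v.1)) ∧ u ∉ B
  have hall : ∀ s : Finset {v // v ∉ A}, s.card ≤ (s.biUnion t).card := by
    intro s
    by_contra! hlt
    set S : Finset V := s.map (Function.Embedding.subtype _) with hS
    set T := s.biUnion t with hT
    have hScard : S.card = s.card := by simp [hS]
    have hmemS : ∀ v, v ∈ S ↔ ∃ h : v ∉ A, (⟨v, h⟩ : {v // v ∉ A}) ∈ s := by
      intro v; simp [hS]
    have hSA : Disjoint S A := by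
      rw [Finset.disjoint_left]
      intro v hv
      exact ((hmemS v).1 hv).1
    have hTS : T ∩ S = S \ B := by
      ext v
      simp only [Finset.mem_inter, Finset.mem_sdiff]
      constructor
      · rintro ⟨h1, h2⟩
        simp only [hT, Finset.mem_biUnion, t, Finset.mem_filter] at h1
        obtain ⟨a, -, -, -, h⟩ := h1
        exact ⟨h2, h⟩
      · rintro ⟨h1, h2⟩
        obtain ⟨h, h'⟩ := (hmemS v).1 h1
        refine ⟨?_, h1⟩
        simp only [hT, Finset.mem_biUnion, t, Finset.mem_filter]
        exact ⟨⟨v, h⟩, h', by simp, Or.inl rfl, h2⟩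
    have e1 : (T \ S).card + (T ∩ S).card = T.card := Finset.card_sdiff_add_card_inter T S
    have e2 : (S \ B).card + (S ∩ B).card = S.card := Finset.card_sdiff_add_card_inter S B
    have e3 : (B \ S).card + (B ∩ S).card = B.card := Finset.card_sdiff_add_card_inter B S
    rw [hTS] at e1
    rw [Finset.inter_comm] at e3
    have hC : ((T \ S) ∪ (B \ S)).card < k := by
      have := Finset.card_union_le (T \ S) (B \ S)
      omega
    have hne : (S ∩ B).Nonempty := by
      rw [← Finset.card_pos]; omega
    obtain ⟨b, hb⟩ := hne
    rw [Finset.mem_inter, hB, Finset.mem_image] at hb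
    obtain ⟨hbS, l, -, rfl⟩ := hb
    obtain ⟨u, v, hu, hv, huC, -, huU, -, huv⟩ := hcut _ S hC hSA ⟨l, hbS, by simp [hbS]⟩
    apply huC
    by_cases huB : u ∈ B
    · simp [huB, hu]
    · obtain ⟨h, h'⟩ := (hmemS v).1 hv
      have : u ∈ T := by
        simp only [hT, Finset.mem_biUnion, t, Finset.mem_filter]
        exact ⟨⟨v, h⟩, h', by simp, Or.inr ⟨huU, huv⟩, huB⟩
      simp [this, hu]
  obtain ⟨f, hf, hft⟩ := (Finset.all_card_le_biUnion_card_iff_exists_injective t).1 hall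
  let F : V → V := fun v => if h : v ∉ A then f ⟨v, h⟩ else v
  have hF : ∀ v (h : v ∉ A), F v = f ⟨v, h⟩ := fun v h => by simp [F, h]
  have hFinj : ∀ u v, u ∉ A → v ∉ A → F u = F v → u = v := by
    intro u v hu hv h
    rw [hF u hu, hF v hv] at h
    simpa using hf h
  have hFt : ∀ v, v ∉ A → (F v = v ∨ (F v ∈ U ∧ G.Adj (F v) v)) ∧ F v ∉ B := by
    intro v hv
    have := hft ⟨v, hv⟩
    rw [← hF v hv] at this
    simpa [t] using this
  let x : Fin k → ℕ → V := fun l n => F^[n] (y l)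
  have hx0 : ∀ l, x l 0 = y l := fun l => rfl
  have hxs : ∀ l n, x l (n + 1) = F (x l n) := fun l n => Function.iterate_succ_apply' F n (y l)
  have hyB : ∀ l, y l ∈ B := fun l => by simp [hB]
  have key : ∀ n n' l l', (∀ m < n, x l m ∉ A) → (∀ m < n', x l' m ∉ A) → x l n = x l' n' →
      l = l' ∧ n = n' := by
    intro n
    induction n with
    | zero =>
      intro n' l l' _ h' h
      cases n' with
      | zero => exact ⟨hy h, rfl⟩
      | succ n' =>
        rw [hx0, hxs] at h
        exact absurd (h ▸ hyB l) (hFt _ (h' n' (by omega))).2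
    | succ n ih =>
      intro n' l l' h0 h' h
      cases n' with
      | zero =>
        rw [hx0, hxs] at h
        exact absurd (h ▸ hyB l') (hFt _ (h0 n (by omega))).2
      | succ n' =>
        rw [hxs, hxs] at h
        have := ih n' l l' (fun m hm => h0 m (by omega)) (fun m hm => h' m (by omega))
          (hFinj _ _ (h0 n (by omega)) (h' n' (by omega)) h)
        omega
  have hreach : ∀ l, ∃ n, x l n ∈ A := by
    intro l
    by_contra! h
    exact not_injective_infinite_finite (x l) fun n n' hn =>
      (key n n' l l (fun m _ => h m) (fun m _ => h m) hn).2
  let N : Fin k → ℕ := fun l => Nat.find (hreach l)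
  have hN : ∀ l, x l (N l) ∈ A := fun l => Nat.find_spec (hreach l)
  have hlt : ∀ l, ∀ m < N l, x l m ∉ A := fun l m hm => Nat.find_min (hreach l) hm
  have hstep : ∀ l, ∀ m < N l, x l (m + 1) ∈ U ∧ G.Adj (x l (m + 1)) (x l m) := by
    intro l m hm
    rcases (hFt _ (hlt l m hm)).1 with h | h
    · rw [← hxs] at h
      have := key (m + 1) m l l (fun j hj => hlt l j (by omega)) (fun j hj => hlt l j (by omega)) h
      omega
    · rwa [← hxs] at h
  have hxU : ∀ l, ∀ m ≤ N l, x l m ∈ U := by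
    intro l m hm
    cases m with
    | zero => exact hyU l
    | succ m => exact (hstep l m (by omega)).1
  have hmem : ∀ l v, v ∈ ((List.range (N l + 1)).map (x l)).reverse ↔ ∃ m ≤ N l, x l m = v := by
    intro l v
    simp
  refine ⟨fun l => ((List.range (N l + 1)).map (x l)).reverse, fun l => ⟨⟨x l (N l), hN l, ?_, ?_,
    ?_, ?_⟩, ?_⟩, ?_⟩
  · simp [List.range_succ]
  · simp [List.range_succ_eq_map, hx0]
  · show List.IsChain _ _
    rw [List.isChain_reverse, List.isChain_map, List.isChain_range_succ]
    exact fun m hm => (hstep l m hm).2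
  · rw [List.nodup_reverse]
    refine List.Nodup.map_on ?_ List.nodup_range
    intro m hm m' hm' h
    rw [List.mem_range] at hm hm'
    exact (key m m' l l (fun j hj => hlt l j (by omega)) (fun j hj => hlt l j (by omega)) h).2
  · intro v hv
    obtain ⟨m, hm, rfl⟩ := (hmem l v).1 hv
    exact hxU l m hm
  · intro l l' hne v hv hv'
    obtain ⟨m, hm, rfl⟩ := (hmem l v).1 hv
    obtain ⟨m', hm', h⟩ := (hmem l' _).1 hv'
    exact hne (key m m' l l' (fun j hj => hlt l j (by omega)) (fun j hj => hlt l' j (by omega))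
      h.symm).1

/-- In a linkage of minimum total length no path can be shortened while avoiding the others. -/
theorem IsLinkage.exists_shortest {G : Digr V} {U A : Finset V} {y : Fin k → V}
    (h : ∃ Q : Fin k → List V, G.IsLinkage U A y Q) :
    ∃ Q : Fin k → List V, G.IsLinkage U A y Q ∧
      ∀ l p, (∃ a ∈ A, G.IsPathFrom p a (y l)) → (∀ v ∈ p, v ∈ U) →
        (∀ m, l ≠ m → ∀ v ∈ p, v ∉ Q m) → (Q l).length ≤ p.length := by
  classical
  obtain ⟨Q, hQ, hmin⟩ := WellFounded.has_min
    (InvImage.wf (fun Q : Fin k → List V => ∑ l, (Q l).length) wellFounded_lt)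
    {Q | G.IsLinkage U A y Q} h
  refine ⟨Q, hQ, fun l p hp hpU hdis => ?_⟩
  by_contra! hlt
  refine hmin (Function.update Q l p) ⟨fun m => ?_, fun m m' hne v hv hv' => ?_⟩ ?_
  · by_cases hm : m = l
    · subst hm; simpa using ⟨hp, hpU⟩
    · simpa [hm] using hQ.1 m
  · by_cases hm : m = l
    · subst hm
      rw [Function.update_of_ne hne.symm] at hv'
      exact hdis m' hne v (by simpa using hv) hv'
    · rw [Function.update_of_ne hm] at hv
      by_cases hm' : m' = l
      · subst hm'
        exact hdis m hne.symm v (by simpa using hv') hv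
      · rw [Function.update_of_ne hm'] at hv'
        exact hQ.2 m m' hne v hv hv'
  · refine Finset.sum_lt_sum (fun m _ => ?_) ⟨l, Finset.mem_univ _, by simpa using hlt⟩
    by_cases hm : m = l
    · subst hm; simpa using hlt.le
    · simp [hm]

/-- A linkage in which no detour `pre` from `A` into a path of the linkage is a shortcut. -/
theorem exists_isLinkage_no_shortcut {G : Digr V} {U A : Finset V} {y : Fin k → V}
    (h : ∃ Q : Fin k → List V, G.IsLinkage U A y Q) :
    ∃ Q : Fin k → List V, G.IsLinkage U A y Q ∧
      ∀ l v pre, v ∈ Q l → (∃ a ∈ A, (pre ++ [v]).head? = some a) →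
        List.IsChain G.Adj (pre ++ [v]) → pre.Nodup → (∀ u ∈ pre, u ∈ U ∧ ∀ m, u ∉ Q m) →
        v ∈ (Q l).take (pre.length + 1) := by
  obtain ⟨Q, hQ, hmin⟩ := IsLinkage.exists_shortest h
  refine ⟨Q, hQ, fun l v pre hv ⟨a, haA, ha⟩ hch hnd hpre => ?_⟩
  obtain ⟨s, t, hst⟩ := List.append_of_mem hv
  obtain ⟨⟨b, -, -, hlast, hchain, hnodup⟩, hU⟩ := hQ.1 l
  replace hchain : List.IsChain G.Adj (Q l) := hchain
  have hsuf : ∀ w ∈ v :: t, w ∈ Q l := fun w hw => hst ▸ List.mem_append_right _ hw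
  have hlen := hmin l (pre ++ v :: t) ⟨a, haA, ?_, ?_, ?_, ?_⟩ ?_ ?_
  · rw [hst] at hlen ⊢
    simp only [List.length_append, List.length_cons] at hlen
    have : s.length ≤ pre.length := by omega
    rw [List.take_append]
    refine List.mem_append_right _ ?_
    rw [show pre.length + 1 - s.length = (pre.length - s.length) + 1 by omega]
    simp
  · cases pre <;> simpa using ha
  · rw [hst] at hlast
    simpa [List.getLast?_append] using hlast
  · show List.IsChain _ _
    rw [List.isChain_split]
    exact ⟨hch, (hst ▸ hchain).right_of_append⟩
  · rw [hst] at hnodup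
    refine List.Nodup.append hnd hnodup.of_append_right ?_
    intro w hw hw'
    exact (hpre w hw).2 l (hsuf w hw')
  · intro w hw
    rcases List.mem_append.1 hw with hw | hw
    · exact (hpre w hw).1
    · exact hU w (hsuf w hw)
  · intro m hm w hw
    rcases List.mem_append.1 hw with hw | hw
    · exact (hpre w hw).2 m
    · exact hQ.2 l m hm w (hsuf w hw)

end Digr

/-- A family of `k` sets, each of size at least `k`, has a system of distinct representatives. -/
theorem exists_injective_mem_of_le_card {V : Type} {k : ℕ} (F : Fin k → Finset V)
    (hF : ∀ j, k ≤ (F j).card) : ∃ f : Fin k → V, Function.Injective f ∧ ∀ j, f j ∈ F j := by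
  classical
  refine (Finset.all_card_le_biUnion_card_iff_exists_injective F).1 fun s => ?_
  rcases s.eq_empty_or_nonempty with rfl | ⟨j, hj⟩
  · simp
  · calc s.card ≤ k := by simpa using Finset.card_le_univ s
      _ ≤ (F j).card := hF j
      _ ≤ _ := Finset.card_le_card (Finset.subset_biUnion_of_mem F hj)

/-- A finite relation has a maximal partial system of distinct representatives. -/
theorem exists_maximal_injOn {ι V : Type} [Fintype ι] [DecidableEq ι] [DecidableEq V] [Nonempty V]
    (C : ι → V → Prop) :
    ∃ (J : Finset ι) (w : ι → V), Set.InjOn w J ∧ (∀ j ∈ J, C j (w j)) ∧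
      ∀ j ∉ J, ∀ v ∉ J.image w, ¬ C j v := by
  classical
  obtain ⟨J, hJ, hmax⟩ := Finset.exists_max_image
    (Finset.univ.filter fun J : Finset ι => ∃ w : ι → V, Set.InjOn w J ∧ ∀ j ∈ J, C j (w j))
    Finset.card ⟨∅, by simp⟩
  obtain ⟨w, hw, hC⟩ := (Finset.mem_filter.1 hJ).2
  refine ⟨J, w, hw, hC, fun j hj v hv hCv => ?_⟩
  have hne : ∀ i ∈ J, i ≠ j := fun i hi h => hj (h ▸ hi)
  have heq : ∀ i ∈ J, Function.update w j v i = w i := fun i hi => Function.update_of_ne (hne i hi) _ _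
  have hv' : ∀ i ∈ J, w i ≠ v := fun i hi h => hv (h ▸ Finset.mem_image_of_mem w hi)
  have := hmax (insert j J) (Finset.mem_filter.2 ⟨Finset.mem_univ _, Function.update w j v, ?_, ?_⟩)
  · rw [Finset.card_insert_of_notMem hj] at this
    omega
  · rw [Finset.coe_insert, Set.injOn_insert (by simpa using hj)]
    refine ⟨fun a ha b hb h => hw ha hb (by rwa [heq a ha, heq b hb] at h), ?_⟩
    rintro ⟨i, hi, h⟩
    rw [heq i hi, Function.update_self] at h
    exact hv' i hi h
  · intro i hi
    rcases Finset.mem_insert.1 hi with rfl | hi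
    · simpa using hCv
    · rw [heq i hi]; exact hC i hi

/-- The `t` elements of `T` on which `g` is smallest. -/
theorem Finset.exists_subset_card_eq_forall_le {V : Type} [DecidableEq V] (T : Finset V) (g : V → ℕ)
    (t : ℕ) (ht : t ≤ T.card) :
    ∃ O ⊆ T, O.card = t ∧ ∀ o ∈ O, ∀ u ∈ T, u ∉ O → g o ≤ g u := by
  induction t with
  | zero => exact ⟨∅, by simp, rfl, by simp⟩
  | succ t ih =>
    obtain ⟨O, hOT, hO, hle⟩ := ih (by omega)
    have hne : (T \ O).Nonempty := by
      rw [← Finset.card_pos, Finset.card_sdiff_of_subset hOT]; omega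
    obtain ⟨m, hm, hmin⟩ := Finset.exists_min_image (T \ O) g hne
    rw [Finset.mem_sdiff] at hm
    refine ⟨insert m O, Finset.insert_subset hm.1 hOT, by
      rw [Finset.card_insert_of_notMem hm.2, hO], fun o ho u hu huO => ?_⟩
    rw [Finset.mem_insert, not_or] at huO
    rcases Finset.mem_insert.1 ho with rfl | ho
    · exact hmin u (Finset.mem_sdiff.2 ⟨hu, huO.2⟩)
    · exact hle o ho u hu huO.2

/-- In an oriented graph with out-neighbourhoods `P`, a set of vertices each having at most `c`
non-out-neighbours inside the set has at most `2 * c` elements. -/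
theorem Finset.card_le_two_mul_of_card_sdiff_le {V : Type} [DecidableEq V] (P : V → Finset V)
    (hP : ∀ u v, v ∈ P u → u ∉ P v) (B : Finset V) (c : ℕ) (hB : ∀ b ∈ B, (B \ P b).card ≤ c) :
    B.card ≤ 2 * c := by
  have h1 : ∑ b ∈ B, (B \ P b).card ≤ B.card * c := by
    simpa using Finset.sum_le_card_nsmul B _ c hB
  have h2 : ∀ b, (B \ P b).card = ∑ a ∈ B, if a ∉ P b then 1 else 0 := by
    intro b
    rw [← Finset.card_filter]
    congr 1
    ext; simp
  have h3 : B.card * B.card ≤ 2 * ∑ b ∈ B, (B \ P b).card := by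
    simp only [h2]
    rw [two_mul]
    nth_rewrite 2 [Finset.sum_comm]
    rw [← Finset.sum_add_distrib]
    have : ∀ b ∈ B, B.card ≤ (∑ a ∈ B, if a ∉ P b then 1 else 0) +
        ∑ a ∈ B, if b ∉ P a then 1 else 0 := by
      intro b _
      rw [← Finset.sum_add_distrib]
      have h := Finset.card_nsmul_le_sum B
        (fun a => (if a ∉ P b then 1 else 0) + if b ∉ P a then 1 else 0) 1 fun a _ => by
          by_cases ha : a ∈ P b
          · simp [hP b a ha]
          · simp [ha]
      rwa [smul_eq_mul, mul_one] at h
    have h := Finset.card_nsmul_le_sum B _ _ this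
    rwa [smul_eq_mul] at h
  rcases Nat.eq_zero_or_pos B.card with h | h
  · omega
  · nlinarith

/-- Every 3k-strong semicomplete digraph with minimum out-degree
at least 22k is k-linked (k ≥ 2). -/
theorem semicomplete_3k_strong_is_k_linked {V : Type} [Fintype V] (k : ℕ) (hk : 2 ≤ k)
    (G : Digr V) (hsc : G.Semicomplete) (hstrong : G.KStrong (3 * k))
    (hdeg : ∀ v : V, 22 * k ≤ G.outDeg v) :
    G.KLinked k := by
  classical
  obtain ⟨hcard, hconn⟩ := hstrong
  refine ⟨by omega, fun x y hxy => ?_⟩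
  have hx : Function.Injective x := fun i j h => Sum.inl_injective (hxy h)
  have hy : Function.Injective y := fun i j h => Sum.inr_injective (hxy h)
  have hxney : ∀ i j, x i ≠ y j := fun i j h => Sum.inl_ne_inr (hxy h)
  have : Nonempty V := Fintype.card_pos_iff.1 (by omega)
  set N : V → Finset V := fun v => Finset.univ.filter (G.Adj v) with hN
  have hNmem : ∀ u v, v ∈ N u ↔ G.Adj u v := by simp [hN]
  have hNcard : ∀ v, 22 * k ≤ (N v).card := by
    intro v
    refine (hdeg v).trans_eq ?_
    rw [Digr.outDeg, ← Set.ncard_coe_finset]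
    congr 1
    ext; simp [hN]
  set X : Finset V := Finset.univ.image x with hX
  set Y : Finset V := Finset.univ.image y with hY
  have hxX : ∀ i, x i ∈ X := by simp [hX]
  have hyY : ∀ i, y i ∈ Y := by simp [hY]
  have hyX : ∀ i, y i ∉ X := by
    intro i h
    obtain ⟨j, -, h⟩ := Finset.mem_image.1 h
    exact hxney j i h
  have hXc : X.card ≤ k := by simpa using Finset.card_image_le (s := Finset.univ) (f := x)
  have hYc : Y.card ≤ k := by simpa using Finset.card_image_le (s := Finset.univ) (f := y)
  -- `P u` is the set of vertices that are dominated by `u` but do not dominate it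
  set P : V → Finset V := fun u =>
    Finset.univ.filter fun v => v ∉ X ∧ v ∉ Y ∧ v ≠ u ∧ ¬ G.Adj v u with hP
  have hPmem : ∀ u v, v ∈ P u ↔ v ∉ X ∧ v ∉ Y ∧ v ≠ u ∧ ¬ G.Adj v u := by simp [hP]
  have hPadj : ∀ u v, v ∈ P u → G.Adj u v := by
    intro u v h
    obtain ⟨-, -, h1, h2⟩ := (hPmem u v).1 h
    exact (hsc v u h1).resolve_left h2
  have hPasymm : ∀ u v, v ∈ P u → u ∉ P v := fun u v h h' =>
    ((hPmem u v).1 h).2.2.2 (hPadj v u h')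
  obtain ⟨O, hOT, hOc, hOmin⟩ := Finset.exists_subset_card_eq_forall_le
    (Finset.univ \ (X ∪ Y)) (fun u => (P u).card) (3 * k) (by
      have h1 := Finset.le_card_sdiff (X ∪ Y) (N (x ⟨0, by omega⟩))
      have h2 := Finset.card_union_le X Y
      have h3 := hNcard (x ⟨0, by omega⟩)
      have h4 := Finset.card_le_card (Finset.sdiff_subset_sdiff
        (Finset.subset_univ (N (x ⟨0, by omega⟩))) (subset_refl (X ∪ Y)))
      omega)
  have hOXY : ∀ v ∈ O, v ∉ X ∧ v ∉ Y := fun v hv => by simpa using hOT hv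
  obtain ⟨J, w, hwinj, hwC, hJmax⟩ := exists_maximal_injOn fun (j : Fin k) (v : V) =>
    G.Adj (x j) v ∧ (v ∉ X ∧ v ∉ Y ∧ v ∉ O) ∧ 2 * k ≤ (N v ∩ O).card
  set W : Finset V := J.image w with hW
  have hwW : ∀ j ∈ J, w j ∈ W := fun j hj => Finset.mem_image_of_mem w hj
  have hWc : W.card ≤ k := by
    refine Finset.card_image_le.trans ?_
    simpa using Finset.card_le_univ J
  have hWXYO : ∀ v ∈ W, v ∉ X ∧ v ∉ Y ∧ v ∉ O := by
    intro v hv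
    obtain ⟨j, hj, rfl⟩ := Finset.mem_image.1 hv
    exact (hwC j hj).2.1
  set U : Finset V := Finset.univ \ (X ∪ W) with hU
  have hUmem : ∀ v, v ∈ U ↔ v ∉ X ∧ v ∉ W := by simp [hU]
  have hOU : ∀ v ∈ O, v ∈ U := fun v hv =>
    (hUmem v).2 ⟨(hOXY v hv).1, fun h => (hWXYO v h).2.2 hv⟩
  have hyU : ∀ l, y l ∈ U := fun l => (hUmem _).2 ⟨hyX l, fun h => (hWXYO _ h).2.1 (hyY l)⟩
  have hlink : ∃ Q, G.IsLinkage U O y Q := by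
    refine Digr.exists_isLinkage G U O y hy hyU ?_
    rintro C S hC hSO ⟨l, hlS, hlC⟩
    obtain ⟨a, ha⟩ : (O \ C).Nonempty := by
      rw [← Finset.card_pos]
      have := Finset.le_card_sdiff C O
      omega
    obtain ⟨haO, haC⟩ := Finset.mem_sdiff.1 ha
    have haS : a ∉ S := fun h => Finset.disjoint_left.1 hSO h haO
    have hD : (C ∪ (X ∪ W)).card ≤ 3 * k - 1 := by
      have := Finset.card_union_le C (X ∪ W)
      have := Finset.card_union_le X W
      omega
    have hDmem : ∀ v, v ∈ ((↑(C ∪ (X ∪ W)) : Set V)ᶜ) ↔ v ∉ C ∧ v ∈ U := by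
      intro v; simp [hUmem]
    obtain ⟨p, hp⟩ := hconn _ hD a ((hDmem a).2 ⟨haC, hOU a haO⟩) (y l)
      ((hDmem _).2 ⟨hlC, hyU l⟩) (fun h => haS (h ▸ hlS))
    obtain ⟨u, v, hu, hv, huD, hvD, huv⟩ := hp.exists_entering_arc S haS hlS
    rw [hDmem] at huD hvD
    exact ⟨u, v, hu, hv, huD.1, hvD.1, huD.2, hvD.2, huv⟩
  obtain ⟨Q, ⟨hQ, hQdisj⟩, hshort⟩ := Digr.exists_isLinkage_no_shortcut hlink
  have hQU : ∀ l, ∀ v ∈ Q l, v ∉ X ∧ v ∉ W := fun l v hv => (hUmem v).1 ((hQ l).2 v hv)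
  have hQcons : ∀ l, ∃ a t, a ∈ O ∧ Q l = a :: t := by
    intro l
    obtain ⟨⟨a, ha, hhead, -⟩, -⟩ := hQ l
    obtain ⟨t, ht⟩ := List.head?_eq_some_iff.1 hhead
    exact ⟨a, t, ha, ht⟩
  choose a tl haO hQeq using hQcons
  have haQ : ∀ l, a l ∈ Q l := fun l => by simp [hQeq l]
  have hQlast : ∀ l, (Q l).getLast? = some (y l) := fun l => (hQ l).1.choose_spec.2.2.1
  have hQchain : ∀ l, List.IsChain G.Adj (Q l) := fun l => (hQ l).1.choose_spec.2.2.2.1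
  have hQnodup : ∀ l, (Q l).Nodup := fun l => (hQ l).1.choose_spec.2.2.2.2
  have hQY : ∀ l, y l ∈ Q l := fun l => List.mem_of_getLast? (hQlast l)
  have hQO : ∀ l, ∀ v ∈ Q l, v ∈ O → v = a l := by
    intro l v hv hvO
    have := hshort l v [] hv ⟨v, hvO, rfl⟩ (by simp) (by simp) (by simp)
    rw [hQeq l] at this
    simpa using this
  set R : Finset V := Finset.univ.filter fun v => v ∉ X ∧ v ∉ W ∧ ∀ l, v ∉ Q l with hR
  have hRmem : ∀ v, v ∈ R ↔ v ∉ X ∧ v ∉ W ∧ ∀ l, v ∉ Q l := by simp [hR]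
  have hRY : ∀ v ∈ R, v ∉ Y := by
    intro v hv h
    obtain ⟨l, -, rfl⟩ := Finset.mem_image.1 h
    exact ((hRmem _).1 hv).2.2 l (hQY l)
  set O' : Finset V := O \ Finset.univ.image a with hO'
  have hac : (Finset.univ.image a).card ≤ k := by
    simpa using Finset.card_image_le (s := Finset.univ) (f := a)
  have hO'c : 2 * k ≤ O'.card := by
    have := Finset.le_card_sdiff (Finset.univ.image a) O
    rw [← hO'] at this
    omega
  have hO'O : ∀ v ∈ O', v ∈ O := fun v hv => (Finset.mem_sdiff.1 hv).1
  have hO'R : ∀ v ∈ O', v ∈ R := by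
    intro v hv
    obtain ⟨h1, h2⟩ := Finset.mem_sdiff.1 hv
    have h3 := (hUmem v).1 (hOU v h1)
    refine (hRmem v).2 ⟨h3.1, h3.2, fun l hl => h2 ?_⟩
    rw [hQO l v hl h1]
    exact Finset.mem_image_of_mem a (Finset.mem_univ l)
  have hRU : ∀ v ∈ R, v ∈ U ∧ ∀ l, v ∉ Q l := fun v hv =>
    have h := (hRmem v).1 hv
    ⟨(hUmem v).2 ⟨h.1, h.2.1⟩, h.2.2⟩
  set S₁ : Finset V := Finset.univ.biUnion fun l => ((tl l).take 1).toFinset with hS₁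
  set S₃ : Finset V := Finset.univ.biUnion fun l => ((Q l).take 3).toFinset with hS₃
  have hS₁c : S₁.card ≤ k := by
    have := Finset.card_biUnion_le_card_mul Finset.univ
      (fun l => ((tl l).take 1).toFinset) 1 fun l _ =>
        (List.toFinset_card_le _).trans (List.length_take_le _ _)
    simpa using this
  have hS₃c : S₃.card ≤ 3 * k := by
    have := Finset.card_biUnion_le_card_mul Finset.univ
      (fun l => ((Q l).take 3).toFinset) 3 fun l _ =>
        (List.toFinset_card_le _).trans (List.length_take_le _ _)
    rw [← hS₃, Finset.card_univ, Fintype.card_fin] at this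
    omega
  set L : Finset V := Finset.univ.filter fun u => u ∈ R ∧ u ∉ O ∧ ∃ o ∈ O', G.Adj o u with hL
  have hLmem : ∀ u, u ∈ L ↔ u ∈ R ∧ u ∉ O ∧ ∃ o ∈ O', G.Adj o u := by simp [hL]
  set Z : Finset V := X ∪ (Y ∪ (W ∪ (O ∪ S₁))) with hZ
  have hZc : Z.card ≤ 7 * k := by
    have h1 := Finset.card_union_le X (Y ∪ (W ∪ (O ∪ S₁)))
    have h2 := Finset.card_union_le Y (W ∪ (O ∪ S₁))
    have h3 := Finset.card_union_le W (O ∪ S₁)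
    have h4 := Finset.card_union_le O S₁
    rw [← hZ] at h1
    omega
  have hZmem : ∀ v, v ∉ Z ↔ v ∉ X ∧ v ∉ Y ∧ v ∉ W ∧ v ∉ O ∧ v ∉ S₁ := by simp [hZ]
  have hZL : ∀ u ∉ Z, ∀ o ∈ O', G.Adj o u → u ∈ L := by
    intro u hu o ho hou
    obtain ⟨h1, -, h3, h4, h5⟩ := (hZmem u).1 hu
    refine (hLmem u).2 ⟨(hRmem u).2 ⟨h1, h3, fun l hl => h5 ?_⟩, h4, o, ho, hou⟩
    have := hshort l u [o] hl ⟨o, hO'O o ho, rfl⟩ (by simpa using hou) (by simp)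
      (by simpa using hRU o (hO'R o ho))
    rw [hQeq l, List.length_singleton, List.take_succ_cons, List.mem_cons] at this
    rcases this with rfl | h
    · exact absurd (haO l) h4
    · exact Finset.mem_biUnion.2 ⟨l, Finset.mem_univ l, List.mem_toFinset.2 h⟩
  have hNL : ∀ v, (∀ u ∈ N v, u ∉ Z → u ∈ L) → 15 * k ≤ (N v ∩ L).card := by
    intro v hv
    have h1 : N v ⊆ Z ∪ (N v ∩ L) := by
      intro u hu
      by_cases h : u ∈ Z
      · exact Finset.mem_union_left _ h
      · exact Finset.mem_union_right _ (Finset.mem_inter.2 ⟨hu, hv u hu h⟩)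
    have h2 := Finset.card_le_card h1
    have h3 := Finset.card_union_le Z (N v ∩ L)
    have h4 := hNcard v
    omega
  have hO'L : ∀ o ∈ O', 15 * k ≤ (N o ∩ L).card := fun o ho =>
    hNL o fun u hu hZ => hZL u hZ o ho ((hNmem o u).1 hu)
  have hxL : ∀ j ∉ J, 15 * k ≤ (N (x j) ∩ L).card := by
    refine fun j hj => hNL _ fun u hu hZ => ?_
    obtain ⟨h1, h2, h3, h4, -⟩ := (hZmem u).1 hZ
    have hlt : (N u ∩ O).card < 2 * k := by
      by_contra! h
      exact hJmax j hj u h3 ⟨(hNmem _ _).1 hu, ⟨h1, h2, h4⟩, h⟩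
    obtain ⟨o, ho, hou⟩ : ∃ o ∈ O', o ∉ N u ∩ O :=
      Finset.exists_mem_notMem_of_card_lt_card (by omega)
    refine hZL u hZ o ho ((hsc o u fun h => h4 (h ▸ hO'O o ho)).resolve_right fun h => hou ?_)
    exact Finset.mem_inter.2 ⟨(hNmem _ _).2 h, hO'O o ho⟩
  obtain ⟨o, hoinj, hoF⟩ := exists_injective_mem_of_le_card
    (fun j => if j ∈ J then N (w j) ∩ O' else O') (by
      intro j
      by_cases hj : j ∈ J
      · simp only [hj, if_true]
        have h1 : (N (w j) ∩ O) \ Finset.univ.image a = N (w j) ∩ O' := by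
          rw [hO', Finset.inter_sdiff_assoc]
        have h2 := Finset.le_card_sdiff (Finset.univ.image a) (N (w j) ∩ O)
        have h3 := (hwC j hj).2.2
        rw [h1] at h2
        omega
      · simp only [hj, if_false]
        omega)
  have hoO' : ∀ j, o j ∈ O' := by
    intro j
    have := hoF j
    split_ifs at this
    · exact (Finset.mem_inter.1 this).2
    · exact this
  have hwo : ∀ j ∈ J, G.Adj (w j) (o j) := by
    intro j hj
    have := hoF j
    rw [if_pos hj] at this
    exact (hNmem _ _).1 (Finset.mem_inter.1 this).1
  set M : Fin k → Finset V := fun j => P (a j) ∩ R with hM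
  have hMa : ∀ j, ∀ z ∈ R, z ∉ M j → G.Adj z (a j) := by
    intro j z hz hzM
    by_contra h
    refine hzM (Finset.mem_inter.2 ⟨(hPmem _ _).2 ⟨((hRmem z).1 hz).1, hRY z hz, ?_, h⟩, hz⟩)
    rintro rfl
    exact ((hRmem _).1 hz).2.2 j (haQ j)
  have hPR : ∀ u ∈ L, (P u).card ≤ (P u ∩ R).card + 4 * k := by
    intro u hu
    obtain ⟨huR, huO, b, hb, hbu⟩ := (hLmem u).1 hu
    have hsub : P u ⊆ (P u ∩ R) ∪ (W ∪ S₃) := by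
      intro v hv
      obtain ⟨hvX, -⟩ := (hPmem u v).1 hv
      by_cases hvW : v ∈ W
      · simp [hvW]
      by_cases hvQ : ∃ l, v ∈ Q l
      · obtain ⟨l, hl⟩ := hvQ
        have := hshort l v [b, u] hl ⟨b, hO'O b hb, rfl⟩ (by simpa using ⟨hbu, hPadj u v hv⟩)
          (by simpa using fun h : b = u => huO (h ▸ hO'O b hb))
          (by simpa using ⟨hRU b (hO'R b hb), hRU u huR⟩)
        refine Finset.mem_union_right _ (Finset.mem_union_right _ ?_)
        exact Finset.mem_biUnion.2 ⟨l, Finset.mem_univ l, List.mem_toFinset.2 this⟩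
      · push Not at hvQ
        exact Finset.mem_union_left _ (Finset.mem_inter.2 ⟨hv, (hRmem v).2 ⟨hvX, hvW, hvQ⟩⟩)
    have h1 := Finset.card_le_card hsub
    have h2 := Finset.card_union_le (P u ∩ R) (W ∪ S₃)
    have h3 := Finset.card_union_le W S₃
    omega
  set bad : Fin k → Finset V := fun j =>
    L.filter fun u => u ∈ M j ∧ ((P u ∩ R) \ M j).card < 3 * k with hbad
  have hbadc : ∀ j, (bad j).card ≤ 2 * (7 * k - 1) := by
    refine fun j => Finset.card_le_two_mul_of_card_sdiff_le P hPasymm _ _ fun u hu => ?_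
    obtain ⟨huL, -, huc⟩ := Finset.mem_filter.1 hu
    obtain ⟨huR, huO, -⟩ := (hLmem u).1 huL
    have h1 : bad j \ P u ⊆ M j \ P u :=
      Finset.sdiff_subset_sdiff (fun v hv => (Finset.mem_filter.1 hv).2.1) (subset_refl _)
    have h2 := Finset.card_le_card h1
    have h3 := Finset.card_sdiff_add_card_inter (P u ∩ R) (M j)
    have h4 := Finset.card_sdiff_add_card_inter (M j) (P u)
    have h5 : P u ∩ R ∩ M j = M j ∩ P u := by
      ext v; simp only [hM, Finset.mem_inter]; tauto
    have h6 : (M j).card ≤ (P (a j)).card := Finset.card_le_card Finset.inter_subset_left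
    have h7 := hOmin (a j) (haO j) u (by simp [((hRmem u).1 huR).1, hRY u huR]) huO
    have h8 := hPR u huL
    rw [h5] at h3
    omega
  obtain ⟨u, huinj, huF⟩ := exists_injective_mem_of_le_card
    (fun j => (N (if j ∈ J then o j else x j) ∩ L) \ bad j) (by
      intro j
      have h1 := Finset.le_card_sdiff (bad j) (N (if j ∈ J then o j else x j) ∩ L)
      have h2 := hbadc j
      have h3 : 15 * k ≤ (N (if j ∈ J then o j else x j) ∩ L).card := by
        split_ifs with hj
        · exact hO'L _ (hoO' j)
        · exact hxL j hj
      omega)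
  have huL : ∀ j, u j ∈ L := fun j => (Finset.mem_inter.1 (Finset.mem_sdiff.1 (huF j)).1).2
  have huadj : ∀ j, G.Adj (if j ∈ J then o j else x j) (u j) := fun j =>
    (hNmem _ _).1 (Finset.mem_inter.1 (Finset.mem_sdiff.1 (huF j)).1).1
  have huR : ∀ j, u j ∈ R := fun j => ((hLmem _).1 (huL j)).1
  have huO : ∀ j, u j ∉ O := fun j => ((hLmem _).1 (huL j)).2.1
  obtain ⟨z, hzinj, hzF⟩ := exists_injective_mem_of_le_card
    (fun j => if u j ∈ M j then
      ((P (u j) ∩ R) \ M j) \ (Finset.univ.image o ∪ Finset.univ.image u) else Finset.univ) (by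
      intro j
      by_cases hj : u j ∈ M j
      · simp only [hj, if_true]
        have h1 : 3 * k ≤ ((P (u j) ∩ R) \ M j).card := by
          by_contra! h
          exact (Finset.mem_sdiff.1 (huF j)).2 (Finset.mem_filter.2 ⟨huL j, hj, h⟩)
        have h2 := Finset.le_card_sdiff (Finset.univ.image o ∪ Finset.univ.image u)
          ((P (u j) ∩ R) \ M j)
        have h3 := Finset.card_union_le (Finset.univ.image o) (Finset.univ.image u)
        have h4 : (Finset.univ.image o).card ≤ k := by
          simpa using Finset.card_image_le (s := Finset.univ) (f := o)
        have h5 : (Finset.univ.image u).card ≤ k := by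
          simpa using Finset.card_image_le (s := Finset.univ) (f := u)
        omega
      · simp only [hj, if_false, Finset.card_univ]
        omega)
  have hz : ∀ j, u j ∈ M j → z j ∈ R ∧ G.Adj (u j) (z j) ∧ G.Adj (z j) (a j) ∧
      ∀ i, z j ≠ o i ∧ z j ≠ u i := by
    intro j hj
    have h := hzF j
    rw [if_pos hj, Finset.mem_sdiff, Finset.mem_sdiff, Finset.mem_inter] at h
    obtain ⟨⟨⟨h1, h2⟩, h3⟩, h4⟩ := h
    refine ⟨h2, hPadj _ _ h1, hMa j _ h2 h3, fun i => ⟨fun e => h4 ?_, fun e => h4 ?_⟩⟩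
    · simp [e]
    · simp [e]
  have huo : ∀ i j, u i ≠ o j := fun i j h => huO i (h ▸ hO'O _ (hoO' j))
  have hmid : ∀ j, ∃ mid : List V, List.IsChain G.Adj (x j :: (mid ++ Q j)) ∧ mid.Nodup ∧
      ∀ v ∈ mid, (j ∈ J ∧ v = w j) ∨ v = o j ∨ v = u j ∨ (u j ∈ M j ∧ v = z j) := by
    intro j
    have hc := hQchain j
    rw [hQeq j] at hc ⊢
    have h1 := huadj j
    have hw : ∀ v ∈ R, j ∈ J → w j ≠ v := fun v hv hj h => ((hRmem v).1 hv).2.1 (h ▸ hwW j hj)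
    have hwo' := hw _ (hO'R _ (hoO' j))
    have hwu := hw _ (huR j)
    have hou := (huo j j).symm
    by_cases hj : j ∈ J <;> by_cases hu : u j ∈ M j
    · obtain ⟨hzR, huz, hza, hzne⟩ := hz j hu
      have hwz := hw _ hzR hj
      rw [if_pos hj] at h1
      refine ⟨[w j, o j, u j, z j], ?_, ?_, ?_⟩
      · simp [hc, (hwC j hj).1, hwo j hj, h1, huz, hza]
      · simp [hwo' hj, hwu hj, hwz, hou, (hzne j).1.symm, (hzne j).2.symm]
      · simp [hj, hu]
    · rw [if_pos hj] at h1
      refine ⟨[w j, o j, u j], ?_, ?_, ?_⟩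
      · simp [hc, (hwC j hj).1, hwo j hj, h1, hMa j _ (huR j) hu]
      · simp [hwo' hj, hwu hj, hou]
      · simp [hj]
    · obtain ⟨hzR, huz, hza, hzne⟩ := hz j hu
      rw [if_neg hj] at h1
      refine ⟨[u j, z j], ?_, ?_, ?_⟩
      · simp [hc, h1, huz, hza]
      · simp [(hzne j).2.symm]
      · simp [hu]
    · rw [if_neg hj] at h1
      refine ⟨[u j], ?_, ?_, ?_⟩
      · simp [hc, h1, hMa j _ (huR j) hu]
      · simp
      · simp
  choose mid hchain hnodup hmem using hmid
  have hmidRW : ∀ j, ∀ v ∈ mid j, v ∈ R ∨ v ∈ W := by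
    intro j v hv
    rcases hmem j v hv with ⟨hj, rfl⟩ | rfl | rfl | ⟨hj, rfl⟩
    · exact Or.inr (hwW j hj)
    · exact Or.inl (hO'R _ (hoO' j))
    · exact Or.inl (huR j)
    · exact Or.inl (hz j hj).1
  have hmidX : ∀ j, ∀ v ∈ mid j, v ∉ X := fun j v hv =>
    (hmidRW j v hv).elim (fun h => ((hRmem v).1 h).1) fun h => (hWXYO v h).1
  have hmidQ : ∀ i j, ∀ v ∈ mid i, v ∉ Q j := fun i j v hv hq =>
    (hmidRW i v hv).elim (fun h => ((hRmem v).1 h).2.2 j hq) (hQU j v hq).2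
  have hmiddisj : ∀ i j, i ≠ j → ∀ v ∈ mid i, v ∉ mid j := by
    intro i j hij v hi hj
    have hWR : ∀ v ∈ R, v ∉ W := fun v hv => ((hRmem v).1 hv).2.1
    have hoR := fun i => hO'R _ (hoO' i)
    rcases hmem i v hi with ⟨hiJ, rfl⟩ | rfl | rfl | ⟨hi', rfl⟩ <;>
      rcases hmem j _ hj with ⟨hjJ, h⟩ | h | h | ⟨hj', h⟩
    · exact hij (hwinj hiJ hjJ h)
    · exact hWR _ (hoR j) (h ▸ hwW i hiJ)
    · exact hWR _ (huR j) (h ▸ hwW i hiJ)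
    · exact hWR _ (hz j hj').1 (h ▸ hwW i hiJ)
    · exact hWR _ (hoR i) (h ▸ hwW j hjJ)
    · exact hij (hoinj h)
    · exact huo j i h.symm
    · exact ((hz j hj').2.2.2 i).1 h.symm
    · exact hWR _ (huR i) (h ▸ hwW j hjJ)
    · exact huo i j h
    · exact hij (huinj h)
    · exact ((hz j hj').2.2.2 i).2 h.symm
    · exact hWR _ (hz i hi').1 (h ▸ hwW j hjJ)
    · exact ((hz i hi').2.2.2 j).1 h
    · exact ((hz i hi').2.2.2 j).2 h
    · exact hij (hzinj h)
  refine ⟨fun j => x j :: (mid j ++ Q j), fun j => ⟨rfl, ?_, hchain j, ?_⟩, ?_⟩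
  · simp [List.getLast?_cons, List.getLast?_append, hQlast j]
  · rw [List.nodup_cons, List.mem_append, not_or]
    exact ⟨⟨fun h => hmidX j _ h (hxX j), fun h => (hQU j _ h).1 (hxX j)⟩,
      List.Nodup.append (hnodup j) (hQnodup j) fun v h h' => hmidQ j j v h h'⟩
  · intro i j hij v hi hj
    rw [List.mem_cons, List.mem_append] at hi hj
    rcases hi with rfl | hi | hi <;> rcases hj with h | hj | hj
    · exact hij (hx h)
    · exact hmidX j _ hj (hxX i)
    · exact (hQU j _ hj).1 (hxX i)
    · exact hmidX i v hi (h ▸ hxX j)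
    · exact hmiddisj i j hij v hi hj
    · exact hmidQ i j v hi hj
    · exact (hQU i v hi).1 (h ▸ hxX j)
    · exact hmidQ j i v hj hi
    · exact hQdisj i j hij v hi hj
end

section
/- Let k ≥ 2 be an integer and suppose D = H[S_1,…,S_h] is a semicomplete composition with the property that |V(D) \ V(S_i)| ≥ 2k−3 for each i ∈ [h]. If D is 3k-strong and δ⁺(D) ≥ 23k, then D is k-linked. -/
/-- `b` is reachable from `a` by a walk all of whose arcs have both ends in `U`. -/
def ReachIn {V : Type} (adj : V → V → Prop) (U : Set V) : V → V → Prop :=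
  Relation.ReflTransGen fun u v => adj u v ∧ u ∈ U ∧ v ∈ U

namespace ReachIn

variable {V : Type} {adj adj' : V → V → Prop} {U U' : Set V} {a b c : V}

theorem refl : ReachIn adj U a a := Relation.ReflTransGen.refl

theorem trans (h : ReachIn adj U a b) (h' : ReachIn adj U b c) : ReachIn adj U a c :=
  Relation.ReflTransGen.trans h h'

theorem single (h : adj a b) (ha : a ∈ U) (hb : b ∈ U) : ReachIn adj U a b :=
  Relation.ReflTransGen.single ⟨h, ha, hb⟩

theorem mono (hadj : ∀ u v, u ∈ U → v ∈ U → adj u v → adj' u v) (hU : U ⊆ U')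
    (h : ReachIn adj U a b) : ReachIn adj' U' a b :=
  Relation.ReflTransGen.mono
    (fun u v huv => ⟨hadj u v huv.2.1 huv.2.2 huv.1, hU huv.2.1, hU huv.2.2⟩) a b h

theorem exists_isPathOn {G : Digr V} (h : ReachIn G.Adj U a b) (hb : b ∈ U) :
    ∃ p, G.IsPathOn U p a b := by
  induction h using Relation.ReflTransGen.head_induction_on with
  | refl => exact ⟨[b], ⟨by simp, by simp, List.isChain_singleton b, by simp⟩, by simpa using hb⟩
  | @head a c hac _ ih =>
    obtain ⟨p, ⟨h1, h2, h3, h4⟩, h5⟩ := ih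
    by_cases hap : a ∈ p
    · obtain ⟨l₁, l₂, rfl⟩ := List.append_of_mem hap
      refine ⟨a :: l₂, ⟨by simp, ?_, ?_, ?_⟩, ?_⟩
      · rw [← h2, List.getLast?_append_of_ne_nil _ (by simp)]
      · exact (List.isChain_append.1 h3).2.1
      · exact (List.nodup_append.1 h4).2.1
      · intro v hv
        exact h5 v (by simp only [List.mem_append]; exact Or.inr hv)
    · refine ⟨a :: p, ⟨by simp, ?_, ?_, ?_⟩, ?_⟩
      · cases p with
        | nil => simp at h1
        | cons d t => rw [← h2]; simp
      · refine List.isChain_cons.2 ⟨?_, h3⟩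
        intro y hy
        rw [h1] at hy
        simp only [Option.mem_def, Option.some.injEq] at hy
        exact hy ▸ hac.1
      · exact List.nodup_cons.2 ⟨hap, h4⟩
      · intro v hv
        rcases List.mem_cons.1 hv with rfl | hv
        · exact hac.2.1
        · exact h5 v hv

theorem of_isPathOn {G : Digr V} {p : List V} (h : G.IsPathOn U p a b) : ReachIn G.Adj U a b := by
  obtain ⟨⟨h1, h2, h3, -⟩, h5⟩ := h
  induction p generalizing a with
  | nil => simp at h1
  | cons d t ih =>
    simp only [List.head?_cons, Option.some.injEq] at h1
    subst h1
    cases t with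
    | nil =>
      simp only [List.getLast?_singleton, Option.some.injEq] at h2
      subst h2
      exact refl
    | cons e t =>
      have h3' := List.isChain_cons_cons.1 h3
      refine (single h3'.1 (h5 d (by simp)) (h5 e (by simp))).trans
        (ih (a := e) (fun v hv => h5 v (List.mem_cons_of_mem _ hv)) (by simp) ?_ h3'.2)
      rw [← h2]; simp

end ReachIn

theorem Digr.KLinked.of_reachIn {V : Type} [Fintype V] {G : Digr V} {k : ℕ}
    (hcard : 2 * k ≤ Fintype.card V)
    (h : ∀ x y : Fin k → V, Function.Injective (Sum.elim x y) →
      ∃ U : Fin k → Set V, (∀ i, ReachIn G.Adj (U i) (x i) (y i)) ∧ (∀ i, y i ∈ U i) ∧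
        ∀ i j, i ≠ j → ∀ v, v ∈ U i → v ∉ U j) : G.KLinked k := by
  refine ⟨hcard, fun x y hxy => ?_⟩
  obtain ⟨U, hU, hy, hdisj⟩ := h x y hxy
  choose P hP using fun i => (hU i).exists_isPathOn (hy i)
  exact ⟨P, fun i => (hP i).1,
    fun i j hij v hvi hvj => hdisj i j hij v ((hP i).2 v hvi) ((hP j).2 v hvj)⟩

theorem Digr.KStrong.reachIn {V : Type} [Fintype V] {G : Digr V} {k : ℕ} (h : G.KStrong k)
    (S : Finset V) (hS : S.card ≤ k - 1) {a b : V} (ha : a ∉ S) (hb : b ∉ S) :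
    ReachIn G.Adj ((S : Set V)ᶜ) a b := by
  by_cases hab : a = b
  · subst hab; exact ReachIn.refl
  · obtain ⟨p, hp⟩ := h.2 S hS a (by simpa using ha) b (by simpa using hb) hab
    exact ReachIn.of_isPathOn hp

/-- Disjoint walks `q j 0, q j 1, …, q j (len j) = y j`, each starting in `A`. -/
structure IsLinkage {V : Type} {k : ℕ} (adj : V → V → Prop) (A : Finset V) (y : Fin k → V)
    (q : Fin k → ℕ → V) (len : Fin k → ℕ) : Prop where
  start : ∀ j, q j 0 ∈ A
  finish : ∀ j, q j (len j) = y j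
  arc : ∀ j p, p < len j → adj (q j p) (q j (p + 1))
  disjoint : ∀ j j' p p', p ≤ len j → p' ≤ len j' → j ≠ j' → q j p ≠ q j' p'

open Classical in
/-- Menger's theorem, in the form linking every vertex of a target set to a source set. -/
theorem exists_isLinkage {V : Type} [Fintype V] {k : ℕ} (adj : V → V → Prop) (A : Finset V)
    (y : Fin k → V) (hy : Function.Injective y)
    (hsep : ∀ S : Finset V, S.card < k →
      ∃ a ∈ A, ∃ j, y j ∉ S ∧ ReachIn adj ((S : Set V)ᶜ) a (y j)) :
    ∃ q len, IsLinkage adj A y q len := by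
  set B : Finset V := Finset.univ.image y with hB
  have hBcard : B.card = k := by
    rw [hB, Finset.card_image_of_injective _ hy, Finset.card_univ, Fintype.card_fin]
  let t : {v // v ∉ A} → Finset V := fun v =>
    Finset.univ.filter fun u => u ∉ B ∧ (u = v.1 ∨ adj u v.1)
  obtain ⟨g, hginj, hg⟩ : ∃ g, Function.Injective g ∧ ∀ v, g v ∈ t v := by
    rw [← Finset.all_card_le_biUnion_card_iff_exists_injective]
    intro s
    set T : Finset V := s.map ⟨Subtype.val, Subtype.val_injective⟩ with hT
    have hTA : ∀ v ∈ T, v ∉ A := by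
      intro v hv
      simp only [hT, Finset.mem_map, Function.Embedding.coeFn_mk] at hv
      obtain ⟨w, -, rfl⟩ := hv
      exact w.2
    have hTs : T.card = s.card := Finset.card_map _
    set N : Finset V := Finset.univ.filter fun u => u ∉ T ∧ u ∉ B ∧ ∃ v ∈ T, adj u v with hN
    have hle : k ≤ (N ∪ B \ T).card := by
      by_contra! hlt
      obtain ⟨a, haA, j, hj, hreach⟩ := hsep _ hlt
      have hyT : y j ∈ T := by
        by_contra hyT
        exact hj (by simp [hB, hyT])
      refine hTA a ?_ haA
      clear haA
      induction hreach using Relation.ReflTransGen.head_induction_on with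
      | refl => exact hyT
      | @head u v huv _ ih =>
        have hu : u ∉ N ∪ B \ T := by simpa using huv.2.1
        by_contra huT
        by_cases huB : u ∈ B
        · exact hu (Finset.mem_union_right _ (Finset.mem_sdiff.2 ⟨huB, huT⟩))
        · exact hu (Finset.mem_union_left _ (by simpa [hN, huT, huB] using ⟨v, ih, huv.1⟩))
    have hsub : T \ B ∪ N ⊆ s.biUnion t := by
      intro u hu
      rcases Finset.mem_union.1 hu with hu | hu
      · obtain ⟨huT, huB⟩ := Finset.mem_sdiff.1 hu
        simp only [hT, Finset.mem_map, Function.Embedding.coeFn_mk] at huT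
        obtain ⟨w, hw, rfl⟩ := huT
        exact Finset.mem_biUnion.2 ⟨w, hw, by simp [t, huB]⟩
      · simp only [hN, Finset.mem_filter, Finset.mem_univ, true_and] at hu
        obtain ⟨-, huB, v, hv, huv⟩ := hu
        simp only [hT, Finset.mem_map, Function.Embedding.coeFn_mk] at hv
        obtain ⟨w, hw, rfl⟩ := hv
        exact Finset.mem_biUnion.2 ⟨w, hw, by simp [t, huB, huv]⟩
    have hdisj : Disjoint (T \ B) N := by
      rw [Finset.disjoint_left]
      intro u hu hu'
      simp only [hN, Finset.mem_filter] at hu'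
      exact hu'.2.1 (Finset.mem_sdiff.1 hu).1
    have h1 := Finset.card_le_card hsub
    rw [Finset.card_union_of_disjoint hdisj] at h1
    have h2 := Finset.card_union_le N (B \ T)
    have h3 := Finset.card_sdiff_add_card_inter T B
    have h4 := Finset.card_sdiff_add_card_inter B T
    rw [Finset.inter_comm] at h4
    omega
  have hgB : ∀ v, g v ∉ B := fun v => by
    have := hg v
    simp only [t, Finset.mem_filter] at this
    exact this.2.1
  have hgadj : ∀ v, g v = v.1 ∨ adj (g v) v.1 := fun v => by
    have := hg v
    simp only [t, Finset.mem_filter] at this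
    exact this.2.2
  let G : V → V := fun v => if h : v ∉ A then g ⟨v, h⟩ else v
  have hG : ∀ v (h : v ∉ A), G v = g ⟨v, h⟩ := fun v h => dif_pos h
  have hGinj : ∀ u v, u ∉ A → v ∉ A → G u = G v → u = v := by
    intro u v hu hv huv
    rw [hG u hu, hG v hv] at huv
    exact congrArg Subtype.val (hginj huv)
  have hyB : ∀ j, y j ∈ B := fun j => Finset.mem_image_of_mem _ (Finset.mem_univ j)
  have huniq : ∀ m m' j j', (∀ p < m, G^[p] (y j) ∉ A) → (∀ p < m', G^[p] (y j') ∉ A) →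
      G^[m] (y j) = G^[m'] (y j') → j = j' ∧ m = m' := by
    intro m
    induction m with
    | zero =>
      intro m' j j' _ h' heq
      cases m' with
      | zero => exact ⟨hy (by simpa using heq), rfl⟩
      | succ m' =>
        rw [Function.iterate_succ_apply', hG _ (h' m' (by omega))] at heq
        exact absurd (hyB j) (by rw [show y j = _ from heq]; exact hgB _)
    | succ m ih =>
      intro m' j j' h h' heq
      cases m' with
      | zero =>
        rw [Function.iterate_succ_apply', hG _ (h m (by omega))] at heq
        exact absurd (hyB j') (by rw [show y j' = _ from heq.symm]; exact hgB _)
      | succ m' =>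
        rw [Function.iterate_succ_apply', Function.iterate_succ_apply'] at heq
        obtain ⟨h1, h2⟩ := ih m' j j' (fun p hp => h p (by omega)) (fun p hp => h' p (by omega))
          (hGinj _ _ (h m (by omega)) (h' m' (by omega)) heq)
        exact ⟨h1, by omega⟩
  have hex : ∀ j, ∃ n, G^[n] (y j) ∈ A := by
    intro j
    by_contra! hno
    refine not_injective_infinite_finite (fun n : ℕ => G^[n] (y j)) fun m m' heq => ?_
    exact (huniq m m' j j (fun p _ => hno p) (fun p _ => hno p) heq).2
  let n : Fin k → ℕ := fun j => Nat.find (hex j)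
  have hn : ∀ j, G^[n j] (y j) ∈ A := fun j => Nat.find_spec (hex j)
  have hlt : ∀ j p, p < n j → G^[p] (y j) ∉ A := fun j p hp => Nat.find_min (hex j) hp
  refine ⟨fun j p => G^[n j - p] (y j), n, ⟨fun j => by simpa using hn j, fun j => by simp, ?_, ?_⟩⟩
  · intro j p hp
    have hA := hlt j (n j - (p + 1)) (by omega)
    have hs : n j - p = (n j - (p + 1)) + 1 := by omega
    have hGs : G^[n j - p] (y j) = g ⟨_, hA⟩ := by
      rw [hs, Function.iterate_succ_apply', hG _ hA]
    show adj (G^[n j - p] (y j)) (G^[n j - (p + 1)] (y j))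
    rcases hgadj ⟨_, hA⟩ with h | h
    · rw [← hGs] at h
      have := (huniq _ _ j j (fun q hq => hlt j q (by omega)) (fun q hq => hlt j q (by omega)) h).2
      omega
    · rwa [hGs]
  · intro j j' p p' _ _ hjj' heq
    exact hjj' (huniq _ _ j j' (fun q hq => hlt j q (by omega)) (fun q hq => hlt j' q (by omega))
      heq).1

/-- The first `p` vertices of a walk in a shortest linkage cannot be replaced by fewer than `p`
vertices off the other walks. -/
theorem IsLinkage.le_of_shortcut {V : Type} {k : ℕ} {adj : V → V → Prop} {A : Finset V}
    {y : Fin k → V} {q : Fin k → ℕ → V} {len : Fin k → ℕ} (h : IsLinkage adj A y q len)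
    (hmin : ∀ q' len', IsLinkage adj A y q' len' → ∑ j, len j ≤ ∑ j, len' j)
    {j : Fin k} {p m : ℕ} (hp : p ≤ len j) (r : ℕ → V)
    (hstart : if m = 0 then q j p ∈ A else r 0 ∈ A) (harc : ∀ s, s + 1 < m → adj (r s) (r (s + 1)))
    (hlast : m ≠ 0 → adj (r (m - 1)) (q j p))
    (hoff : ∀ s < m, ∀ j', j' ≠ j → ∀ p' ≤ len j', r s ≠ q j' p') : p ≤ m := by
  let r' : ℕ → V := fun s => if s < m then r s else q j (p + (s - m))
  have hnew : IsLinkage adj A y (Function.update q j r')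
      (Function.update len j (m + (len j - p))) := by
    have hoff' : ∀ j', j' ≠ j → ∀ s ≤ m + (len j - p), ∀ p' ≤ len j', r' s ≠ q j' p' := by
      intro j' hj' s hs p' hp'
      by_cases hsm : s < m
      · simpa [r', hsm] using hoff s hsm j' hj' p' hp'
      · simpa [r', hsm] using h.disjoint j j' (p + (s - m)) p' (by omega) hp' hj'.symm
    refine ⟨fun i => ?_, fun i => ?_, fun i s hs => ?_, fun i i' s s' hs hs' hii' => ?_⟩
    · by_cases hi : i = j
      · subst hi
        by_cases hm : m = 0
        · simpa [r', hm] using hstart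
        · simpa [r', hm, Nat.pos_of_ne_zero hm] using hstart
      · simpa [Function.update_of_ne hi] using h.start i
    · by_cases hi : i = j
      · subst hi
        have : p + (len i - p) = len i := by omega
        simpa [r', this] using h.finish i
      · simpa [Function.update_of_ne hi] using h.finish i
    · by_cases hi : i = j
      · subst hi
        simp only [Function.update_self] at hs ⊢
        rcases lt_trichotomy (s + 1) m with hsm | hsm | hsm
        · simpa [r', hsm, (by omega : s < m)] using harc s hsm
        · have := hlast (by omega)
          subst hsm
          simpa [r'] using this
        · have h1 : ¬ s < m := by omega
          have h2 : ¬ s + 1 < m := by omega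
          have h3 : p + (s + 1 - m) = p + (s - m) + 1 := by omega
          simpa [r', h1, h2, h3] using h.arc i (p + (s - m)) (by omega)
      · simp only [Function.update_of_ne hi] at hs ⊢
        exact h.arc i s hs
    · by_cases hi : i = j
      · subst hi
        simp only [Function.update_self, Function.update_of_ne hii'.symm] at hs hs' ⊢
        exact hoff' i' hii'.symm s hs s' hs'
      · by_cases hi' : i' = j
        · subst hi'
          simp only [Function.update_self, Function.update_of_ne hi] at hs hs' ⊢
          exact (hoff' i hi s' hs' s hs).symm
        · simp only [Function.update_of_ne hi, Function.update_of_ne hi'] at hs hs' ⊢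
          exact h.disjoint i i' s s' hs hs' hii'
  have hle := hmin _ _ hnew
  rw [Finset.sum_update_of_mem (Finset.mem_univ j),
    ← Finset.add_sum_erase _ _ (Finset.mem_univ j), Finset.erase_eq] at hle
  omega

theorem IsLinkage.exists_minimal {V : Type} {k : ℕ} {adj : V → V → Prop} {A : Finset V}
    {y : Fin k → V} (h : ∃ q len, IsLinkage adj A y q len) :
    ∃ q len, IsLinkage adj A y q len ∧
      ∀ q' len', IsLinkage adj A y q' len' → ∑ j, len j ≤ ∑ j, len' j := by
  classical
  have hex : ∃ n, ∃ q len, IsLinkage adj A y q len ∧ ∑ j, len j = n := by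
    obtain ⟨q, len, h⟩ := h
    exact ⟨_, q, len, h, rfl⟩
  obtain ⟨q, len, hq, hn⟩ := Nat.find_spec hex
  exact ⟨q, len, hq, fun q' len' hq' => hn ▸ Nat.find_min' hex ⟨q', len', hq', rfl⟩⟩

theorem Finset.exists_top_subset {V : Type} [DecidableEq V] (M : Finset V) (d : V → ℕ) (m : ℕ)
    (hm : m ≤ M.card) :
    ∃ W ⊆ M, W.card = m ∧ ∀ w ∈ W, ∀ u ∈ M \ W, d u ≤ d w := by
  induction m with
  | zero => exact ⟨∅, by simp, by simp, by simp⟩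
  | succ m ih =>
    obtain ⟨W, hWM, hW, hd⟩ := ih (by omega)
    have hne : (M \ W).Nonempty := by
      rw [← Finset.card_pos, Finset.card_sdiff_of_subset hWM]; omega
    obtain ⟨z, hz, hmax⟩ := Finset.exists_max_image (M \ W) d hne
    obtain ⟨hzM, hzW⟩ := Finset.mem_sdiff.1 hz
    refine ⟨insert z W, Finset.insert_subset hzM hWM, by rw [Finset.card_insert_of_notMem hzW, hW],
      fun w hw u hu => ?_⟩
    have hu' : u ∈ M \ W := by
      simp only [Finset.mem_sdiff, Finset.mem_insert, not_or] at hu ⊢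
      exact ⟨hu.1, hu.2.2⟩
    rcases Finset.mem_insert.1 hw with rfl | hw
    · exact hmax u hu'
    · exact hd w hw u hu'

open Classical in
theorem exists_large_inDegree {V : Type} (adj : V → V → Prop) (A : Finset V) (hA : A.Nonempty)
    (hsemi : ∀ u ∈ A, ∀ v ∈ A, u ≠ v → adj u v ∨ adj v u) :
    ∃ u ∈ A, A.card ≤ 2 * (A.filter fun v => adj v u).card + 1 := by
  have hsum : ∑ u ∈ A, (A.filter fun v => adj u v).card =
      ∑ u ∈ A, (A.filter fun v => adj v u).card :=
    Finset.sum_card_bipartiteAbove_eq_sum_card_bipartiteBelow adj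
  have hle : ∑ u ∈ A, A.card ≤ ∑ u ∈ A, (2 * (A.filter fun v => adj v u).card + 1) := by
    calc ∑ u ∈ A, A.card
        ≤ ∑ u ∈ A, ((A.filter fun v => adj u v).card + (A.filter fun v => adj v u).card + 1) := by
          refine Finset.sum_le_sum fun u hu => ?_
          have hsub : A ⊆ (A.filter fun v => adj u v) ∪ (A.filter fun v => adj v u) ∪ {u} := by
            intro v hv
            by_cases huv : u = v
            · simp [huv]
            · simp only [Finset.mem_union, Finset.mem_filter, Finset.mem_singleton]
              have := hsemi u hu v hv huv
              tauto
          have h1 := Finset.card_le_card hsub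
          have h2 := Finset.card_union_le
            ((A.filter fun v => adj u v) ∪ (A.filter fun v => adj v u)) {u}
          have h3 := Finset.card_union_le (A.filter fun v => adj u v) (A.filter fun v => adj v u)
          simp only [Finset.card_singleton] at h2
          omega
      _ = _ := by
          simp only [Finset.sum_add_distrib, two_mul, hsum]
  exact Finset.exists_le_of_sum_le hA hle

theorem exists_injective_choice {V : Type} [DecidableEq V] {k : ℕ} (t : Fin k → Finset V)
    (ht : ∀ i, k ≤ (t i).card) : ∃ c : Fin k → V, Function.Injective c ∧ ∀ i, c i ∈ t i := by
  rw [← Finset.all_card_le_biUnion_card_iff_exists_injective]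
  intro s
  rcases s.eq_empty_or_nonempty with rfl | ⟨i, hi⟩
  · simp
  · have h1 := Finset.card_le_univ s
    rw [Fintype.card_fin] at h1
    exact h1.trans ((ht i).trans (Finset.card_le_card (Finset.subset_biUnion_of_mem t hi)))

open Classical in
theorem exists_maximal_partial_transversal {V : Type} {k : ℕ} (t : Fin k → Finset V)
    (v₀ : V) : ∃ (I : Finset (Fin k)) (f : Fin k → V), Set.InjOn f I ∧ (∀ i ∈ I, f i ∈ t i) ∧
      ∀ i ∉ I, t i ⊆ I.image f := by
  obtain ⟨I, hI, hmax⟩ := Finset.exists_max_image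
    (Finset.univ.filter fun I : Finset (Fin k) =>
      ∃ f : Fin k → V, Set.InjOn f I ∧ ∀ i ∈ I, f i ∈ t i) Finset.card
    ⟨∅, by simpa using Or.inr ⟨v₀⟩⟩
  simp only [Finset.mem_filter, Finset.mem_univ, true_and] at hI hmax
  obtain ⟨f, hf, hft⟩ := hI
  refine ⟨I, f, hf, hft, fun i hi u hu => ?_⟩
  by_contra hno
  have hne : ∀ j ∈ I, j ≠ i := fun j hj hji => hi (hji ▸ hj)
  have := hmax (insert i I) ⟨Function.update f i u, ?_, ?_⟩
  · rw [Finset.card_insert_of_notMem hi] at this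
    omega
  · rw [Finset.coe_insert, Set.injOn_insert (by simpa using hi)]
    constructor
    · intro a ha b hb hab
      rw [Function.update_of_ne (hne a ha), Function.update_of_ne (hne b hb)] at hab
      exact hf ha hb hab
    · rintro ⟨a, ha, hau⟩
      rw [Function.update_of_ne (hne a ha), Function.update_self] at hau
      exact hno (Finset.mem_image.2 ⟨a, ha, hau⟩)
  · intro j hj
    rcases Finset.mem_insert.1 hj with rfl | hj
    · simpa using hu
    · rw [Function.update_of_ne (hne j hj)]
      exact hft j hj

theorem exists_disjoint_pairs {V : Type} [DecidableEq V] {k : ℕ} (Φ : Fin k → V → V → Prop)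
    (v₀ : V) (h : ∀ i (P : Finset V), P.card ≤ 2 * (k - 1) → ∃ u v, u ∉ P ∧ v ∉ P ∧ Φ i u v) :
    ∃ u v : Fin k → V, (∀ i, Φ i (u i) (v i)) ∧
      ∀ i j, i ≠ j → u i ≠ u j ∧ u i ≠ v j ∧ v i ≠ v j := by
  have key : ∀ s : Finset (Fin k), ∃ u v : Fin k → V, (∀ i ∈ s, Φ i (u i) (v i)) ∧
      ∀ i ∈ s, ∀ j ∈ s, i ≠ j → u i ≠ u j ∧ u i ≠ v j ∧ v i ≠ v j := by
    intro s
    induction s using Finset.induction_on with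
    | empty => exact ⟨fun _ => v₀, fun _ => v₀, by simp, by simp⟩
    | insert a s ha ih =>
      obtain ⟨u, v, hΦ, hd⟩ := ih
      have hs : s.card + 1 ≤ k := by
        have := Finset.card_le_univ (insert a s)
        rwa [Finset.card_insert_of_notMem ha, Fintype.card_fin] at this
      obtain ⟨u', v', hu', hv', hΦ'⟩ := h a (s.image u ∪ s.image v) (by
        have h1 := Finset.card_union_le (s.image u) (s.image v)
        have h2 : (s.image u).card ≤ s.card := Finset.card_image_le
        have h3 : (s.image v).card ≤ s.card := Finset.card_image_le
        omega)
      simp only [Finset.mem_union, Finset.mem_image, not_or, not_exists, not_and] at hu' hv'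
      have hne : ∀ j ∈ s, j ≠ a := fun j hj hja => ha (hja ▸ hj)
      refine ⟨Function.update u a u', Function.update v a v', ?_, ?_⟩
      · intro i hi
        rcases Finset.mem_insert.1 hi with rfl | hi
        · simpa using hΦ'
        · simpa [Function.update_of_ne (hne i hi)] using hΦ i hi
      · intro i hi j hj hij
        rcases Finset.mem_insert.1 hi with hi' | hi' <;>
          rcases Finset.mem_insert.1 hj with hj' | hj'
        · exact absurd (hi'.trans hj'.symm) hij
        · subst hi'
          simp only [Function.update_self, Function.update_of_ne (hne j hj')]
          exact ⟨(hu'.1 j hj' ·.symm), (hu'.2 j hj' ·.symm), (hv'.2 j hj' ·.symm)⟩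
        · subst hj'
          simp only [Function.update_self, Function.update_of_ne (hne i hi')]
          exact ⟨(hu'.1 i hi' ·), (hv'.1 i hi' ·), (hv'.2 i hi' ·)⟩
        · simp only [Function.update_of_ne (hne i hi'), Function.update_of_ne (hne j hj')]
          exact hd i hi' j hj' hij
  obtain ⟨u, v, h1, h2⟩ := key Finset.univ
  exact ⟨u, v, fun i => h1 i (Finset.mem_univ i),
    fun i j => h2 i (Finset.mem_univ i) j (Finset.mem_univ j)⟩

open Classical in
/-- Linkage for digraphs that are semicomplete apart from arcs at the terminal vertices `y`. -/
theorem exists_disjoint_reachIn {V : Type} [Fintype V] {k : ℕ} (hk : 1 ≤ k) (adj : V → V → Prop)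
    (x y : Fin k → V) (hxy : Function.Injective (Sum.elim x y))
    (hsemi : ∀ u v, u ≠ v → (∀ j, u ≠ y j) → (∀ j, v ≠ y j) → adj u v ∨ adj v u)
    (hdeg : ∀ v, (∀ j, v ≠ y j) →
      22 * k ≤ (Finset.univ.filter fun u => adj v u ∧ ∀ j, u ≠ y j).card)
    (hstr : ∀ S : Finset V, S.card ≤ 3 * k - 1 → ∀ a b, a ∉ S → b ∉ S →
      ReachIn adj ((S : Set V)ᶜ) a b) :
    ∃ U : Fin k → Set V, (∀ i, ReachIn adj (U i) (x i) (y i)) ∧ (∀ i, y i ∈ U i) ∧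
      ∀ i j, i ≠ j → ∀ v, v ∈ U i → v ∉ U j := by
  have hxinj : Function.Injective x := hxy.comp Sum.inl_injective
  have hyinj : Function.Injective y := hxy.comp Sum.inr_injective
  have hxney : ∀ i j, x i ≠ y j := fun i j h => by
    have := @hxy (Sum.inl i) (Sum.inr j) h
    simp at this
  let i₀ : Fin k := ⟨0, hk⟩
  have hcard : ∀ g : Fin k → V, (Finset.univ.image g).card ≤ k := fun g =>
    Finset.card_image_le.trans (by simp)
  set X : Finset V := Finset.univ.image x with hX
  have hXc : X.card ≤ k := hcard x
  have hxX : ∀ i, x i ∈ X := fun i => Finset.mem_image_of_mem _ (Finset.mem_univ i)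
  have hyX : ∀ j, y j ∉ X := fun j h => by
    obtain ⟨i, -, hi⟩ := Finset.mem_image.1 h
    exact hxney i j hi
  set M : Finset V := Finset.univ.filter fun u => u ∉ X ∧ ∀ j, u ≠ y j with hM
  have hMmem : ∀ u, u ∈ M ↔ u ∉ X ∧ ∀ j, u ≠ y j := fun u => by simp [hM]
  have hMc : 21 * k ≤ M.card := by
    have h1 := hdeg (x i₀) (hxney i₀)
    have h2 : (Finset.univ.filter fun u => adj (x i₀) u ∧ ∀ j, u ≠ y j) ⊆ M ∪ X := by
      intro u hu
      simp only [Finset.mem_filter, Finset.mem_univ, true_and] at hu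
      by_cases huX : u ∈ X
      · exact Finset.mem_union_right _ huX
      · exact Finset.mem_union_left _ ((hMmem u).2 ⟨huX, hu.2⟩)
    have h3 := Finset.card_le_card h2
    have h4 := Finset.card_union_le M X
    omega
  obtain ⟨W, hWM, hWc, hWtop⟩ := Finset.exists_top_subset M
    (fun u => (M.filter fun v => adj v u).card) (3 * k) (by omega)
  -- `bad` vertices are dominated by more than `k` vertices of `W`
  let bad : V → Prop := fun u => k < (W.filter fun w => adj w u).card
  obtain ⟨I, f, hfinj, hft, hImax⟩ := exists_maximal_partial_transversal
    (fun i : Fin k => (M \ W).filter fun u => adj (x i) u ∧ ¬ bad u) (x i₀)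
  simp only [Finset.mem_filter, Finset.mem_sdiff] at hft
  set X' : Finset V := I.image f with hX'
  have hX'c : X'.card ≤ k := Finset.card_image_le.trans ((Finset.card_le_univ I).trans (by simp))
  have hX'M : ∀ u ∈ X', u ∈ M ∧ u ∉ W := by
    intro u hu
    obtain ⟨i, hi, rfl⟩ := Finset.mem_image.1 hu
    exact (hft i hi).1
  set Z : Finset V := X ∪ X' with hZ
  have hZc : Z.card ≤ 2 * k := (Finset.card_union_le X X').trans (by omega)
  have hyZ : ∀ j, y j ∉ Z := by
    intro j hj
    rcases Finset.mem_union.1 hj with h | h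
    · exact hyX j h
    · exact ((hMmem _).1 (hX'M _ h).1).2 j rfl
  have hWZ : ∀ w ∈ W, w ∉ Z := by
    intro w hw hj
    rcases Finset.mem_union.1 hj with h | h
    · exact ((hMmem _).1 (hWM hw)).1 h
    · exact (hX'M _ h).2 hw
  obtain ⟨q, len, hq, hmin⟩ := IsLinkage.exists_minimal
    (exists_isLinkage (fun u v => adj u v ∧ u ∉ Z ∧ v ∉ Z) W y hyinj (by
      intro S hS
      obtain ⟨a, haW, haS⟩ : ∃ a ∈ W, a ∉ S := by
        by_contra! h
        have := Finset.card_le_card (show W ⊆ S from h)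
        omega
      obtain ⟨j, hj⟩ : ∃ j, y j ∉ S := by
        by_contra! h
        have h1 : Finset.univ.image y ⊆ S := by
          intro v hv
          obtain ⟨j, -, rfl⟩ := Finset.mem_image.1 hv
          exact h j
        have h2 := Finset.card_le_card h1
        rw [Finset.card_image_of_injective _ hyinj, Finset.card_univ, Fintype.card_fin] at h2
        omega
      refine ⟨a, haW, j, hj, ?_⟩
      have h3 := Finset.card_union_le Z S
      refine (hstr (Z ∪ S) (by omega) a (y j) ?_ ?_).mono ?_ ?_
      · simpa [not_or] using ⟨hWZ a haW, haS⟩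
      · simpa [not_or] using ⟨hyZ j, hj⟩
      · intro u v hu hv huv
        simp only [Finset.coe_union, Set.mem_compl_iff, Set.mem_union, Finset.mem_coe,
          not_or] at hu hv
        exact ⟨huv, hu.1, hv.1⟩
      · intro u hu
        simp only [Finset.coe_union, Set.mem_compl_iff, Set.mem_union, Finset.mem_coe,
          not_or] at hu ⊢
        exact hu.2))
  have hqZ : ∀ j p, p ≤ len j → q j p ∉ Z := by
    intro j p hp
    rcases hp.lt_or_eq with hp | rfl
    · exact (hq.arc j p hp).2.1
    · rw [hq.finish]; exact hyZ j
  have hqW : ∀ j p, p ≤ len j → q j p ∈ W → p = 0 := by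
    intro j p hp hw
    have := hq.le_of_shortcut hmin hp (m := 0) (q j) (by simpa using hw) (by simp) (by simp) (by simp)
    omega
  set used : Finset V := Finset.univ.image fun j => q j 0 with hused
  have husedc : used.card ≤ k := hcard _
  have hmem_used : ∀ j, q j 0 ∈ used := fun j => Finset.mem_image_of_mem _ (Finset.mem_univ j)
  have hnot_on : ∀ w ∈ W, w ∉ used → ∀ j p, p ≤ len j → w ≠ q j p := by
    rintro w hw hwu j p hp rfl
    have := hqW j p hp hw
    subst this
    exact hwu (hmem_used j)
  have harc_one : ∀ w ∈ W, w ∉ used → ∀ j p, p ≤ len j → adj w (q j p) → p ≤ 1 := by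
    intro w hw hwu j p hp hadj
    exact hq.le_of_shortcut hmin hp (m := 1) (fun _ => w) (by simpa using hw) (by omega)
      (fun _ => ⟨hadj, hWZ w hw, hqZ j p hp⟩) (fun _ _ j' _ p' hp' => hnot_on w hw hwu j' p' hp')
  have harc_two : ∀ w ∈ W, w ∉ used → ∀ u, adj w u → u ∉ Z → (∀ j p, p ≤ len j → u ≠ q j p) →
      ∀ j p, p ≤ len j → adj u (q j p) → p ≤ 2 := by
    intro w hw hwu u hadj huZ huq j p hp hadj'
    refine hq.le_of_shortcut hmin hp (m := 2) (fun s => if s = 0 then w else u) (by simpa using hw)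
      ?_ (fun _ => ⟨by simpa using hadj', by simpa using huZ, hqZ j p hp⟩) ?_
    · intro s hs
      have : s = 0 := by omega
      subst this
      exact ⟨by simpa using hadj, by simpa using hWZ w hw, by simpa using huZ⟩
    · intro s _ j' _ p' hp'
      by_cases hs : s = 0
      · simpa [hs] using hnot_on w hw hwu j' p' hp'
      · simpa [hs] using huq j' p' hp'
  have hWused : 2 * k ≤ (W \ used).card := by
    have := Finset.le_card_sdiff used W
    omega
  obtain ⟨c, hcinj, hc⟩ := exists_injective_choice
    (fun i => (W \ used).filter fun w => i ∈ I → adj (f i) w) (by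
      intro i
      by_cases hi : i ∈ I
      · obtain ⟨⟨hfM, hfW⟩, -, hgood⟩ := hft i hi
        have h1 : W \ used ⊆ ((W \ used).filter fun w => i ∈ I → adj (f i) w) ∪
            (W.filter fun w => adj w (f i)) := by
          intro w hw
          have hwW := (Finset.mem_sdiff.1 hw).1
          have := hsemi w (f i) (fun h => hfW (h ▸ hwW)) ((hMmem _).1 (hWM hwW)).2
            ((hMmem _).1 hfM).2
          simp only [Finset.mem_union, Finset.mem_filter]
          tauto
        have h2 := Finset.card_le_card h1
        have h3 := Finset.card_union_le ((W \ used).filter fun w => i ∈ I → adj (f i) w)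
          (W.filter fun w => adj w (f i))
        simp only [bad, not_lt] at hgood
        omega
      · simp only [hi, false_imp_iff, Finset.filter_true]
        omega)
  simp only [Finset.mem_filter, Finset.mem_sdiff] at hc
  set C : Finset V := Finset.univ.image c with hC
  have hCc : C.card ≤ k := hcard c
  have hcC : ∀ i, c i ∈ C := fun i => Finset.mem_image_of_mem _ (Finset.mem_univ i)
  have hCW : C ⊆ W := by
    intro w hw
    obtain ⟨i, -, rfl⟩ := Finset.mem_image.1 hw
    exact (hc i).1.1
  set Q₁ : Finset V := Finset.univ.image fun j => q j 1 with hQ₁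
  have hQ₁c : Q₁.card ≤ k := hcard _
  set Q₂ : Finset V := Finset.univ.image fun j => q j 2 with hQ₂
  have hQ₂c : Q₂.card ≤ k := hcard _
  let src : Fin k → V := fun i => if i ∈ I then c i else x i
  have hsrc : ∀ i j, src i ≠ y j := by
    intro i j
    by_cases hi : i ∈ I
    · simpa [src, hi] using ((hMmem _).1 (hWM (hc i).1.1)).2 j
    · simpa [src, hi] using hxney i j
  let A : Fin k → Finset V := fun i =>
    (Finset.univ.filter fun u => adj (src i) u ∧ ∀ j, u ≠ y j) \ (X ∪ W ∪ X' ∪ Q₁)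
  have hAc : ∀ i, 16 * k ≤ (A i).card := by
    intro i
    have h1 := hdeg (src i) (hsrc i)
    have h2 := Finset.le_card_sdiff (X ∪ W ∪ X' ∪ Q₁)
      (Finset.univ.filter fun u => adj (src i) u ∧ ∀ j, u ≠ y j)
    have h3 := Finset.card_union_le (X ∪ W ∪ X') Q₁
    have h4 := Finset.card_union_le (X ∪ W) X'
    have h5 := Finset.card_union_le X W
    refine le_trans ?_ h2
    omega
  have hA : ∀ i, ∀ u ∈ A i, adj (src i) u ∧ u ∈ M ∧ u ∉ W ∧ u ∉ X' ∧
      (∃ w ∈ W, w ∉ used ∧ adj w u) ∧ ∀ j p, p ≤ len j → u ≠ q j p := by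
    intro i u hu
    simp only [A, Finset.mem_sdiff, Finset.mem_filter, Finset.mem_univ, true_and, Finset.mem_union,
      not_or] at hu
    obtain ⟨⟨hadj, huy⟩, ⟨⟨huX, huW⟩, huX'⟩, huQ₁⟩ := hu
    have huM : u ∈ M := (hMmem u).2 ⟨huX, huy⟩
    have hw : ∃ w ∈ W, w ∉ used ∧ adj w u := by
      by_cases hi : i ∈ I
      · exact ⟨c i, (hc i).1.1, (hc i).1.2, by simpa [src, hi] using hadj⟩
      · by_contra! hno
        refine huX' (hImax i hi ?_)
        simp only [Finset.mem_filter, Finset.mem_sdiff, bad, not_lt]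
        refine ⟨⟨huM, huW⟩, by simpa [src, hi] using hadj, (Finset.card_le_card ?_).trans husedc⟩
        intro w hw
        obtain ⟨hwW, hwu⟩ := Finset.mem_filter.1 hw
        by_contra hwn
        exact hno w hwW hwn hwu
    refine ⟨hadj, huM, huW, huX', hw, ?_⟩
    rintro j p hp rfl
    obtain ⟨w, hwW, hwn, hwu⟩ := hw
    have h1 := harc_one w hwW hwn j p hp hwu
    interval_cases p
    · exact huW (hq.start j)
    · exact huQ₁ (Finset.mem_image_of_mem _ (Finset.mem_univ j))
  obtain ⟨u, v, huv, hdisj⟩ := exists_disjoint_pairs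
    (fun i u v => u ∈ A i ∧ (v = u ∨ adj u v) ∧ adj v (q i 0) ∧ v ∈ M ∧ v ∉ X' ∧ v ∉ C ∧
      ∀ j p, p ≤ len j → v ≠ q j p) (x i₀) (by
    intro i P hP
    by_contra! hno
    set w := q i 0 with hw
    have hwW : w ∈ W := hq.start i
    set A' := A i \ P with hA'
    have hA'c : 14 * k + 2 ≤ A'.card := by
      have h2 := hAc i
      refine le_trans ?_ (Finset.le_card_sdiff P (A i))
      omega
    have hA'mem : ∀ u ∈ A', u ∈ A i ∧ u ∉ P := fun u hu => Finset.mem_sdiff.1 hu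
    have hnadj : ∀ u ∈ A', ¬ adj u w := by
      intro u hu hadj
      obtain ⟨huA, huP⟩ := hA'mem u hu
      obtain ⟨-, h1, h2, h3, -, h5⟩ := hA i u huA
      obtain ⟨j, p, hp, he⟩ := hno u u huP huP huA (Or.inl rfl) hadj h1 h3 fun h => h2 (hCW h)
      exact h5 j p hp he
    obtain ⟨u, hu, hmax⟩ := exists_large_inDegree adj A' (by
        rw [← Finset.card_pos]; omega) (by
      intro a ha b hb hab
      exact hsemi a b hab ((hMmem _).1 (hA i a (hA'mem a ha).1).2.1).2
        ((hMmem _).1 (hA i b (hA'mem b hb).1).2.1).2)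
    obtain ⟨huA, huP⟩ := hA'mem u hu
    obtain ⟨-, huM, huW, huX', ⟨w', hw'W, hw'u, hw'adj⟩, huq⟩ := hA i u huA
    have huZ : u ∉ Z := by
      simp only [hZ, Finset.mem_union, not_or]
      exact ⟨((hMmem _).1 huM).1, huX'⟩
    set F : Finset V := used ∪ C ∪ X' ∪ Q₁ ∪ Q₂ ∪ P with hF
    have hFc : F.card ≤ 7 * k - 2 := by
      refine (Finset.card_union_le (used ∪ C ∪ X' ∪ Q₁ ∪ Q₂) P).trans ?_
      have h2 := Finset.card_union_le (used ∪ C ∪ X' ∪ Q₁) Q₂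
      have h3 := Finset.card_union_le (used ∪ C ∪ X') Q₁
      have h4 := Finset.card_union_le (used ∪ C) X'
      have h5 := Finset.card_union_le used C
      omega
    have hsub : ((M.filter fun v => adj v w) \ F) ∪ (A'.filter fun v => adj v u) ⊆
        M.filter fun v => adj v u := by
      intro v hv
      rcases Finset.mem_union.1 hv with hv | hv
      · simp only [hF, Finset.mem_sdiff, Finset.mem_filter, Finset.mem_union, not_or] at hv
        obtain ⟨⟨hvM, hvw⟩, ⟨⟨⟨⟨hvused, hvC⟩, hvX'⟩, hvQ₁⟩, hvQ₂⟩, hvP⟩ := hv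
        refine Finset.mem_filter.2 ⟨hvM, ?_⟩
        have hne : v ≠ u := fun h => hnadj u hu (h ▸ hvw)
        refine (hsemi v u hne ((hMmem _).1 hvM).2 ((hMmem _).1 huM).2).resolve_right fun huv => ?_
        obtain ⟨j, p, hp, he⟩ := hno u v huP hvP huA (Or.inr huv) hvw hvM hvX' hvC
        have h2 := harc_two w' hw'W hw'u u hw'adj huZ huq j p hp (he ▸ huv)
        interval_cases p
        · exact hvused (he ▸ hmem_used j)
        · exact hvQ₁ (he ▸ Finset.mem_image_of_mem _ (Finset.mem_univ j))
        · exact hvQ₂ (he ▸ Finset.mem_image_of_mem _ (Finset.mem_univ j))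
      · obtain ⟨hvA, hvu⟩ := Finset.mem_filter.1 hv
        exact Finset.mem_filter.2 ⟨(hA i v (hA'mem v hvA).1).2.1, hvu⟩
    have hdis : Disjoint ((M.filter fun v => adj v w) \ F) (A'.filter fun v => adj v u) := by
      rw [Finset.disjoint_left]
      intro v hv hv'
      exact hnadj v (Finset.mem_filter.1 hv').1 (Finset.mem_filter.1 (Finset.mem_sdiff.1 hv).1).2
    have h1 := Finset.card_le_card hsub
    rw [Finset.card_union_of_disjoint hdis] at h1
    have h2 := Finset.le_card_sdiff F (M.filter fun v => adj v w)
    have h3 := hWtop w hwW u (Finset.mem_sdiff.2 ⟨huM, huW⟩)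
    omega)
  let U : Fin k → Set V := fun i =>
    {z | z = x i ∨ (i ∈ I ∧ z = f i) ∨ z = c i ∨ z = u i ∨ z = v i ∨ ∃ p ≤ len i, z = q i p}
  have hxU : ∀ i, x i ∈ U i := fun i => Or.inl rfl
  have hcU : ∀ i, c i ∈ U i := fun i => Or.inr (Or.inr (Or.inl rfl))
  have huU : ∀ i, u i ∈ U i := fun i => Or.inr (Or.inr (Or.inr (Or.inl rfl)))
  have hvU : ∀ i, v i ∈ U i := fun i => Or.inr (Or.inr (Or.inr (Or.inr (Or.inl rfl))))
  have hqU : ∀ i p, p ≤ len i → q i p ∈ U i := fun i p hp =>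
    Or.inr (Or.inr (Or.inr (Or.inr (Or.inr ⟨p, hp, rfl⟩))))
  refine ⟨U, fun i => ?_, fun i => hq.finish i ▸ hqU i _ le_rfl, ?_⟩
  · obtain ⟨huA, huv', hvq, -⟩ := huv i
    have h1 : ReachIn adj (U i) (x i) (src i) := by
      by_cases hi : i ∈ I
      · have hfU : f i ∈ U i := Or.inr (Or.inl ⟨hi, rfl⟩)
        have hs : src i = c i := by simp [src, hi]
        rw [hs]
        exact (ReachIn.single (hft i hi).2.1 (hxU i) hfU).trans
          (ReachIn.single ((hc i).2 hi) hfU (hcU i))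
      · have hs : src i = x i := by simp [src, hi]
        rw [hs]
        exact ReachIn.refl
    have hsU : src i ∈ U i := by
      by_cases hi : i ∈ I
      · simpa [src, hi] using hcU i
      · simpa [src, hi] using hxU i
    have h2 : ReachIn adj (U i) (src i) (u i) := ReachIn.single (hA i _ huA).1 hsU (huU i)
    have h3 : ReachIn adj (U i) (u i) (v i) := by
      rcases huv' with h | h
      · rw [h]; exact ReachIn.refl
      · exact ReachIn.single h (huU i) (hvU i)
    have h4 : ReachIn adj (U i) (v i) (q i 0) := ReachIn.single hvq (hvU i) (hqU i 0 (Nat.zero_le _))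
    have h5 : ∀ p ≤ len i, ReachIn adj (U i) (q i 0) (q i p) := by
      intro p
      induction p with
      | zero => exact fun _ => ReachIn.refl
      | succ p ih =>
        exact fun hp => (ih (by omega)).trans
          (ReachIn.single (hq.arc i p (by omega)).1 (hqU i p (by omega)) (hqU i _ hp))
    exact h1.trans (h2.trans (h3.trans (h4.trans (hq.finish i ▸ h5 _ le_rfl))))
  · have hclass : ∀ i, ∀ z ∈ U i, (z ∈ X ∧ z = x i) ∨ (z ∉ X ∧ z ∈ X' ∧ i ∈ I ∧ z = f i) ∨
        (z ∉ X ∧ z ∉ X' ∧ z ∈ C ∧ (∀ j p, p ≤ len j → z ≠ q j p) ∧ z = c i) ∨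
        (z ∉ X ∧ z ∉ X' ∧ z ∉ C ∧ (∀ j p, p ≤ len j → z ≠ q j p) ∧ (z = u i ∨ z = v i)) ∨
        (z ∉ X ∧ z ∉ X' ∧ ∃ p ≤ len i, z = q i p) := by
      intro i z hz
      obtain ⟨huA, -, -, hvM, hvX', hvC, hvq⟩ := huv i
      obtain ⟨-, huM, huW, huX', -, huq⟩ := hA i _ huA
      rcases hz with rfl | ⟨hi, rfl⟩ | rfl | rfl | rfl | ⟨p, hp, rfl⟩
      · exact Or.inl ⟨hxX i, rfl⟩
      · have hf : f i ∈ X' := Finset.mem_image_of_mem _ hi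
        exact Or.inr (Or.inl ⟨((hMmem _).1 (hX'M _ hf).1).1, hf, hi, rfl⟩)
      · exact Or.inr (Or.inr (Or.inl ⟨((hMmem _).1 (hWM (hc i).1.1)).1,
          fun h => (hX'M _ h).2 (hc i).1.1, hcC i, hnot_on _ (hc i).1.1 (hc i).1.2, rfl⟩))
      · exact Or.inr (Or.inr (Or.inr (Or.inl ⟨((hMmem _).1 huM).1, huX', fun h => huW (hCW h), huq,
          Or.inl rfl⟩)))
      · exact Or.inr (Or.inr (Or.inr (Or.inl ⟨((hMmem _).1 hvM).1, hvX', hvC, hvq, Or.inr rfl⟩)))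
      · have := hqZ i p hp
        simp only [hZ, Finset.mem_union, not_or] at this
        exact Or.inr (Or.inr (Or.inr (Or.inr ⟨this.1, this.2, p, hp, rfl⟩)))
    intro i j hij z hzi hzj
    rcases hclass i z hzi with ⟨a₁, a₂⟩ | ⟨a₁, a₂, a₃, a₄⟩ | ⟨a₁, a₂, a₃, a₄, a₅⟩ |
        ⟨a₁, a₂, a₃, a₄, a₅⟩ | ⟨a₁, a₂, p, a₃, a₄⟩ <;>
      rcases hclass j z hzj with ⟨b₁, b₂⟩ | ⟨b₁, b₂, b₃, b₄⟩ | ⟨b₁, b₂, b₃, b₄, b₅⟩ |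
        ⟨b₁, b₂, b₃, b₄, b₅⟩ | ⟨b₁, b₂, p', b₃, b₄⟩ <;>
      try first
        | contradiction
        | exact a₄ _ _ b₃ b₄
        | exact b₄ _ _ a₃ a₄
    · exact hij (hxinj (a₂.symm.trans b₂))
    · exact hij (hfinj a₃ b₃ (a₄.symm.trans b₄))
    · exact hij (hcinj (a₅.symm.trans b₅))
    · have h1 := hdisj i j hij
      have h2 := hdisj j i hij.symm
      rcases a₅ with a₅ | a₅ <;> rcases b₅ with b₅ | b₅
      · exact h1.1 (a₅.symm.trans b₅)
      · exact h1.2.1 (a₅.symm.trans b₅)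
      · exact h2.2.1 (b₅.symm.trans a₅)
      · exact h1.2.2 (a₅.symm.trans b₅)
    · exact hq.disjoint i j p p' a₃ b₃ hij (a₄.symm.trans b₄)

/-- Arcs inside a part of a composition can be bypassed, unless both ends lie in one part. -/
theorem ReachIn.cross_of_twins {V ι : Type} {adj' adj : V → V → Prop} {φ : V → ι} {U : Set V}
    {a b : V} (h : ReachIn adj' U a b)
    (hadj : ∀ u v, adj' u v → φ u ≠ φ v → adj u v)
    (htwin : ∀ u u' v v', φ u = φ u' → φ v = φ v' → φ u ≠ φ v → adj u v → adj u' v') :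
    φ a = φ b ∨ ReachIn (fun u v => φ u ≠ φ v ∧ adj u v) U a b := by
  induction h using Relation.ReflTransGen.head_induction_on with
  | refl => exact Or.inl rfl
  | @head a z haz _ ih =>
    obtain ⟨haz, ha, hz⟩ := haz
    by_cases hab : φ a = φ b
    · exact Or.inl hab
    right
    by_cases hz' : φ a = φ z
    · rcases ih with ih | ih
      · exact absurd (hz'.trans ih) hab
      · rcases Relation.ReflTransGen.cases_head ih with rfl | ⟨z', ⟨⟨hne, hzz'⟩, -, hz'U⟩, hrest⟩
        · exact absurd hz' hab
        · exact Relation.ReflTransGen.head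
            ⟨⟨hz' ▸ hne, htwin z a z' z' hz'.symm rfl hne hzz'⟩, ha, hz'U⟩ hrest
    · have h1 := hadj a z haz hz'
      rcases ih with ih | ih
      · have hbU : b ∈ U := by
          by_contra hb
          rename_i hzb
          rcases Relation.ReflTransGen.cases_tail hzb with rfl | ⟨p, -, -, -, h⟩
          · exact hb hz
          · exact hb h
        exact ReachIn.single ⟨hab, htwin a a z b rfl ih hz' h1⟩ ha hbU
      · exact Relation.ReflTransGen.head ⟨⟨hz', h1⟩, ha, hz⟩ ih

namespace Digr

variable {V ι : Type}

theorem IsCompositionOver.twin {G : Digr V} {H : Digr ι} {φ : V → ι}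
    (hcomp : G.IsCompositionOver H φ) (u u' v v' : V) (hu : φ u = φ u') (hv : φ v = φ v')
    (hne : φ u ≠ φ v) (h : G.Adj u v) : G.Adj u' v' := by
  rw [hcomp.2 _ _ hne] at h
  rw [hcomp.2 _ _ (hu ▸ hv ▸ hne), ← hu, ← hv]
  exact h

variable [Fintype V]

open Classical in
theorem outDeg_eq_card (G : Digr V) (v : V) :
    G.outDeg v = (Finset.univ.filter fun w => G.Adj v w).card := by
  rw [outDeg, ← Set.ncard_coe_finset]
  simp

open Classical in
/-- The case where every part of the composition misses at least `3k` vertices. -/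
theorem IsCompositionOver.kLinked_of_forall_le_card {k : ℕ} (hk : 1 ≤ k) {G : Digr V}
    {H : Digr ι} {φ : V → ι} (hcomp : G.IsCompositionOver H φ) (hH : H.Semicomplete)
    (hparts : ∀ i, 3 * k ≤ (Finset.univ.filter fun v => φ v ≠ i).card)
    (hstrong : G.KStrong (3 * k)) (hdeg : ∀ v : V, 23 * k ≤ G.outDeg v) : G.KLinked k := by
  refine KLinked.of_reachIn (by have := hstrong.1; omega) fun x y hxy => ?_
  have hyinj : Function.Injective y := hxy.comp Sum.inr_injective
  let E : V → V → Prop := fun u v =>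
    (φ u ≠ φ v ∧ G.Adj u v) ∨ (φ u = φ v ∧ u ≠ v ∧ ∀ j, v ≠ y j)
  have hEG : ∀ u v, E u v → φ u ≠ φ v → G.Adj u v := fun u v h hne =>
    h.elim (·.2) fun h => absurd h.1 hne
  have hcross : ∀ S : Finset V, S.card ≤ 3 * k - 1 → ∀ a b, a ∉ S → b ∉ S → φ a ≠ φ b →
      ReachIn E ((S : Set V)ᶜ) a b := fun S hS a b ha hb hab =>
    (((hstrong.reachIn S hS ha hb).cross_of_twins (fun _ _ h _ => h) hcomp.twin).resolve_left
      hab).mono (fun u v _ _ h => Or.inl h) subset_rfl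
  obtain ⟨U, hU, hyU, hdisj⟩ := exists_disjoint_reachIn hk E x y hxy
    (by
      intro u v huv hu hv
      by_cases h : φ u = φ v
      · exact Or.inl (Or.inr ⟨h, huv, hv⟩)
      · rcases hH _ _ h with h' | h'
        · exact Or.inl (Or.inl ⟨h, (hcomp.2 _ _ h).2 h'⟩)
        · exact Or.inr (Or.inl ⟨Ne.symm h, (hcomp.2 _ _ (Ne.symm h)).2 h'⟩))
    (by
      intro v _
      suffices h : ∀ F : Finset V, (∀ u, u ∈ F ↔ E v u ∧ ∀ j, u ≠ y j) → 22 * k ≤ F.card from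
        h _ fun u => by simp only [Finset.mem_filter, Finset.mem_univ, true_and]
      intro F hF
      have h1 := hdeg v
      rw [outDeg_eq_card] at h1
      have h2 : (Finset.univ.filter fun w => G.Adj v w) ⊆
          F ∪ Finset.univ.image y := by
        intro w hw
        have hw := (Finset.mem_filter.1 hw).2
        by_cases hwy : ∀ j, w ≠ y j
        · refine Finset.mem_union_left _ ((hF w).2 ⟨?_, hwy⟩)
          by_cases h : φ v = φ w
          · exact Or.inr ⟨h, fun h => G.irrefl w (h ▸ hw), hwy⟩
          · exact Or.inl ⟨h, hw⟩
        · push Not at hwy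
          obtain ⟨j, rfl⟩ := hwy
          exact Finset.mem_union_right _ (Finset.mem_image_of_mem _ (Finset.mem_univ j))
      have h3 := (Finset.card_le_card h2).trans (Finset.card_union_le _ _)
      rw [Finset.card_image_of_injective _ hyinj, Finset.card_univ, Fintype.card_fin] at h3
      omega)
    (by
      intro S hS a b ha hb
      by_cases hab : φ a = φ b
      · obtain ⟨t, ht, htS⟩ := Finset.exists_mem_notMem_of_card_lt_card
          (show S.card < (Finset.univ.filter fun v => φ v ≠ φ a).card by
            have := hparts (φ a)
            omega)
        have ht := (Finset.mem_filter.1 ht).2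
        exact (hcross S hS a t ha htS ht.symm).trans (hcross S hS t b htS hb (hab ▸ ht))
      · exact hcross S hS a b ha hb hab)
  have key : ∀ i a, ReachIn E (U i) (x i) a → φ (x i) ≠ φ a → ReachIn G.Adj (U i) (x i) a :=
    fun i a h hne => ((h.cross_of_twins hEG hcomp.twin).resolve_left hne).mono
      (fun u v _ _ h => h.2) subset_rfl
  refine ⟨U, fun i => ?_, hyU, hdisj⟩
  by_cases hi : φ (x i) = φ (y i)
  · rcases Relation.ReflTransGen.cases_tail (hU i) with h | ⟨p, hp, h, hpU, hyU⟩
    · exact absurd (@hxy (Sum.inl i) (Sum.inr i) h.symm) (by simp)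
    · rcases h with ⟨hne, h⟩ | h
      · exact (key i p hp (hi ▸ hne.symm)).trans (ReachIn.single h hpU hyU)
      · exact absurd rfl (h.2.2 i)
  · exact key i _ (hU i) hi

open Classical in
/-- In a composition of high connectivity, a part missing few vertices is joined to all of them by
arcs in both directions. -/
theorem IsCompositionOver.adj_of_card_lt {k : ℕ} {G : Digr V} {H : Digr ι} {φ : V → ι}
    (hcomp : G.IsCompositionOver H φ) {i₀ : ι}
    (hupp : (Finset.univ.filter fun v => φ v ≠ i₀).card < k) (hstrong : G.KStrong k) {s t : V}
    (hs : φ s = i₀) (ht : φ t ≠ i₀) : G.Adj s t ∧ G.Adj t s := by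
  set T : Finset V := Finset.univ.filter fun v => φ v ≠ i₀ with hT
  have hTmem : ∀ v, v ∈ T ↔ φ v ≠ i₀ := fun v => by simp [hT]
  have hsT : s ∉ T := fun h => (hTmem s).1 h hs
  constructor
  · by_contra hno
    have hsub : (T.filter fun w => G.Adj s w) ⊆ T.erase t := fun w hw => by
      obtain ⟨hwT, hw⟩ := Finset.mem_filter.1 hw
      exact Finset.mem_erase.2 ⟨fun h => hno (h ▸ hw), hwT⟩
    have hc := (Finset.card_le_card hsub).trans_lt
      (Finset.card_erase_lt_of_mem ((hTmem t).2 ht))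
    have hr := hstrong.reachIn (T.filter fun w => G.Adj s w) (by omega) (a := s) (b := t)
      (fun h => hsT (Finset.mem_filter.1 h).1) (fun h => hno (Finset.mem_filter.1 h).2)
    have hinv : ∀ b, ReachIn G.Adj (((T.filter fun w => G.Adj s w : Finset V) : Set V)ᶜ) s b →
        φ b = i₀ := by
      intro b hb
      induction hb with
      | refl => exact hs
      | @tail b c _ hbc ih =>
        by_contra hc
        exact hbc.2.2 (Finset.mem_coe.2 (Finset.mem_filter.2 ⟨(hTmem c).2 hc,
          hcomp.twin b s c c (ih.trans hs.symm) rfl (ih ▸ Ne.symm hc) hbc.1⟩))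
    exact ht (hinv t hr)
  · by_contra hno
    have hsub : (T.filter fun w => G.Adj w s) ⊆ T.erase t := fun w hw => by
      obtain ⟨hwT, hw⟩ := Finset.mem_filter.1 hw
      exact Finset.mem_erase.2 ⟨fun h => hno (h ▸ hw), hwT⟩
    have hc := (Finset.card_le_card hsub).trans_lt
      (Finset.card_erase_lt_of_mem ((hTmem t).2 ht))
    have hr := hstrong.reachIn (T.filter fun w => G.Adj w s) (by omega) (a := t) (b := s)
      (fun h => hno (Finset.mem_filter.1 h).2) (fun h => hsT (Finset.mem_filter.1 h).1)
    have hinv : ∀ b, ReachIn G.Adj (((T.filter fun w => G.Adj w s : Finset V) : Set V)ᶜ) b s →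
        φ b = i₀ := by
      intro b hb
      induction hb using Relation.ReflTransGen.head_induction_on with
      | refl => exact hs
      | @head b c hbc _ ih =>
        by_contra hc
        exact hbc.2.1 (Finset.mem_coe.2 (Finset.mem_filter.2 ⟨(hTmem b).2 hc,
          hcomp.twin b b c s rfl (ih.trans hs.symm) (ih ▸ hc) hbc.1⟩))
    exact ht (hinv t hr)

open Classical in
/-- The case where some part of the composition misses fewer than `3k` vertices. -/
theorem IsCompositionOver.kLinked_of_card_lt {k : ℕ} (hk : 1 ≤ k) {G : Digr V}
    {H : Digr ι} {φ : V → ι} (hcomp : G.IsCompositionOver H φ) (i₀ : ι)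
    (hlow : 2 * k - 3 ≤ (Finset.univ.filter fun v => φ v ≠ i₀).card)
    (hupp : (Finset.univ.filter fun v => φ v ≠ i₀).card < 3 * k)
    (hstrong : G.KStrong (3 * k)) (hdeg : ∀ v : V, 23 * k ≤ G.outDeg v) : G.KLinked k := by
  refine KLinked.of_reachIn (by have := hstrong.1; omega) fun x y hxy => ?_
  obtain ⟨s₀, hs₀⟩ := hcomp.1 i₀
  set T : Finset V := Finset.univ.filter fun v => φ v ≠ i₀ with hT
  have hTmem : ∀ v, v ∈ T ↔ φ v ≠ i₀ := fun v => by simp [hT]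
  have hTc : 20 * k ≤ Tᶜ.card := by
    have h1 := hdeg s₀
    rw [outDeg_eq_card] at h1
    have h2 := h1.trans (Finset.card_le_univ _)
    have h3 := Finset.card_add_card_compl T
    omega
  have hadj : ∀ u v, (u ∈ T ↔ v ∉ T) → G.Adj u v := by
    intro u v huv
    simp only [hTmem, not_not] at huv
    by_cases h : φ u = i₀
    · exact (hcomp.adj_of_card_lt hupp hstrong h fun hv => huv.2 hv h).1
    · exact (hcomp.adj_of_card_lt hupp hstrong (huv.1 h) h).2
  let Y : Finset V := Finset.univ.image (Sum.elim x y)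
  have hYmem : ∀ s, Sum.elim x y s ∈ Y := fun s => Finset.mem_image_of_mem _ (Finset.mem_univ s)
  have hYc : Y.card ≤ 2 * k := by
    refine Finset.card_image_le.trans ?_
    simp only [Finset.card_univ, Fintype.card_sum, Fintype.card_fin]
    omega
  -- the pairs with both ends outside `T`
  set R : Finset (Fin k) := Finset.univ.filter fun i => x i ∉ T ∧ y i ∉ T with hR
  have hRmem : ∀ i, i ∈ R ↔ x i ∉ T ∧ y i ∉ T := fun i => by simp [hR]
  obtain ⟨i₁, hi₁⟩ : ∃ i₁ : Fin k, R.Nonempty → i₁ ∈ R := by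
    by_cases h : R.Nonempty
    · exact ⟨h.choose, fun _ => h.choose_spec⟩
    · exact ⟨⟨0, hk⟩, fun h' => absurd h' h⟩
  have hfree : 2 * R.card ≤ (T \ Y).card + 3 := by
    have h1 : T ∩ Y ⊆ (Rᶜ).image x ∪ (Rᶜ).image y := by
      intro v hv
      obtain ⟨hvT, hvY⟩ := Finset.mem_inter.1 hv
      obtain ⟨i | i, -, rfl⟩ := Finset.mem_image.1 hvY
      · exact Finset.mem_union_left _ (Finset.mem_image_of_mem _
          (Finset.mem_compl.2 fun h => ((hRmem i).1 h).1 hvT))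
      · exact Finset.mem_union_right _ (Finset.mem_image_of_mem _
          (Finset.mem_compl.2 fun h => ((hRmem i).1 h).2 hvT))
    have h2 := (Finset.card_le_card h1).trans (Finset.card_union_le _ _)
    have h3 : ((Rᶜ).image x).card ≤ Rᶜ.card := Finset.card_image_le
    have h4 : ((Rᶜ).image y).card ≤ Rᶜ.card := Finset.card_image_le
    have h5 := Finset.card_add_card_compl R
    have h6 := Finset.card_sdiff_add_card_inter T Y
    rw [Fintype.card_fin] at h5
    omega
  obtain ⟨w, hwinj, hw⟩ : ∃ w : {i // i ≠ i₁} → V, Function.Injective w ∧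
      ∀ i, w i ∈ if i.1 ∈ R then T \ Y else Tᶜ \ Y := by
    rw [← Finset.all_card_le_biUnion_card_iff_exists_injective]
    intro s
    by_cases hs : ∀ i ∈ s, i.1 ∈ R
    · rcases s.eq_empty_or_nonempty with rfl | ⟨i, hi⟩
      · simp
      · have hiR := hs i hi
        have h1 : s.card ≤ (R.erase i₁).card := by
          rw [← Finset.card_image_of_injective s Subtype.val_injective]
          refine Finset.card_le_card fun j hj => ?_
          obtain ⟨l, hl, rfl⟩ := Finset.mem_image.1 hj
          exact Finset.mem_erase.2 ⟨l.2, hs l hl⟩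
        rw [Finset.card_erase_of_mem (hi₁ ⟨_, hiR⟩)] at h1
        have h2 : 0 < s.card := Finset.card_pos.2 ⟨i, hi⟩
        refine le_trans ?_ (Finset.card_le_card (Finset.subset_biUnion_of_mem _ hi))
        rw [if_pos hiR]
        omega
    · push Not at hs
      obtain ⟨i, hi, hiR⟩ := hs
      refine le_trans ?_ (Finset.card_le_card (Finset.subset_biUnion_of_mem _ hi))
      rw [if_neg hiR]
      have h1 : s.card ≤ k := by
        have := Finset.card_le_univ s
        have h2 := Fintype.card_subtype_le fun i => i ≠ i₁
        rw [Fintype.card_fin] at h2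
        omega
      have h2 := Finset.le_card_sdiff Y Tᶜ
      omega
  have hwY : ∀ i, w i ∉ Y := fun i => by
    have := hw i
    split_ifs at this <;> exact (Finset.mem_sdiff.1 this).2
  let P : Fin k → Finset V := fun i => if h : i ≠ i₁ then {x i, w ⟨i, h⟩, y i} else ∅
  have hP : ∀ i (h : i ≠ i₁), P i = {x i, w ⟨i, h⟩, y i} := fun i h => by simp [P, h]
  have hPc : (Finset.univ.biUnion P).card ≤ 3 * k - 1 := by
    have h1 : Finset.univ.biUnion P ⊆ (Finset.univ.erase i₁).biUnion P := by
      intro v hv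
      obtain ⟨i, -, hi⟩ := Finset.mem_biUnion.1 hv
      refine Finset.mem_biUnion.2 ⟨i, Finset.mem_erase.2 ⟨?_, Finset.mem_univ _⟩, hi⟩
      rintro rfl
      simp [P] at hi
    have h2 := (Finset.card_le_card h1).trans
      (Finset.card_biUnion_le_card_mul _ P 3 fun i hi => by
        rw [hP i (Finset.ne_of_mem_erase hi)]
        exact Finset.card_le_three)
    rw [Finset.card_erase_of_mem (Finset.mem_univ _), Finset.card_univ, Fintype.card_fin] at h2
    omega
  have hdisj : ∀ i j, i ≠ j → ∀ v ∈ P i, v ≠ x j ∧ v ≠ y j ∧ v ∉ P j := by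
    intro i j hij v hv
    have hi : i ≠ i₁ := by
      rintro rfl
      simp [P] at hv
    have hwx : ∀ i l, w i ≠ x l := fun i l h => hwY i (h ▸ hYmem (Sum.inl l))
    have hwy : ∀ i l, w i ≠ y l := fun i l h => hwY i (h ▸ hYmem (Sum.inr l))
    have hxx : x i ≠ x j := fun h => hij (Sum.inl_injective (@hxy (Sum.inl i) (Sum.inl j) h))
    have hyy : y i ≠ y j := fun h => hij (Sum.inr_injective (@hxy (Sum.inr i) (Sum.inr j) h))
    have hxy' : ∀ i j, x i ≠ y j := fun i j h => by
      simpa using @hxy (Sum.inl i) (Sum.inr j) h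
    have hvx : v ≠ x j ∧ v ≠ y j := by
      rw [hP i hi] at hv
      simp only [Finset.mem_insert, Finset.mem_singleton] at hv
      rcases hv with rfl | rfl | rfl
      · exact ⟨hxx, hxy' _ _⟩
      · exact ⟨hwx _ _, hwy _ _⟩
      · exact ⟨(hxy' _ _).symm, hyy⟩
    refine ⟨hvx.1, hvx.2, fun hvj => ?_⟩
    have hj : j ≠ i₁ := by
      rintro rfl
      simp [P] at hvj
    rw [hP j hj] at hvj
    rw [hP i hi] at hv
    simp only [Finset.mem_insert, Finset.mem_singleton, hvx.1, hvx.2, false_or, or_false] at hv hvj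
    subst hvj
    rcases hv with h | h | h
    · exact hwx _ _ h
    · exact hij (congrArg Subtype.val (hwinj h)).symm
    · exact hwy _ _ h
  let U : Fin k → Set V := fun i =>
    if i = i₁ then ((Finset.univ.biUnion P : Finset V) : Set V)ᶜ else (P i : Set V)
  have hU₁ : U i₁ = ((Finset.univ.biUnion P : Finset V) : Set V)ᶜ := if_pos rfl
  have hU : ∀ i, i ≠ i₁ → U i = P i := fun i hi => if_neg hi
  have hnotP : ∀ v, (∀ i, i ≠ i₁ → v ∉ P i) → v ∉ Finset.univ.biUnion P := by
    intro v hv hmem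
    obtain ⟨i, -, hi⟩ := Finset.mem_biUnion.1 hmem
    by_cases h : i = i₁
    · subst h
      simp [P] at hi
    · exact hv i h hi
  have hx₁ : x i₁ ∉ Finset.univ.biUnion P := hnotP _ fun i hi h => (hdisj i i₁ hi _ h).1 rfl
  have hy₁ : y i₁ ∉ Finset.univ.biUnion P := hnotP _ fun i hi h => (hdisj i i₁ hi _ h).2.1 rfl
  refine ⟨U, fun i => ?_, fun i => ?_, fun i j hij v hv => ?_⟩
  · by_cases hi : i = i₁
    · subst hi
      rw [hU₁]
      exact hstrong.reachIn _ hPc hx₁ hy₁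
    · have hxP : x i ∈ (P i : Set V) := by simp [hP i hi]
      have hyP : y i ∈ (P i : Set V) := by simp [hP i hi]
      have hwP : w ⟨i, hi⟩ ∈ (P i : Set V) := by simp [hP i hi]
      have hwi := hw ⟨i, hi⟩
      rw [hU i hi]
      by_cases hmix : x i ∈ T ↔ y i ∉ T
      · exact ReachIn.single (hadj _ _ hmix) hxP hyP
      · have : (x i ∈ T ↔ w ⟨i, hi⟩ ∉ T) ∧ (w ⟨i, hi⟩ ∈ T ↔ y i ∉ T) := by
          by_cases h : i ∈ R
          · rw [if_pos h, Finset.mem_sdiff] at hwi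
            have h := (hRmem i).1 h
            exact ⟨iff_of_false h.1 (not_not.2 hwi.1), iff_of_true hwi.1 h.2⟩
          · rw [if_neg h, Finset.mem_sdiff, Finset.mem_compl] at hwi
            rw [hRmem] at h
            have hxy' : x i ∈ T ∧ y i ∈ T := by tauto
            exact ⟨iff_of_true hxy'.1 hwi.1, iff_of_false hwi.1 (not_not.2 hxy'.2)⟩
        exact (ReachIn.single (hadj _ _ this.1) hxP hwP).trans
          (ReachIn.single (hadj _ _ this.2) hwP hyP)
  · by_cases hi : i = i₁
    · subst hi
      rw [hU₁]
      exact fun h => hy₁ (Finset.mem_coe.1 h)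
    · rw [hU i hi]
      simp [hP i hi]
  · by_cases hi : i = i₁
    · subst hi
      rw [hU₁] at hv
      rw [hU j hij.symm]
      exact fun h => hv (Finset.mem_coe.2 (Finset.mem_biUnion.2 ⟨j, Finset.mem_univ _, h⟩))
    · rw [hU i hi] at hv
      by_cases hj : j = i₁
      · subst hj
        rw [hU₁]
        exact fun h => h (Finset.mem_coe.2 (Finset.mem_biUnion.2 ⟨i, Finset.mem_univ _, hv⟩))
      · rw [hU j hj]
        exact (hdisj i j hij v hv).2.2

end Digr

/-- A 3k-strong semicomplete composition D = H[S₁,…,S_h] with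
δ⁺(D) ≥ 23k and |V(D) \ V(Sᵢ)| ≥ 2k−3 for each i is k-linked (k ≥ 2). -/
theorem semicomplete_composition_is_k_linked {V ι : Type} [Fintype V] [Fintype ι]
    (k : ℕ) (hk : 2 ≤ k) (G : Digr V) (H : Digr ι) (φ : V → ι)
    (hι : 2 ≤ Fintype.card ι)
    (hcomp : Digr.IsCompositionOver G H φ) (hH : H.Semicomplete)
    (hparts : ∀ i : ι, 2 * k - 3 ≤ Set.ncard {v : V | φ v ≠ i})
    (hstrong : G.KStrong (3 * k)) (hdeg : ∀ v : V, 23 * k ≤ G.outDeg v) :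
    G.KLinked k := by
  classical
  have hncard : ∀ i : ι, Set.ncard {v : V | φ v ≠ i} =
      (Finset.univ.filter fun v => φ v ≠ i).card := fun i => by
    rw [← Set.ncard_coe_finset]
    simp
  simp only [hncard] at hparts
  by_cases h : ∀ i, 3 * k ≤ (Finset.univ.filter fun v => φ v ≠ i).card
  · exact hcomp.kLinked_of_forall_le_card (by omega) hH h hstrong hdeg
  · push Not at h
    obtain ⟨i₀, hi₀⟩ := h
    exact hcomp.kLinked_of_card_lt (by omega) i₀ (hparts i₀) hi₀ hstrong hdeg
end

section
/- Let k ≥ 2 be an integer. Every 3k-strong extended semicomplete digraph D with δ⁺(D) ≥ 23k is k-linked. -/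
namespace List

theorem exists_first_mem {V : Type} {p : V → Prop} {l : List V} (h : ∃ v ∈ l, p v) :
    ∃ l₁ s l₂, l = l₁ ++ s :: l₂ ∧ p s ∧ ∀ v ∈ l₁, ¬ p v := by
  induction l with
  | nil => simp at h
  | cons a l ih =>
    by_cases ha : p a
    · exact ⟨[], a, l, rfl, ha, by simp⟩
    · obtain ⟨v, hv, hpv⟩ := h
      rcases List.mem_cons.1 hv with rfl | hv
      · exact absurd hpv ha
      · obtain ⟨l₁, s, l₂, rfl, hs, h₁⟩ := ih ⟨v, hv, hpv⟩
        refine ⟨a :: l₁, s, l₂, rfl, hs, ?_⟩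
        intro v hv
        rcases List.mem_cons.1 hv with rfl | hv
        · exact ha
        · exact h₁ v hv

/-- A member of a list is among its first `t` entries or is preceded by at least `t` entries. -/
theorem mem_take_or_exists_append {V : Type} {v : V} {l : List V} (h : v ∈ l) (t : ℕ) :
    v ∈ l.take t ∨ ∃ l₁ l₂, l = l₁ ++ v :: l₂ ∧ t ≤ l₁.length := by
  obtain ⟨l₁, l₂, rfl⟩ := List.append_of_mem h
  by_cases ht : t ≤ l₁.length
  · exact .inr ⟨l₁, l₂, rfl, ht⟩
  · left
    rw [List.take_append]
    obtain ⟨n, hn⟩ : ∃ n, t - l₁.length = n + 1 := ⟨t - l₁.length - 1, by omega⟩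
    simp [hn]

end List

/-- `l` is the vertex sequence of a walk from `x` to `y` along the relation `R`. -/
def IsWalk {V : Type} (R : V → V → Prop) (l : List V) (x y : V) : Prop :=
  l.IsChain R ∧ l.head? = some x ∧ l.getLast? = some y

namespace IsWalk

variable {V : Type} {R R' : V → V → Prop} {l l₁ l₂ : List V} {x y z : V}

theorem singleton (R : V → V → Prop) (x : V) : IsWalk R [x] x x := by simp [IsWalk]

theorem cons (h : IsWalk R l y z) (hxy : R x y) : IsWalk R (x :: l) x z := by
  obtain ⟨h₁, h₂, h₃⟩ := h
  cases l with
  | nil => simp at h₂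
  | cons a l =>
    simp only [List.head?_cons, Option.some.injEq] at h₂
    subst h₂
    refine ⟨List.isChain_cons_cons.2 ⟨hxy, h₁⟩, rfl, ?_⟩
    rw [List.getLast?_cons_cons]
    exact h₃

theorem left (h : IsWalk R (l₁ ++ z :: l₂) x y) : IsWalk R (l₁ ++ [z]) x z := by
  obtain ⟨h₁, h₂, h₃⟩ := h
  refine ⟨(List.isChain_split.1 h₁).1, ?_, by simp⟩
  cases l₁ <;> simpa using h₂

theorem right (h : IsWalk R (l₁ ++ z :: l₂) x y) : IsWalk R (z :: l₂) z y := by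
  obtain ⟨h₁, h₂, h₃⟩ := h
  refine ⟨(List.isChain_split.1 h₁).2, rfl, ?_⟩
  rwa [List.getLast?_append_of_ne_nil _ (by simp)] at h₃

theorem join (h : IsWalk R (l₁ ++ [z]) x z) (h' : IsWalk R (z :: l₂) z y) :
    IsWalk R (l₁ ++ z :: l₂) x y := by
  refine ⟨List.isChain_split.2 ⟨h.1, h'.1⟩, ?_, ?_⟩
  · have := h.2.1
    cases l₁ <;> simpa using this
  · rw [List.getLast?_append_of_ne_nil _ (by simp)]
    exact h'.2.2

theorem mono (h : IsWalk R l x y) (hR : ∀ a b, R a b → R' a b) : IsWalk R' l x y :=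
  ⟨h.1.imp hR, h.2⟩

theorem reverse (h : IsWalk R l x y) : IsWalk (flip R) l.reverse y x :=
  ⟨List.isChain_reverse.2 h.1, by simpa using h.2.2, by simpa using h.2.1⟩

theorem start_mem (h : IsWalk R l x y) : x ∈ l := List.mem_of_head? h.2.1

theorem end_mem (h : IsWalk R l x y) : y ∈ l := List.mem_of_getLast? h.2.2

theorem exists_suffix (h : IsWalk R l x y) (hz : z ∈ l) :
    ∃ l₂, IsWalk R (z :: l₂) z y ∧ z :: l₂ ⊆ l := by
  obtain ⟨l₁, l₂, rfl⟩ := List.append_of_mem hz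
  exact ⟨l₂, h.right, by intro a; simp; tauto⟩

/-- Every walk contains a path with the same ends. -/
theorem exists_nodup (h : IsWalk R l x y) : ∃ p, IsWalk R p x y ∧ p ⊆ l ∧ p.Nodup := by
  induction l generalizing x with
  | nil => simp [IsWalk] at h
  | cons a l ih =>
    obtain ⟨h₁, h₂, h₃⟩ := h
    simp only [List.head?_cons, Option.some.injEq] at h₂
    subst h₂
    cases l with
    | nil =>
      simp only [List.getLast?_singleton, Option.some.injEq] at h₃
      subst h₃
      exact ⟨[a], singleton R a, by simp, by simp⟩
    | cons b l =>
      rw [List.getLast?_cons_cons] at h₃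
      obtain ⟨hab, hbl⟩ := List.isChain_cons_cons.1 h₁
      obtain ⟨p, hp, hpl, hnd⟩ := ih ⟨hbl, rfl, h₃⟩
      by_cases ha : a ∈ p
      · obtain ⟨p₁, p₂, rfl⟩ := List.append_of_mem ha
        refine ⟨a :: p₂, hp.right, ?_, hnd.sublist (List.sublist_append_right _ _)⟩
        exact fun v hv => List.mem_cons_of_mem _ (hpl (List.mem_append_right _ hv))
      · exact ⟨a :: p, hp.cons hab, List.cons_subset_cons a hpl, List.nodup_cons.2 ⟨ha, hnd⟩⟩

end IsWalk

/-- `R` without the arc `(x, y)`. -/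
def deleteArc {V : Type} (R : V → V → Prop) (x y : V) : V → V → Prop :=
  fun a b => R a b ∧ ¬ (a = x ∧ b = y)

/-- `S` meets every `R`-walk from `A` to `B`. -/
def Separates {V : Type} (R : V → V → Prop) (A B S : Finset V) : Prop :=
  ∀ l, ∀ a ∈ A, ∀ b ∈ B, IsWalk R l a b → ∃ v ∈ l, v ∈ S

/-- `k` pairwise disjoint walks from `A` to `B`. -/
def HasLinkage {V : Type} (R : V → V → Prop) (A B : Finset V) (k : ℕ) : Prop :=
  ∃ P : Fin k → List V, (∀ i, ∃ a ∈ A, ∃ b ∈ B, IsWalk R (P i) a b) ∧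
    ∀ i j, i ≠ j → ∀ v ∈ P i, v ∉ P j

section Menger

variable {V : Type} {R : V → V → Prop} {A B S Z : Finset V} {k : ℕ} {x y : V}

theorem Separates.flip (h : Separates R A B S) : Separates (flip R) B A S := by
  intro l b hb a ha hl
  obtain ⟨v, hv, hvS⟩ := h l.reverse a ha b hb hl.reverse
  exact ⟨v, by simpa using hv, hvS⟩

theorem HasLinkage.flip (h : HasLinkage R A B k) : HasLinkage (flip R) B A k := by
  obtain ⟨P, hP, hd⟩ := h
  refine ⟨fun i => (P i).reverse, fun i => ?_, fun i j hij v hv => ?_⟩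
  · obtain ⟨a, ha, b, hb, hw⟩ := hP i
    exact ⟨b, hb, a, ha, hw.reverse⟩
  · simpa using hd i j hij v (by simpa using hv)

theorem flip_deleteArc : flip (deleteArc R x y) = deleteArc (flip R) y x := by
  funext a b
  simp [flip, deleteArc, and_comm]

theorem isChain_deleteArc {l : List V} {s : V} (h : (l ++ [s]).IsChain R) (hx : x ∉ l) :
    (l ++ [s]).IsChain (deleteArc R x y) := by
  induction l with
  | nil => simp
  | cons a l ih =>
    simp only [List.mem_cons, not_or] at hx
    rw [List.cons_append, List.isChain_cons] at h ⊢
    exact ⟨fun b hb => ⟨h.1 b hb, fun hab => hx.1 hab.1.symm⟩, ih h.2 hx.2⟩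

theorem Separates.of_insert [DecidableEq V] (hS : Separates (deleteArc R x y) A B S)
    (hZ : Separates (deleteArc R x y) A (insert x S) Z) : Separates R A B Z := by
  intro l a ha b hb hl
  have hit : ∃ v ∈ l, v ∈ insert x S := by
    by_cases hx : x ∈ l
    · exact ⟨x, hx, by simp⟩
    · obtain ⟨l', b', hlb⟩ : ∃ l' b', l = l' ++ [b'] := by
        rcases List.eq_nil_or_concat l with rfl | ⟨l', b', h⟩
        · simp [IsWalk] at hl
        · exact ⟨l', b', by simpa using h⟩
      have : IsWalk (deleteArc R x y) l a b := by
        refine ⟨?_, hl.2⟩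
        have := hl.1
        subst hlb
        exact isChain_deleteArc this (by simp at hx; tauto)
      obtain ⟨v, hv, hvS⟩ := hS l a ha b hb this
      exact ⟨v, hv, by simp [hvS]⟩
  obtain ⟨l₁, s, l₂, rfl, hs, h₁⟩ := List.exists_first_mem hit
  have hw := hl.left
  have hx : x ∉ l₁ := fun h => h₁ x h (by simp)
  obtain ⟨v, hv, hvZ⟩ := hZ (l₁ ++ [s]) a ha s hs ⟨isChain_deleteArc hw.1 hx, hw.2⟩
  exact ⟨v, by simp at hv ⊢; tauto, hvZ⟩

/-- A full set of disjoint walks into `B` can be indexed by `B` and cut at the first vertex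
of `B`. -/
theorem HasLinkage.exists_indexed (h : HasLinkage R A B k) (hB : B.card = k) :
    ∃ L : V → List V, (∀ s ∈ B, (∃ a ∈ A, IsWalk R (L s ++ [s]) a s) ∧ ∀ v ∈ L s, v ∉ B) ∧
      ∀ s ∈ B, ∀ t ∈ B, s ≠ t → ∀ v ∈ L s ++ [s], v ∉ L t ++ [t] := by
  classical
  obtain ⟨P, hP, hd⟩ := h
  choose a ha b hb hw using hP
  have hinj : Function.Injective b := by
    intro i j hij
    by_contra hne
    exact hd i j hne (b i) (hw i).end_mem (hij ▸ (hw j).end_mem)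
  have hsurj : ∀ s ∈ B, ∃ i, b i = s := by
    have himg : Finset.univ.image b = B := by
      apply Finset.eq_of_subset_of_card_le
      · intro s hs
        obtain ⟨i, -, rfl⟩ := Finset.mem_image.1 hs
        exact hb i
      · rw [Finset.card_image_of_injective _ hinj, hB]; simp
    intro s hs
    rw [← himg] at hs
    simpa using hs
  have key : ∀ s, ∃ l : List V, s ∈ B → ∃ i, b i = s ∧ (∃ a ∈ A, IsWalk R (l ++ [s]) a s) ∧
      (∀ v ∈ l, v ∉ B) ∧ l ++ [s] ⊆ P i := by
    intro s
    by_cases hs : s ∈ B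
    · obtain ⟨i, rfl⟩ := hsurj s hs
      obtain ⟨l₁, t, l₂, hl, ht, h₁⟩ :=
        List.exists_first_mem (p := (· ∈ B)) ⟨b i, (hw i).end_mem, hb i⟩
      obtain ⟨j, rfl⟩ := hsurj t ht
      have hji : j = i := by
        by_contra hne
        exact hd j i hne (b j) (hw j).end_mem (by rw [hl]; simp)
      subst hji
      refine ⟨l₁, fun _ => ⟨j, rfl, ⟨a j, ha j, ?_⟩, h₁, ?_⟩⟩
      · have := hw j
        rw [hl] at this
        exact this.left
      · rw [hl]; intro v; simp; tauto
    · exact ⟨[], fun h => absurd h hs⟩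
  choose L hL using key
  refine ⟨L, fun s hs => ?_, fun s hs t ht hst v hv hv' => ?_⟩
  · obtain ⟨i, -, h1, h2, -⟩ := hL s hs
    exact ⟨h1, h2⟩
  · obtain ⟨i, hi, -, -, h1⟩ := hL s hs
    obtain ⟨j, hj, -, -, h2⟩ := hL t ht
    have hij : i ≠ j := by rintro rfl; exact hst (hi.symm.trans hj)
    exact hd i j hij v (h1 hv) (h2 hv')

theorem HasLinkage.of_finset_index {ι : Type} (T : Finset ι) (hT : T.card = k) (Q : ι → List V)
    (hQ : ∀ s ∈ T, ∃ a ∈ A, ∃ b ∈ B, IsWalk R (Q s) a b)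
    (hd : ∀ s ∈ T, ∀ t ∈ T, s ≠ t → ∀ v ∈ Q s, v ∉ Q t) : HasLinkage R A B k := by
  let e := (T.equivFinOfCardEq hT).symm
  refine ⟨fun i => Q (e i), fun i => hQ _ (e i).2, fun i j hij => hd _ (e i).2 _ (e j).2 ?_⟩
  intro h
  exact hij (e.injective (Subtype.ext h))

/-- Linkages to `insert x S` and from `insert y S` avoiding the arc `(x, y)`, where `S` separates
in the absence of this arc, combine to a linkage. -/
theorem HasLinkage.glue [DecidableEq V] (hxy : R x y) (hx : x ∉ S) (hy : y ∉ S)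
    (hk : S.card + 1 = k) (hS : Separates (deleteArc R x y) A B S)
    (hA : HasLinkage (deleteArc R x y) A (insert x S) k)
    (hB : HasLinkage (deleteArc R x y) (insert y S) B k) : HasLinkage R A B k := by
  obtain ⟨L, hL, hLd⟩ := hA.exists_indexed (by rw [Finset.card_insert_of_notMem hx, hk])
  obtain ⟨M, hM, hMd⟩ := hB.flip.exists_indexed (by rw [Finset.card_insert_of_notMem hy, hk])
  have hM' : ∀ s ∈ insert y S, (∃ b ∈ B, IsWalk (deleteArc R x y) (s :: (M s).reverse) s b) ∧
      ∀ v ∈ M s, v ∉ insert y S := by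
    intro s hs
    obtain ⟨⟨b, hb, hw⟩, h2⟩ := hM s hs
    refine ⟨⟨b, hb, ?_⟩, h2⟩
    have := hw.reverse
    simpa using this
  have le : ∀ a b, deleteArc R x y a b → R a b := fun a b h => h.1
  have memS : ∀ s ∈ insert x S, ∀ v ∈ L s ++ [s], v ∈ S → v = s := by
    intro s hs v hv hvS
    rcases List.mem_append.1 hv with hv | hv
    · exact absurd (Finset.mem_insert_of_mem hvS) ((hL s hs).2 v hv)
    · simpa using hv
  have memS' : ∀ s ∈ insert y S, ∀ v ∈ M s ++ [s], v ∈ S → v = s := by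
    intro s hs v hv hvS
    rcases List.mem_append.1 hv with hv | hv
    · exact absurd (Finset.mem_insert_of_mem hvS) ((hM s hs).2 v hv)
    · simpa using hv
  have cross : ∀ s ∈ insert x S, ∀ t ∈ insert y S, ∀ v ∈ L s ++ [s], v ∈ M t ++ [t] →
      v ∈ S ∧ v = s ∧ v = t := by
    intro s hs t ht v hv hv'
    by_cases hvS : v ∈ S
    · exact ⟨hvS, memS s hs v hv hvS, memS' t ht v hv' hvS⟩
    exfalso
    have first : ∃ l₁, ∃ a ∈ A, IsWalk (deleteArc R x y) (l₁ ++ [v]) a v ∧ ∀ z ∈ l₁, z ∉ S := by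
      obtain ⟨a, ha, hw⟩ := (hL s hs).1
      rcases List.mem_append.1 hv with hv | hv
      · obtain ⟨l₁, l₂, hl⟩ := List.append_of_mem hv
        refine ⟨l₁, a, ha, ?_, fun z hz hzS => ?_⟩
        · rw [hl, List.append_assoc] at hw
          exact IsWalk.left (l₂ := l₂ ++ [s]) hw
        · exact (hL s hs).2 z (by rw [hl]; simp [hz]) (by simp [hzS])
      · simp only [List.mem_singleton] at hv
        subst hv
        exact ⟨L v, a, ha, hw, fun z hz hzS => (hL v hs).2 z hz (by simp [hzS])⟩
    have second : ∃ l₂, ∃ b ∈ B, IsWalk (deleteArc R x y) (v :: l₂) v b ∧ ∀ z ∈ l₂, z ∉ S := by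
      obtain ⟨b, hb, hw⟩ := (hM' t ht).1
      rcases List.mem_append.1 hv' with hv' | hv'
      · obtain ⟨l₁, l₂, hl⟩ := List.append_of_mem (List.mem_reverse.2 hv')
        refine ⟨l₂, b, hb, ?_, fun z hz hzS => ?_⟩
        · rw [hl] at hw
          exact IsWalk.right (l₁ := t :: l₁) hw
        · exact (hM t ht).2 z (by rw [← List.mem_reverse, hl]; simp [hz]) (by simp [hzS])
      · simp only [List.mem_singleton] at hv'
        subst hv'
        exact ⟨_, b, hb, hw, fun z hz hzS => (hM v ht).2 z (by simpa using hz) (by simp [hzS])⟩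
    obtain ⟨l₁, a, ha, hw₁, h₁⟩ := first
    obtain ⟨l₂, b, hb, hw₂, h₂⟩ := second
    obtain ⟨z, hz, hzS⟩ := hS _ a ha b hb (hw₁.join hw₂)
    simp only [List.mem_append, List.mem_cons] at hz
    rcases hz with hz | rfl | hz
    · exact h₁ z hz hzS
    · exact hvS hzS
    · exact h₂ z hz hzS
  let τ : V → V := fun s => if s = x then y else s
  have hτx : τ x = y := if_pos rfl
  have hτ : ∀ s ∈ S, τ s = s := fun s hs => if_neg (by rintro rfl; exact hx hs)
  have hτmem : ∀ s ∈ insert x S, τ s ∈ insert y S := by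
    intro s hs
    rcases Finset.mem_insert.1 hs with rfl | hs
    · simp [hτx]
    · simp [hτ s hs, hs]
  have hτinj : ∀ s ∈ insert x S, ∀ t ∈ insert x S, τ s = τ t → s = t := by
    intro s hs t ht h
    rcases Finset.mem_insert.1 hs with hs' | hs' <;> rcases Finset.mem_insert.1 ht with ht' | ht'
    · exact hs'.trans ht'.symm
    · rw [hs', hτx, hτ t ht'] at h; exact absurd (h ▸ ht') hy
    · rw [ht', hτx, hτ s hs'] at h; exact absurd (h ▸ hs') hy
    · rwa [hτ s hs', hτ t ht'] at h
  have hQ : ∀ s, ∃ Q : List V, s ∈ insert x S → (∃ a ∈ A, ∃ b ∈ B, IsWalk R Q a b) ∧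
      ∀ v ∈ Q, v ∈ L s ++ [s] ∨ v ∈ M (τ s) ++ [τ s] := by
    intro s
    by_cases hs : s ∈ insert x S
    swap
    · exact ⟨[], fun h => absurd h hs⟩
    obtain ⟨a, ha, hw⟩ := (hL s hs).1
    obtain ⟨b, hb, hw'⟩ := (hM' _ (hτmem s hs)).1
    by_cases hsx : s = x
    · subst hsx
      rw [hτx] at hw' ⊢
      refine ⟨L s ++ s :: y :: (M y).reverse, fun _ =>
        ⟨⟨a, ha, b, hb, (hw.mono le).join ((hw'.mono le).cons hxy)⟩, ?_⟩⟩
      intro v; simp; tauto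
    · have hsS : s ∈ S := Finset.mem_of_mem_insert_of_ne hs hsx
      rw [hτ s hsS] at hw' ⊢
      refine ⟨L s ++ s :: (M s).reverse, fun _ =>
        ⟨⟨a, ha, b, hb, (hw.mono le).join (hw'.mono le)⟩, ?_⟩⟩
      intro v; simp; tauto
  choose Q hQ using hQ
  have cross' : ∀ s ∈ insert x S, ∀ t ∈ insert x S, s ≠ t → ∀ v ∈ L s ++ [s],
      v ∉ M (τ t) ++ [τ t] := by
    intro s hs t ht hst v hv hv'
    obtain ⟨hvS, rfl, h2⟩ := cross s hs _ (hτmem t ht) v hv hv'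
    exact hst (hτinj v hs t ht ((hτ v hvS).trans h2))
  refine HasLinkage.of_finset_index (insert x S) (by rw [Finset.card_insert_of_notMem hx, hk]) Q
    (fun s hs => (hQ s hs).1) ?_
  intro s hs t ht hst v hv hv'
  rcases (hQ s hs).2 v hv with h | h <;> rcases (hQ t ht).2 v hv' with h' | h'
  · exact hLd s hs t ht hst v h h'
  · exact cross' s hs t ht hst v h h'
  · exact cross' t ht s hs hst.symm v h' h
  · exact hMd _ (hτmem s hs) _ (hτmem t ht) (fun e => hst (hτinj s hs t ht e)) v h h'

/-- **Menger's theorem** for finite digraphs: if no set of fewer than `k` vertices separates `A`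
from `B`, there are `k` disjoint walks from `A` to `B`. -/
theorem menger [Finite V] (R : V → V → Prop) (A B : Finset V) (k : ℕ)
    (h : ∀ S, Separates R A B S → k ≤ S.card) : HasLinkage R A B k := by
  classical
  induction hn : {p : V × V | R p.1 p.2}.ncard using Nat.strong_induction_on
    generalizing R A B with
  | _ n ih =>
  by_cases hR : ∃ x y, R x y
  · obtain ⟨x, y, hxy⟩ := hR
    have hlt : {p : V × V | deleteArc R x y p.1 p.2}.ncard < n := by
      rw [← hn]
      apply Set.ncard_lt_ncard _ (Set.toFinite _)
      refine ⟨fun p hp => hp.1, fun hsub => ?_⟩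
      exact (hsub (show (x, y) ∈ {p : V × V | R p.1 p.2} from hxy)).2 ⟨rfl, rfl⟩
    by_cases hdel : ∀ S, Separates (deleteArc R x y) A B S → k ≤ S.card
    · obtain ⟨P, hP, hd⟩ := ih _ hlt _ A B hdel rfl
      refine ⟨P, fun i => ?_, hd⟩
      obtain ⟨a, ha, b, hb, hw⟩ := hP i
      exact ⟨a, ha, b, hb, hw.mono fun _ _ h => h.1⟩
    · push Not at hdel
      obtain ⟨S, hS, hSk⟩ := hdel
      have left : ∀ Z, Separates (deleteArc R x y) A (insert x S) Z → k ≤ Z.card :=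
        fun Z hZ => h Z (hS.of_insert hZ)
      have hS' : Separates (deleteArc (flip R) y x) B A S := by
        rw [← flip_deleteArc]; exact hS.flip
      have right : ∀ Z, Separates (deleteArc R x y) (insert y S) B Z → k ≤ Z.card := by
        intro Z hZ
        have := hZ.flip
        rw [flip_deleteArc] at this
        exact h Z (hS'.of_insert this).flip
      have hx1 : k ≤ (insert x S).card := left _ fun l a _ b hb hl => ⟨b, hl.end_mem, hb⟩
      have hy1 : k ≤ (insert y S).card := right _ fun l a ha b _ hl => ⟨a, hl.start_mem, ha⟩
      have hx : x ∉ S := by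
        intro hx; rw [Finset.insert_eq_of_mem hx] at hx1; omega
      have hy : y ∉ S := by
        intro hy; rw [Finset.insert_eq_of_mem hy] at hy1; omega
      have hk : S.card + 1 = k := by
        rw [Finset.card_insert_of_notMem hx] at hx1; omega
      exact HasLinkage.glue hxy hx hy hk hS (ih _ hlt _ _ _ left rfl) (ih _ hlt _ _ _ right rfl)
  · push Not at hR
    have hcard : k ≤ (A ∩ B).card := by
      refine h _ fun l a ha b hb hl => ?_
      obtain ⟨h1, h2, h3⟩ := hl
      match l, h1, h2, h3 with
      | [v], _, h2, h3 =>
        simp only [List.head?_cons, Option.some.injEq, List.getLast?_singleton] at h2 h3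
        subst h2 h3
        exact ⟨v, by simp, by simp [ha, hb]⟩
      | u :: v :: l, h1, _, _ => exact absurd (List.isChain_cons_cons.1 h1).1 (hR u v)
    obtain ⟨T, hT, hTk⟩ := Finset.exists_subset_card_eq hcard
    refine HasLinkage.of_finset_index T hTk (fun v => [v]) (fun s hs => ?_) (by simp)
    have := Finset.mem_inter.1 (hT hs)
    exact ⟨s, this.1, s, this.2, IsWalk.singleton R s⟩

end Menger

section Matching

variable {V : Type} {k : ℕ}

/-- The values taken by a partial function on `Fin k`. -/
def usedBy [DecidableEq V] (f : Fin k → Option V) : Finset V :=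
  Finset.univ.biUnion fun i => (f i).toFinset

theorem mem_usedBy [DecidableEq V] {f : Fin k → Option V} {v : V} :
    v ∈ usedBy f ↔ ∃ i, f i = some v := by
  simp [usedBy]

theorem card_usedBy_le [DecidableEq V] (f : Fin k → Option V) : (usedBy f).card ≤ k := by
  refine (Finset.card_biUnion_le_card_mul _ _ 1 fun i _ => ?_).trans (by simp)
  cases f i <;> simp

theorem card_usedBy_lt [DecidableEq V] {f : Fin k → Option V} {i : Fin k} (hi : f i = none) :
    (usedBy f).card < k := by
  have hsub : usedBy f ⊆ (Finset.univ.erase i).biUnion fun i => (f i).toFinset := by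
    intro v hv
    obtain ⟨j, hj⟩ := mem_usedBy.1 hv
    have hji : j ≠ i := by rintro rfl; simp [hi] at hj
    simp only [Finset.mem_biUnion]
    exact ⟨j, by simp [hji], by simp [hj]⟩
  have h1 : ((Finset.univ.erase i).biUnion fun i => (f i).toFinset).card ≤
      (Finset.univ.erase i).card * 1 :=
    Finset.card_biUnion_le_card_mul _ _ 1 fun i _ => by cases f i <;> simp
  have h2 := Finset.card_le_card hsub
  have h3 : (Finset.univ.erase i).card = k - 1 := by simp
  have := i.pos
  omega

/-- `f` is a partial matching in the bipartite graph `r` which cannot be extended. -/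
structure IsMaximalMatching (r : Fin k → V → Prop) (f : Fin k → Option V) : Prop where
  rel : ∀ {i v}, f i = some v → r i v
  inj : ∀ {i j v}, f i = some v → f j = some v → i = j
  maximal : ∀ {i}, f i = none → ∀ v, r i v → ∃ j, f j = some v

theorem exists_isMaximalMatching [Finite V] (r : Fin k → V → Prop) :
    ∃ f, IsMaximalMatching r f := by
  classical
  let F := {f : Fin k → Option V // (∀ i v, f i = some v → r i v) ∧
    ∀ i j v, f i = some v → f j = some v → i = j}
  have : Nonempty F := ⟨⟨fun _ => none, by simp, by simp⟩⟩
  obtain ⟨⟨f, hf₁, hf₂⟩, hmax⟩ :=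
    Finite.exists_max fun f : F => (Finset.univ.filter fun i => f.1 i ≠ none).card
  refine ⟨f, fun {i v} => hf₁ i v, fun {i j v} => hf₂ i j v, ?_⟩
  intro i hi v hv
  by_contra! hne
  have hupd : ∀ j w, Function.update f i (some v) j = some w → (j = i ∧ w = v) ∨
      (j ≠ i ∧ f j = some w) := by
    intro j w h
    by_cases hj : j = i
    · subst hj; simp at h; exact .inl ⟨rfl, h.symm⟩
    · rw [Function.update_of_ne hj] at h; exact .inr ⟨hj, h⟩
  have := hmax ⟨Function.update f i (some v), ?_, ?_⟩
  · refine absurd this (not_le.2 (Finset.card_lt_card ?_))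
    rw [Finset.ssubset_iff_of_subset]
    · exact ⟨i, by simp, by simp [hi]⟩
    · intro j hj
      simp only [Finset.mem_filter, Finset.mem_univ, true_and] at hj ⊢
      by_cases hji : j = i
      · subst hji; simp
      · rwa [Function.update_of_ne hji]
  · intro j w h
    rcases hupd j w h with ⟨rfl, rfl⟩ | ⟨-, h⟩
    · exact hv
    · exact hf₁ j w h
  · intro j₁ j₂ w h₁ h₂
    rcases hupd j₁ w h₁ with ⟨e₁, e₁'⟩ | ⟨-, h₁'⟩ <;>
      rcases hupd j₂ w h₂ with ⟨e₂, e₂'⟩ | ⟨-, h₂'⟩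
    · exact e₁.trans e₂.symm
    · exact absurd (e₁' ▸ h₂') (hne j₂)
    · exact absurd (e₂' ▸ h₁') (hne j₁)
    · exact hf₂ _ _ _ h₁' h₂'

end Matching

theorem Finset.exists_subset_card_eq_minimizing {V : Type} (A : Finset V) (d : V → ℕ) (m : ℕ)
    (hm : m ≤ A.card) :
    ∃ W ⊆ A, W.card = m ∧ ∀ w ∈ W, ∀ u ∈ A, u ∉ W → d w ≤ d u := by
  classical
  induction m with
  | zero => exact ⟨∅, by simp, rfl, by simp⟩
  | succ m ih =>
    obtain ⟨W, hWA, hW, hmin⟩ := ih (by omega)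
    have hne : (A \ W).Nonempty := by
      rw [← Finset.card_pos, Finset.card_sdiff_of_subset hWA]; omega
    obtain ⟨z, hz, hzmin⟩ := Finset.exists_min_image (A \ W) d hne
    obtain ⟨hzA, hzW⟩ := Finset.mem_sdiff.1 hz
    refine ⟨insert z W, Finset.insert_subset hzA hWA, by
      rw [Finset.card_insert_of_notMem hzW, hW], ?_⟩
    intro w hw u hu huW
    simp only [Finset.mem_insert, not_or] at huW
    rcases Finset.mem_insert.1 hw with rfl | hw
    · exact hzmin u (Finset.mem_sdiff.2 ⟨hu, huW.2⟩)
    · exact hmin w hw u hu huW.2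

/-- In an oriented graph, the vertices with fewer than `c` non-out-neighbours inside a set that
contains them all are fewer than `2 * c`. -/
theorem card_filter_nonoutneighbors_le {V : Type} [DecidableEq V] (T : V → V → Prop)
    [DecidableRel T] (hT : ∀ u v, T u v → ¬ T v u) (A : Finset V) (c : ℕ) :
    (A.filter fun u => (A.filter fun a => ¬ T u a).card < c).card ≤ 2 * c := by
  set E := A.filter fun u => (A.filter fun a => ¬ T u a).card < c with hE
  have hEA : E ⊆ A := Finset.filter_subset _ _
  rcases E.eq_empty_or_nonempty with h | hne
  · simp [h]
  have hswap : ∑ u ∈ E, (E.filter fun a => T u a).card = ∑ u ∈ E, (E.filter fun a => T a u).card :=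
    Finset.sum_card_bipartiteAbove_eq_sum_card_bipartiteBelow T
  have hle : ∀ u ∈ E, (E.filter fun a => T u a).card + (E.filter fun a => T a u).card ≤ E.card := by
    intro u _
    rw [← Finset.card_union_of_disjoint]
    · exact Finset.card_le_card (Finset.union_subset (Finset.filter_subset _ _)
        (Finset.filter_subset _ _))
    · rw [Finset.disjoint_filter]
      exact fun a _ h => hT _ _ h
  have hge : ∀ u ∈ E, E.card ≤ (E.filter fun a => T u a).card + c := by
    intro u hu
    have h1 : (E.filter fun a => ¬ T u a).card < c :=
      (Finset.card_le_card (Finset.filter_subset_filter _ hEA)).trans_lt (Finset.mem_filter.1 hu).2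
    have := Finset.card_filter_add_card_filter_not (s := E) (fun a => T u a)
    omega
  have h1 := Finset.sum_le_sum hle
  rw [Finset.sum_add_distrib, ← hswap] at h1
  have h2 := Finset.sum_le_sum hge
  rw [Finset.sum_add_distrib] at h2
  simp only [Finset.sum_const, smul_eq_mul] at h1 h2
  have hpos := hne.card_pos
  by_contra! hcon
  nlinarith

/-- Adjacency in an extended semicomplete digraph whose parts are the fibres of `φ`. -/
structure IsExtendedSemicomplete {V ι : Type} (R : V → V → Prop) (φ : V → ι) : Prop where
  total : ∀ {u v}, φ u ≠ φ v → R u v ∨ R v u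
  left_iff : ∀ {u v} z, φ u = φ v → (R u z ↔ R v z)
  right_iff : ∀ {u v} z, φ u = φ v → (R z u ↔ R z v)

/-- An extended semicomplete digraph has a set `W` of `m` hubs: apart from few exceptions, every
vertex outside `W` that is not a twin of a hub `w` dominates `w` or reaches it by `c` paths with
two arcs. -/
theorem IsExtendedSemicomplete.exists_hubs {V ι : Type} [Fintype V] [DecidableEq V]
    {R : V → V → Prop} [DecidableRel R] {φ : V → ι} (hR : IsExtendedSemicomplete R φ)
    (hirr : ∀ v, ¬ R v v)
    (A : Finset V) (m c : ℕ) (hm : m ≤ A.card) :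
    ∃ W ⊆ A, W.card = m ∧ ∃ E : V → Finset V, (∀ w, (E w).card ≤ 2 * c) ∧
      ∀ w ∈ W, ∀ u ∈ A, u ∉ W → u ∉ E w → R u w ∨ φ u = φ w ∨
        c ≤ (A.filter fun v => R u v ∧ R v w).card := by
  let e := Fintype.equivFin V
  let T : V → V → Prop := fun u v => R u v ∧ (¬ R v u ∨ e u < e v)
  have hTasym : ∀ u v, T u v → ¬ T v u := by
    rintro u v ⟨h1, h2⟩ ⟨h3, h4⟩
    rcases h2 with h2 | h2
    · exact h2 h3
    · rcases h4 with h4 | h4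
      · exact h4 h1
      · exact lt_asymm h2 h4
  have hTtot : ∀ u v, R u v → T u v ∨ T v u := by
    intro u v h
    by_cases h' : R v u
    · rcases lt_trichotomy (e u) (e v) with hlt | heq | hlt
      · exact .inl ⟨h, .inr hlt⟩
      · rw [e.injective heq] at h; exact absurd h (hirr v)
      · exact .inr ⟨h', .inr hlt⟩
    · exact .inl ⟨h, .inl h'⟩
  obtain ⟨W, hWA, hW, hmin⟩ :=
    A.exists_subset_card_eq_minimizing (fun u => (A.filter fun v => T u v).card) m hm
  refine ⟨W, hWA, hW, fun w => (A.filter fun v => T w v).filter fun u =>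
    ((A.filter fun v => T w v).filter fun a => ¬ T u a).card < c,
    fun w => card_filter_nonoutneighbors_le T hTasym _ c, ?_⟩
  intro w hw u hu huW huE
  by_contra! hcon
  obtain ⟨h1, h2, h3⟩ := hcon
  have hwu : R w u := (hR.total h2).resolve_left h1
  have hTwu : T w u := ⟨hwu, .inl h1⟩
  have hbig : c ≤ ((A.filter fun v => T w v).filter fun a => ¬ T u a).card := by
    by_contra! hlt
    exact huE (Finset.mem_filter.2 ⟨Finset.mem_filter.2 ⟨hu, hTwu⟩, hlt⟩)
  have hd := hmin w hw u hu huW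
  have e1 := Finset.card_filter_add_card_filter_not (s := A.filter fun v => T w v) (fun a => T u a)
  have e2 := Finset.card_filter_add_card_filter_not (s := A.filter fun v => T u v) (fun a => T w a)
  have e3 : (A.filter fun v => T w v).filter (fun a => T u a) =
      (A.filter fun v => T u v).filter (fun a => T w a) := by
    ext a; simp; tauto
  rw [e3] at e1
  have hsub : ((A.filter fun v => T u v).filter fun a => ¬ T w a) ⊆
      A.filter fun v => R u v ∧ R v w := by
    intro v hv
    simp only [Finset.mem_filter] at hv ⊢
    obtain ⟨⟨hvA, huv⟩, hnw⟩ := hv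
    refine ⟨hvA, huv.1, ?_⟩
    by_contra hvw
    have hφ : φ v ≠ φ w := fun h => h1 ((hR.right_iff u h).1 huv.1)
    exact hnw ⟨(hR.total hφ).resolve_left hvw, .inl hvw⟩
  have := Finset.card_le_card hsub
  omega

/-- `P` consists of disjoint walks avoiding `F` from vertices of `W` to the vertices `y i`. -/
structure IsLinkageTo {V : Type} {k : ℕ} (R : V → V → Prop) (W F : Finset V) (y : Fin k → V)
    (P : Fin k → List V) : Prop where
  walk : ∀ i, ∃ w ∈ W, IsWalk R (P i) w (y i)
  avoid : ∀ {i v}, v ∈ P i → v ∉ F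
  disj : ∀ {i j v}, v ∈ P i → v ∈ P j → i = j

/-- A linkage to `y` with the smallest possible total length. -/
structure IsMinLinkageTo {V : Type} {k : ℕ} (R : V → V → Prop) (W F : Finset V) (y : Fin k → V)
    (P : Fin k → List V) : Prop extends IsLinkageTo R W F y P where
  sum_length_le : ∀ Q, IsLinkageTo R W F y Q → ∑ i, (P i).length ≤ ∑ i, (Q i).length

theorem IsLinkageTo.exists_min {V : Type} {k : ℕ} {R : V → V → Prop} {W F : Finset V}
    {y : Fin k → V} {P : Fin k → List V} (h : IsLinkageTo R W F y P) :
    ∃ P, IsMinLinkageTo R W F y P := by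
  classical
  have hex : ∃ n, ∃ P, IsLinkageTo R W F y P ∧ ∑ i, (P i).length = n := ⟨_, P, h, rfl⟩
  obtain ⟨Q, hQ, hn⟩ := Nat.find_spec hex
  exact ⟨Q, hQ, fun Q' hQ' => hn ▸ Nat.find_min' hex ⟨Q', hQ', rfl⟩⟩

theorem HasLinkage.isLinkageTo {V : Type} {k : ℕ} {R : V → V → Prop} {W F : Finset V}
    {y : Fin k → V} [DecidableEq V] (hy : Function.Injective y) (hyF : ∀ i, y i ∉ F)
    (h : HasLinkage (fun u v => R u v ∧ u ∉ F ∧ v ∉ F) W (Finset.univ.image y) k) :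
    ∃ P, IsLinkageTo R W F y P := by
  obtain ⟨L, hL, hd⟩ := h.exists_indexed (by rw [Finset.card_image_of_injective _ hy]; simp)
  have hmem : ∀ i, y i ∈ Finset.univ.image y := fun i => by simp
  refine ⟨fun i => L (y i) ++ [y i], fun i => ?_, fun {i v} hv => ?_, fun {i j v} hi hj => ?_⟩
  · obtain ⟨a, ha, hw⟩ := (hL _ (hmem i)).1
    exact ⟨a, ha, hw.mono fun _ _ h => h.1⟩
  · obtain ⟨a, ha, hw⟩ := (hL _ (hmem i)).1
    obtain ⟨l₁, l₂, hl⟩ := List.append_of_mem hv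
    rw [hl] at hw
    cases l₂ with
    | nil =>
      have : v = y i := by simpa using hw.right.2.2
      exact this ▸ hyF i
    | cons b l₂ => exact (List.isChain_cons_cons.1 hw.right.1).1.2.1
  · by_contra hij
    exact hd _ (hmem i) _ (hmem j) (fun e => hij (hy e)) v hi hj

namespace IsMinLinkageTo

variable {V ι : Type} {k : ℕ} {R : V → V → Prop} {W F : Finset V} {y : Fin k → V}
  {P : Fin k → List V} {φ : V → ι}

theorem length_le (h : IsMinLinkageTo R W F y P) {j : Fin k} {Q : List V} {w : V} (hw : w ∈ W)
    (hQ : IsWalk R Q w (y j)) (hF : ∀ v ∈ Q, v ∉ F) (hd : ∀ i ≠ j, ∀ v ∈ Q, v ∉ P i) :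
    (P j).length ≤ Q.length := by
  have hlink : IsLinkageTo R W F y (Function.update P j Q) := by
    refine ⟨fun i => ?_, fun {i v} hv => ?_, fun {i₁ i₂ v} h₁ h₂ => ?_⟩
    · by_cases hi : i = j
      · subst hi; exact ⟨w, hw, by simpa using hQ⟩
      · rw [Function.update_of_ne hi]; exact h.walk i
    · by_cases hi : i = j
      · subst hi; exact hF v (by simpa using hv)
      · rw [Function.update_of_ne hi] at hv; exact h.avoid hv
    · by_cases hi₁ : i₁ = j <;> by_cases hi₂ : i₂ = j
      · exact hi₁.trans hi₂.symm
      · rw [Function.update_of_ne hi₂] at h₂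
        rw [hi₁, Function.update_self] at h₁
        exact absurd h₂ (hd i₂ hi₂ v h₁)
      · rw [Function.update_of_ne hi₁] at h₁
        rw [hi₂, Function.update_self] at h₂
        exact absurd h₁ (hd i₁ hi₁ v h₂)
      · rw [Function.update_of_ne hi₁] at h₁
        rw [Function.update_of_ne hi₂] at h₂
        exact h.disj h₁ h₂
  have hle := h.sum_length_le _ hlink
  rw [← Finset.add_sum_erase _ _ (Finset.mem_univ j),
    ← Finset.add_sum_erase _ (fun i => (Function.update P j Q i).length) (Finset.mem_univ j)] at hle
  have hsum : ∑ i ∈ Finset.univ.erase j, (Function.update P j Q i).length =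
      ∑ i ∈ Finset.univ.erase j, (P i).length :=
    Finset.sum_congr rfl fun i hi => by rw [Function.update_of_ne (Finset.ne_of_mem_erase hi)]
  rw [hsum, Function.update_self] at hle
  omega

theorem suffix_avoid (h : IsMinLinkageTo R W F y P) {j : Fin k} {l₁ l₂ : List V} {v : V}
    (hj : P j = l₁ ++ v :: l₂) : ∀ u ∈ v :: l₂, u ∉ F ∧ ∀ i ≠ j, u ∉ P i := by
  intro u hu
  have huj : u ∈ P j := by rw [hj]; exact List.mem_append_right _ hu
  exact ⟨h.avoid huj, fun i hi hui => hi (h.disj hui huj)⟩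

theorem suffix_walk (h : IsMinLinkageTo R W F y P) {j : Fin k} {l₁ l₂ : List V} {v : V}
    (hj : P j = l₁ ++ v :: l₂) : IsWalk R (v :: l₂) v (y j) := by
  obtain ⟨w, -, hw⟩ := h.walk j
  rw [hj] at hw
  exact hw.right

theorem prefix_eq_nil (h : IsMinLinkageTo R W F y P) {j : Fin k} {l₁ l₂ : List V} {v : V}
    (hj : P j = l₁ ++ v :: l₂) (hv : v ∈ W) : l₁ = [] := by
  have := h.length_le hv (h.suffix_walk hj) (fun u hu => (h.suffix_avoid hj u hu).1)
    (fun i hi u hu => (h.suffix_avoid hj u hu).2 i hi)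
  rw [hj] at this
  simp only [List.length_append, List.length_cons] at this
  exact List.eq_nil_of_length_eq_zero (by omega)

theorem not_rel_of_two_le (h : IsMinLinkageTo R W F y P) {w : V} (hw : w ∈ W) (hwF : w ∉ F)
    (hwP : ∀ i, w ∉ P i) {j : Fin k} {l₁ l₂ : List V} {v : V} (hj : P j = l₁ ++ v :: l₂)
    (hl : 2 ≤ l₁.length) : ¬ R w v := by
  intro hwv
  have := h.length_le hw ((h.suffix_walk hj).cons hwv)
    (fun u hu => by
      rcases List.mem_cons.1 hu with rfl | hu
      · exact hwF
      · exact (h.suffix_avoid hj u hu).1)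
    (fun i hi u hu => by
      rcases List.mem_cons.1 hu with rfl | hu
      · exact hwP i
      · exact (h.suffix_avoid hj u hu).2 i hi)
  rw [hj] at this
  simp only [List.length_append, List.length_cons] at this
  omega

theorem not_rel_of_three_le (h : IsMinLinkageTo R W F y P) {w u : V} (hw : w ∈ W) (hwF : w ∉ F)
    (hwP : ∀ i, w ∉ P i) (huF : u ∉ F) (huP : ∀ i, u ∉ P i) (hwu : R w u)
    {j : Fin k} {l₁ l₂ : List V} {v : V} (hj : P j = l₁ ++ v :: l₂)
    (hl : 3 ≤ l₁.length) : ¬ R u v := by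
  intro huv
  have := h.length_le hw (((h.suffix_walk hj).cons huv).cons hwu)
    (fun z hz => by
      rcases List.mem_cons.1 hz with rfl | hz
      · exact hwF
      rcases List.mem_cons.1 hz with rfl | hz
      · exact huF
      · exact (h.suffix_avoid hj z hz).1)
    (fun i hi z hz => by
      rcases List.mem_cons.1 hz with rfl | hz
      · exact hwP i
      rcases List.mem_cons.1 hz with rfl | hz
      · exact huP i
      · exact (h.suffix_avoid hj z hz).2 i hi)
  rw [hj] at this
  simp only [List.length_append, List.length_cons] at this
  omega

/-- Late inner vertices of a minimum linkage dominate all unused vertices of `W`. -/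
theorem rel_of_two_le (h : IsMinLinkageTo R W F y P) (hR : IsExtendedSemicomplete R φ) {w : V}
    (hw : w ∈ W) (hwF : w ∉ F) (hwP : ∀ i, w ∉ P i) {j : Fin k} {l₁ l₂ : List V} {v : V}
    (hj : P j = l₁ ++ v :: l₂) (hl : 2 ≤ l₁.length) (hv : v ≠ y j) : R v w := by
  have hwv := h.not_rel_of_two_le hw hwF hwP hj hl
  by_contra hvw
  have hφ : φ v = φ w := by
    by_contra hne
    rcases hR.total hne with h | h
    · exact hvw h
    · exact hwv h
  have hwalk := h.suffix_walk hj
  cases l₂ with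
  | nil => exact hv (by simpa using hwalk.2.2)
  | cons z l₂ =>
    have hvz := (List.isChain_cons_cons.1 hwalk.1).1
    exact h.not_rel_of_two_le hw hwF hwP (j := j) (l₁ := l₁ ++ [v]) (l₂ := l₂) (v := z)
      (by simpa using hj) (by simp; omega) ((hR.left_iff z hφ).1 hvz)

/-- Vertices outside a minimum linkage dominating a late vertex of it dominate all unused
vertices of `W`. -/
theorem rel_of_three_le (h : IsMinLinkageTo R W F y P) (hR : IsExtendedSemicomplete R φ) {w u : V}
    (hw : w ∈ W) (hwF : w ∉ F) (hwP : ∀ i, w ∉ P i) (huF : u ∉ F) (huP : ∀ i, u ∉ P i)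
    {j : Fin k} {l₁ l₂ : List V} {v : V} (hj : P j = l₁ ++ v :: l₂)
    (hl : 3 ≤ l₁.length) (huv : R u v) : R u w := by
  by_contra huw
  have hφ : φ u = φ w := by
    by_contra hne
    rcases hR.total hne with h' | h'
    · exact huw h'
    · exact h.not_rel_of_three_le hw hwF hwP huF huP h' hj hl huv
  exact h.not_rel_of_two_le hw hwF hwP hj (by omega) ((hR.left_iff v hφ).1 huv)

theorem card_filter_mem_le [DecidableEq V] (h : IsMinLinkageTo R W F y P) :
    (W.filter fun w => ∃ i, w ∈ P i).card ≤ k := by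
  choose s _ hs using h.walk
  have : (W.filter fun w => ∃ i, w ∈ P i) ⊆ Finset.univ.image s := by
    intro w hw
    obtain ⟨hwW, i, hi⟩ := Finset.mem_filter.1 hw
    obtain ⟨l₁, l₂, hl⟩ := List.append_of_mem hi
    have h1 := h.prefix_eq_nil hl hwW
    have h2 := (hs i).2.1
    subst h1
    rw [hl] at h2
    simp only [List.nil_append, List.head?_cons, Option.some.injEq] at h2
    simp only [Finset.mem_image, Finset.mem_univ, true_and]
    exact ⟨i, h2.symm⟩
  refine (Finset.card_le_card this).trans (Finset.card_image_le.trans (by simp))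

theorem card_filter_not_rel_le [DecidableEq V] [DecidableRel R] (h : IsMinLinkageTo R W F y P)
    {v : V} (hv : ∀ w ∈ W, (∀ i, w ∉ P i) → R v w) : (W.filter fun w => ¬ R v w).card ≤ k := by
  refine (Finset.card_le_card fun w hw => ?_).trans h.card_filter_mem_le
  obtain ⟨hwW, hn⟩ := Finset.mem_filter.1 hw
  refine Finset.mem_filter.2 ⟨hwW, ?_⟩
  by_contra! hcon
  exact hn (hv w hwW hcon)

end IsMinLinkageTo

/-- If deleting fewer than `m` vertices leaves `R` strongly connected, then any `k` vertices `y i`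
can be reached by disjoint walks from `W` that avoid a set `F` of at most `m - k` vertices. -/
theorem exists_isLinkageTo {V : Type} [Finite V] [DecidableEq V] {k m : ℕ} {R : V → V → Prop}
    {W F : Finset V} {y : Fin k → V} (hy : Function.Injective y) (hyF : ∀ i, y i ∉ F)
    (hconn : ∀ S : Finset V, S.card < m → ∀ u ∉ S, ∀ v ∉ S,
      ∃ l, IsWalk R l u v ∧ ∀ z ∈ l, z ∉ S)
    (hW : k ≤ W.card) (hWF : ∀ w ∈ W, w ∉ F) (hF : F.card + k ≤ m) :
    ∃ P, IsLinkageTo R W F y P := by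
  refine HasLinkage.isLinkageTo hy hyF (menger _ _ _ _ fun S hS => ?_)
  by_contra! hSk
  obtain ⟨w, hw, hwS⟩ := Finset.exists_mem_notMem_of_card_lt_card (hSk.trans_le hW)
  obtain ⟨v, hv, hvS⟩ := Finset.exists_mem_notMem_of_card_lt_card
    (s := S) (t := Finset.univ.image y)
    (by rw [Finset.card_image_of_injective _ hy]; simpa using hSk)
  have hvF : v ∉ F := by
    obtain ⟨i, -, rfl⟩ := Finset.mem_image.1 hv
    exact hyF i
  obtain ⟨l, hl, hlS⟩ := hconn (F ∪ S) ((Finset.card_union_le _ _).trans_lt (by omega)) w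
    (by simp [hwS, hWF w hw]) v (by simp [hvF, hvS])
  simp only [Finset.mem_union, not_or] at hlS
  obtain ⟨z, hz, hzS⟩ := hS l w hw v hv ⟨by
    refine hl.1.imp_of_mem_imp fun a b ha hb hab => ⟨hab, (hlS a ha).1, (hlS b hb).1⟩, hl.2⟩
  exact (hlS z hz).2 hzS

/-- `v` lies outside the terminals and outside `W`, and dominates all but `k` vertices of `W`. -/
structure IsGood {V : Type} {k : ℕ} (R : V → V → Prop) [DecidableRel R] (x y : Fin k → V)
    (W : Finset V) (v : V) : Prop where
  ne_x : ∀ i, v ≠ x i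
  ne_y : ∀ i, v ≠ y i
  notMem : v ∉ W
  card_le : (W.filter fun w => ¬ R v w).card ≤ k

/-- The vertices among the first `t` of some walk `P i`. -/
def early {V : Type} {k : ℕ} [DecidableEq V] (P : Fin k → List V) (t : ℕ) : Finset V :=
  Finset.univ.biUnion fun i => ((P i).take t).toFinset

theorem card_early_le {V : Type} {k : ℕ} [DecidableEq V] (P : Fin k → List V) (t : ℕ) :
    (early P t).card ≤ k * t := by
  refine (Finset.card_biUnion_le_card_mul _ _ t fun i _ => ?_).trans (by simp)
  exact (List.toFinset_card_le _).trans (by simp)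

theorem mem_early_or_exists_append {V : Type} {k : ℕ} [DecidableEq V] {P : Fin k → List V}
    {j : Fin k} {v : V} (h : v ∈ P j) (t : ℕ) :
    v ∈ early P t ∨ ∃ l₁ l₂, P j = l₁ ++ v :: l₂ ∧ t ≤ l₁.length := by
  refine (List.mem_take_or_exists_append h t).imp_left fun h => ?_
  simp only [early, Finset.mem_biUnion, List.mem_toFinset]
  exact ⟨j, by simp, h⟩

/-- A minimum linkage from a set of hubs to the vertices `y i`, together with a maximal matching
from the vertices `x i` to the good vertices that the linkage avoids. -/
structure IsHubLinkage {V ι : Type} {k : ℕ} [Fintype V] [DecidableEq V] (R : V → V → Prop)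
    [DecidableRel R] (φ : V → ι) (x y : Fin k → V) (W : Finset V) (E : V → Finset V)
    (f : Fin k → Option V) (P : Fin k → List V) (s : Fin k → V) : Prop where
  ext : IsExtendedSemicomplete R φ
  inj : Function.Injective (Sum.elim x y)
  deg : ∀ v, 23 * k ≤ (Finset.univ.filter fun u => R v u).card
  card_W : W.card = 3 * k
  x_notMem_W : ∀ i, x i ∉ W
  card_E : ∀ w, (E w).card ≤ 14 * k
  hub : ∀ w ∈ W, ∀ u, (∀ i, u ≠ x i) → u ∉ W → u ∉ E w → R u w ∨ φ u = φ w ∨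
    7 * k ≤ (Finset.univ.filter fun v => (∀ i, v ≠ x i) ∧ R u v ∧ R v w).card
  matching : IsMaximalMatching (fun i v => R (x i) v ∧ IsGood R x y W v) f
  linkage : IsMinLinkageTo R W (Finset.univ.image x ∪ usedBy f) y P
  s_mem_W : ∀ i, s i ∈ W
  s_mem : ∀ i, s i ∈ P i

theorem exists_isHubLinkage {V ι : Type} {k : ℕ} [Fintype V] [DecidableEq V] {R : V → V → Prop}
    [DecidableRel R] {φ : V → ι} (hR : IsExtendedSemicomplete R φ) (hirr : ∀ v, ¬ R v v)
    {x y : Fin k → V} (hxy : Function.Injective (Sum.elim x y))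
    (hdeg : ∀ v, 23 * k ≤ (Finset.univ.filter fun u => R v u).card)
    (hconn : ∀ S : Finset V, S.card < 3 * k → ∀ u ∉ S, ∀ v ∉ S,
      ∃ l, IsWalk R l u v ∧ ∀ z ∈ l, z ∉ S) :
    ∃ W E f P s, IsHubLinkage R φ x y W E f P s := by
  have hX : (Finset.univ.image x).card ≤ k := Finset.card_image_le.trans (by simp)
  have hmemX : ∀ u, u ∈ (Finset.univ.image x)ᶜ ↔ ∀ i, u ≠ x i := by
    intro u; simp [eq_comm]
  have hcard : 3 * k ≤ (Finset.univ.image x)ᶜ.card := by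
    rw [Finset.card_compl]
    rcases Nat.eq_zero_or_pos k with rfl | hk
    · simp
    have h1 := (hdeg (x ⟨0, hk⟩)).trans (Finset.card_le_univ _)
    omega
  obtain ⟨W, hWX, hW, E, hE, hub⟩ := hR.exists_hubs hirr _ (3 * k) (7 * k) hcard
  obtain ⟨f, hf⟩ := exists_isMaximalMatching fun i v => R (x i) v ∧ IsGood R x y W v
  have hy : Function.Injective y := hxy.comp Sum.inr_injective
  have hne : ∀ i j, y i ≠ x j := fun i j h => by simpa using hxy (a₁ := .inr i) (a₂ := .inl j) h
  obtain ⟨P', hP'⟩ := exists_isLinkageTo (R := R) (W := W)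
    (F := Finset.univ.image x ∪ usedBy f) hy (fun i h => by
      rcases Finset.mem_union.1 h with h | h
      · obtain ⟨j, -, h⟩ := Finset.mem_image.1 h
        exact hne i j h.symm
      · obtain ⟨j, h⟩ := mem_usedBy.1 h
        exact (hf.rel h).2.ne_y i rfl) hconn (by omega) (fun w hw h => by
      rcases Finset.mem_union.1 h with h | h
      · exact Finset.mem_compl.1 (hWX hw) h
      · obtain ⟨j, h⟩ := mem_usedBy.1 h
        exact (hf.rel h).2.notMem hw) (by
      have := Finset.card_union_le (Finset.univ.image x) (usedBy f)
      have := card_usedBy_le f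
      omega)
  obtain ⟨P, hP⟩ := hP'.exists_min
  choose s hsW hs using hP.walk
  refine ⟨W, E, f, P, s, hR, hxy, hdeg, hW, fun i hi => ?_, fun w => (hE w).trans (by omega), ?_,
    hf, hP, hsW, fun i => (hs i).start_mem⟩
  · exact Finset.mem_compl.1 (hWX hi) (by simp)
  · intro w hw u hu huW huE
    have := hub w hw u ((hmemX u).2 hu) huW huE
    have he : (Finset.univ.filter fun v => (∀ i, v ≠ x i) ∧ R u v ∧ R v w) =
        ((Finset.univ.image x)ᶜ.filter fun v => R u v ∧ R v w) := by
      ext v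
      rw [Finset.mem_filter, Finset.mem_filter, hmemX]
      simp
    rwa [he]

namespace IsHubLinkage

variable {V ι : Type} {k : ℕ} [Fintype V] [DecidableEq V] {R : V → V → Prop} [DecidableRel R]
  {φ : V → ι} {x y : Fin k → V} {W : Finset V} {E : V → Finset V} {f : Fin k → Option V}
  {P : Fin k → List V} {s : Fin k → V}

theorem x_notMem (h : IsHubLinkage R φ x y W E f P s) (i j : Fin k) : x i ∉ P j := fun hi =>
  h.linkage.avoid hi (by simp)

theorem f_notMem (h : IsHubLinkage R φ x y W E f P s) {i j : Fin k} {v : V} (hi : f i = some v) :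
    v ∉ P j := fun hj => h.linkage.avoid hj (Finset.mem_union_right _ (mem_usedBy.2 ⟨i, hi⟩))

theorem y_mem (h : IsHubLinkage R φ x y W E f P s) (i : Fin k) : y i ∈ P i := by
  obtain ⟨w, -, hw⟩ := h.linkage.walk i
  exact hw.end_mem

theorem W_notMem (h : IsHubLinkage R φ x y W E f P s) {w : V} (hw : w ∈ W) :
    w ∉ Finset.univ.image x ∪ usedBy f := by
  intro hcon
  rcases Finset.mem_union.1 hcon with hc | hc
  · obtain ⟨j, -, rfl⟩ := Finset.mem_image.1 hc
    exact h.x_notMem_W j hw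
  · obtain ⟨j, hc⟩ := mem_usedBy.1 hc
    exact (h.matching.rel hc).2.notMem hw

theorem isGood_of_mem (h : IsHubLinkage R φ x y W E f P s) {j : Fin k} {l₁ l₂ : List V} {v : V}
    (hj : P j = l₁ ++ v :: l₂) (hl : 2 ≤ l₁.length) (hv : ∀ i, v ≠ y i) : IsGood R x y W v where
  ne_x i e := h.x_notMem i j (by rw [hj, ← e]; simp)
  ne_y := hv
  notMem hvW := by simp [h.linkage.prefix_eq_nil hj hvW] at hl
  card_le := h.linkage.card_filter_not_rel_le fun w hw hwP =>
    h.linkage.rel_of_two_le h.ext hw (h.W_notMem hw) hwP hj hl (hv j)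

/-- The next vertices of `z` on the linkage `P` and of its outneighbours are near the beginning. -/
structure IsBase (R : V → V → Prop) (y : Fin k → V) (W F : Finset V) (P : Fin k → List V)
    (z : V) : Prop where
  mem_early_two : ∀ {j v}, v ∈ P j → R z v → (∀ i, v ≠ y i) → v ∈ early P 2
  mem_early_three : ∀ {u}, R z u → u ∉ F → u ∉ W → (∀ j, u ∉ P j) → ∀ {j v}, v ∈ P j → R u v →
    v ∈ early P 3

theorem isBase_hub (h : IsHubLinkage R φ x y W E f P s) {w : V} (hw : w ∈ W)
    (hwP : ∀ j, w ∉ P j) : IsBase R y W (Finset.univ.image x ∪ usedBy f) P w where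
  mem_early_two {j v} hv hwv _ := by
    refine (mem_early_or_exists_append hv 2).resolve_right ?_
    rintro ⟨l₁, l₂, hl, hl₁⟩
    exact h.linkage.not_rel_of_two_le hw (h.W_notMem hw) hwP hl hl₁ hwv
  mem_early_three {u} hwu huF _ huP {j v} hv huv := by
    refine (mem_early_or_exists_append hv 3).resolve_right ?_
    rintro ⟨l₁, l₂, hl, hl₁⟩
    exact h.linkage.not_rel_of_three_le hw (h.W_notMem hw) hwP huF huP hwu hl hl₁ huv

theorem isBase_source (h : IsHubLinkage R φ x y W E f P s) {i : Fin k} (hi : f i = none) :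
    IsBase R y W (Finset.univ.image x ∪ usedBy f) P (x i) where
  mem_early_two {j v} hv hxv hvy := by
    refine (mem_early_or_exists_append hv 2).resolve_right ?_
    rintro ⟨l₁, l₂, hl, hl₁⟩
    obtain ⟨i', hi'⟩ := h.matching.maximal hi v ⟨hxv, h.isGood_of_mem hl hl₁ hvy⟩
    exact h.f_notMem hi' hv
  mem_early_three {u} hxu huF huW huP {j v} hv huv := by
    refine (mem_early_or_exists_append hv 3).resolve_right ?_
    rintro ⟨l₁, l₂, hl, hl₁⟩
    have hgood : IsGood R x y W u :=
      { ne_x := fun i' e => huF (by simp [e])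
        ne_y := fun i' e => huP i' (e ▸ h.y_mem i')
        notMem := huW
        card_le := h.linkage.card_filter_not_rel_le fun w hw hwP =>
          h.linkage.rel_of_three_le h.ext hw (h.W_notMem hw) hwP huF huP hl hl₁ huv }
    exact huF (Finset.mem_union_right _ (mem_usedBy.2 (h.matching.maximal hi u ⟨hxu, hgood⟩)))

/-- `w` is an unused hub that `x i` reaches directly or through its good vertex `f i`. -/
structure ReachesHub (R : V → V → Prop) (x : Fin k → V) (W : Finset V) (f : Fin k → Option V)
    (P : Fin k → List V) (i : Fin k) (w : V) : Prop where
  mem : w ∈ W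
  notMem : ∀ j, w ∉ P j
  rel : R (x i) w ∨ ∃ a, f i = some a ∧ R a w

theorem eq_none_of_maximal (h : IsHubLinkage R φ x y W E f P s) {g : Fin k → Option V}
    (hg : IsMaximalMatching (ReachesHub R x W f P) g) {i : Fin k} (hi : g i = none) :
    f i = none := by
  cases hf : f i with
  | none => rfl
  | some a =>
    exfalso
    have hgood := (h.matching.rel hf).2.card_le
    have hP := h.linkage.card_filter_mem_le
    have hsub : W ⊆ (W.filter fun w => ¬ R a w) ∪ ((W.filter fun w => ∃ i, w ∈ P i) ∪
        usedBy g) := by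
      intro w hw
      by_cases hwa : R a w
      · by_cases hwP : ∃ i, w ∈ P i
        · simp [hw, hwP]
        · push Not at hwP
          simp only [Finset.mem_union, mem_usedBy]
          exact .inr (.inr (hg.maximal hi w ⟨hw, hwP, .inr ⟨a, hf, hwa⟩⟩))
      · simp [hw, hwa]
    have h1 := Finset.card_le_card hsub
    have h2 := Finset.card_union_le (W.filter fun w => ¬ R a w)
      ((W.filter fun w => ∃ i, w ∈ P i) ∪ usedBy g)
    have h3 := Finset.card_union_le (W.filter fun w => ∃ i, w ∈ P i) (usedBy g)
    have h4 := card_usedBy_lt hi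
    have h5 := h.card_W
    omega

/-- The vertex from which the `i`-th route leaves the hubs, or the source if it uses no hub. -/
def base (x : Fin k → V) (g : Fin k → Option V) (i : Fin k) : V := (g i).getD (x i)

theorem isBase_base (h : IsHubLinkage R φ x y W E f P s) {g : Fin k → Option V}
    (hg : IsMaximalMatching (ReachesHub R x W f P) g) (i : Fin k) :
    IsBase R y W (Finset.univ.image x ∪ usedBy f) P (base x g i) := by
  cases hi : g i with
  | none => simpa [base, hi] using h.isBase_source (h.eq_none_of_maximal hg hi)
  | some w => simpa [base, hi] using h.isBase_hub (hg.rel hi).mem (hg.rel hi).notMem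

/-- `u` is a new outneighbour of the `i`-th base vertex that is not exceptional for `s i`. -/
structure IsExit (R : V → V → Prop) (x : Fin k → V) (W : Finset V) (E : V → Finset V)
    (f : Fin k → Option V) (P : Fin k → List V) (s : Fin k → V) (g : Fin k → Option V)
    (i : Fin k) (u : V) : Prop where
  rel : R (base x g i) u
  notMem : u ∉ Finset.univ.image x ∪ usedBy f
  notMem_W : u ∉ W
  notMem_P : ∀ j, u ∉ P j
  notMem_E : u ∉ E (s i)

theorem exists_eq_some_of_isExit (h : IsHubLinkage R φ x y W E f P s) {g g' : Fin k → Option V}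
    (hg : IsMaximalMatching (ReachesHub R x W f P) g)
    (hg' : IsMaximalMatching (IsExit R x W E f P s g) g') (i : Fin k) : ∃ u, g' i = some u := by
  cases hi : g' i with
  | some u => exact ⟨u, rfl⟩
  | none =>
    exfalso
    have hbase := h.isBase_base hg i
    have hsub : (Finset.univ.filter fun u => R (base x g i) u) ⊆
        (Finset.univ.image x ∪ usedBy f) ∪ (W ∪ (E (s i) ∪ (early P 2 ∪
          (Finset.univ.image y ∪ usedBy g')))) := by
      intro u hu
      have hu := (Finset.mem_filter.1 hu).2
      by_contra hcon
      rw [Finset.mem_union, not_or] at hcon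
      obtain ⟨h1, hcon⟩ := hcon
      simp only [Finset.mem_union, not_or] at hcon
      obtain ⟨h2, h3, h4, h5, h6⟩ := hcon
      refine h6 (mem_usedBy.2 (hg'.maximal hi u ⟨hu, h1, h2, fun j hj => ?_, h3⟩))
      exact h4 (hbase.mem_early_two hj hu fun i' e => h5 (by simp [e]))
    have e0 := Finset.card_le_card hsub
    have e1 := Finset.card_union_le (Finset.univ.image x ∪ usedBy f) (W ∪ (E (s i) ∪ (early P 2 ∪
          (Finset.univ.image y ∪ usedBy g'))))
    have e2 := Finset.card_union_le W (E (s i) ∪ (early P 2 ∪ (Finset.univ.image y ∪ usedBy g')))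
    have e3 := Finset.card_union_le (E (s i)) (early P 2 ∪ (Finset.univ.image y ∪ usedBy g'))
    have e4 := Finset.card_union_le (early P 2) (Finset.univ.image y ∪ usedBy g')
    have e5 := Finset.card_union_le (Finset.univ.image y) (usedBy g')
    have e6 := Finset.card_union_le (Finset.univ.image x) (usedBy f)
    have c1 : (Finset.univ.image x).card ≤ k := Finset.card_image_le.trans (by simp)
    have c2 : (Finset.univ.image y).card ≤ k := Finset.card_image_le.trans (by simp)
    have c3 := card_usedBy_le f
    have c4 := card_usedBy_lt hi
    have c5 := h.card_W
    have c6 := h.card_E (s i)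
    have c7 := card_early_le P 2
    have c8 := h.deg (base x g i)
    omega

/-- `v` is a new vertex joining the `i`-th exit vertex to `s i`. -/
structure IsReturn (R : V → V → Prop) (x : Fin k → V) (f : Fin k → Option V)
    (P : Fin k → List V) (s : Fin k → V) (g g' : Fin k → Option V) (i : Fin k) (v : V) :
    Prop where
  rel : ∃ u, g' i = some u ∧ R u v
  rel_start : R v (s i)
  notMem : v ∉ Finset.univ.image x ∪ usedBy f
  notMem_hubs : v ∉ usedBy g
  notMem_exits : v ∉ usedBy g'
  notMem_P : ∀ j, v ∉ P j

theorem exists_eq_some_of_isReturn (h : IsHubLinkage R φ x y W E f P s)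
    {g g' g'' : Fin k → Option V}
    (hg : IsMaximalMatching (ReachesHub R x W f P) g)
    (hg' : IsMaximalMatching (IsExit R x W E f P s g) g')
    (hg'' : IsMaximalMatching (IsReturn R x f P s g g') g'') {i : Fin k} {u : V}
    (hi : g' i = some u) (hus : ¬ R u (s i)) (hφ : φ u ≠ φ (s i)) : ∃ v, g'' i = some v := by
  cases hi'' : g'' i with
  | some u => exact ⟨u, rfl⟩
  | none =>
    exfalso
    have hu := hg'.rel hi
    have hbase := h.isBase_base hg i
    have hub := ((h.hub _ (h.s_mem_W i) u (fun j e => hu.notMem (by simp [e])) hu.notMem_W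
      hu.notMem_E).resolve_left hus).resolve_left hφ
    have hsub : (Finset.univ.filter fun v => (∀ i, v ≠ x i) ∧ R u v ∧ R v (s i)) ⊆
        usedBy f ∪ (usedBy g ∪ (usedBy g' ∪ (early P 3 ∪ usedBy g''))) := by
      intro v hv
      obtain ⟨hvx, huv, hvs⟩ := (Finset.mem_filter.1 hv).2
      by_contra hcon
      rw [Finset.mem_union, Finset.mem_union, Finset.mem_union, Finset.mem_union] at hcon
      push Not at hcon
      obtain ⟨h1, h2, h3, h4, h5⟩ := hcon
      refine h5 (mem_usedBy.2 (hg''.maximal hi'' v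
        ⟨⟨u, hi, huv⟩, hvs, ?_, h2, h3, fun j hj => h4 ?_⟩))
      · rw [Finset.mem_union]
        push Not
        refine ⟨fun hm => ?_, h1⟩
        obtain ⟨j, -, e⟩ := Finset.mem_image.1 hm
        exact hvx j e.symm
      · exact hbase.mem_early_three hu.rel hu.notMem hu.notMem_W hu.notMem_P hj huv
    have e0 := Finset.card_le_card hsub
    have e1 := Finset.card_union_le (usedBy f)
      (usedBy g ∪ (usedBy g' ∪ (early P 3 ∪ usedBy g'')))
    have e2 := Finset.card_union_le (usedBy g) (usedBy g' ∪ (early P 3 ∪ usedBy g''))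
    have e3 := Finset.card_union_le (usedBy g') (early P 3 ∪ usedBy g'')
    have e4 := Finset.card_union_le (early P 3) (usedBy g'')
    have c1 := card_usedBy_le f
    have c2 := card_usedBy_le g
    have c3 := card_usedBy_le g'
    have c4 := card_usedBy_lt hi''
    have c5 := card_early_le P 3
    omega

/-- The vertices available to the `i`-th route. -/
def Owns (x : Fin k → V) (f g g' g'' : Fin k → Option V) (P : Fin k → List V) (i : Fin k)
    (v : V) : Prop :=
  v = x i ∨ f i = some v ∨ g i = some v ∨ g' i = some v ∨ g'' i = some v ∨ v ∈ P i

theorem eq_of_owns (h : IsHubLinkage R φ x y W E f P s) {g g' g'' : Fin k → Option V}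
    (hg : IsMaximalMatching (ReachesHub R x W f P) g)
    (hg' : IsMaximalMatching (IsExit R x W E f P s g) g')
    (hg'' : IsMaximalMatching (IsReturn R x f P s g g') g'') {i j : Fin k} {v : V}
    (hi : Owns x f g g' g'' P i v) (hj : Owns x f g g' g'' P j v) : i = j := by
  have hF : (∃ i, v = x i) ∨ (∃ i, f i = some v) ↔ v ∈ Finset.univ.image x ∪ usedBy f := by
    simp [mem_usedBy, eq_comm]
  have d1 : ∀ {i j}, v = x i → f j ≠ some v := fun {i j} e hf => (h.matching.rel hf).2.ne_x i e
  have d2 : v ∈ W → v ∉ Finset.univ.image x ∪ usedBy f := h.W_notMem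
  have d3 : ∀ {i}, v ∈ P i → v ∉ Finset.univ.image x ∪ usedBy f := fun hv => h.linkage.avoid hv
  have i1 : ∀ {i j}, v = x i → v = x j → i = j := fun h₁ h₂ =>
    (h.inj.comp Sum.inl_injective) (h₁.symm.trans h₂)
  have g1 : ∀ {i}, g i = some v → v ∈ W ∧ ∀ j, v ∉ P j := fun e =>
    ⟨(hg.rel e).mem, (hg.rel e).notMem⟩
  have g2 : ∀ {i}, g' i = some v → v ∉ W ∧ v ∉ Finset.univ.image x ∪ usedBy f ∧
    ∀ j, v ∉ P j := fun e =>
    ⟨(hg'.rel e).notMem_W, (hg'.rel e).notMem, (hg'.rel e).notMem_P⟩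
  have g3 : ∀ {i}, g'' i = some v → v ∉ Finset.univ.image x ∪ usedBy f ∧
    (∀ j, g j ≠ some v) ∧ (∀ j, g' j ≠ some v) ∧ ∀ j, v ∉ P j := fun e =>
    ⟨(hg''.rel e).notMem, fun j hj => (hg''.rel e).notMem_hubs (mem_usedBy.2 ⟨j, hj⟩),
      fun j hj => (hg''.rel e).notMem_exits (mem_usedBy.2 ⟨j, hj⟩), (hg''.rel e).notMem_P⟩
  rcases hi with hi | hi | hi | hi | hi | hi <;> rcases hj with hj | hj | hj | hj | hj | hj
  all_goals first
    | exact i1 hi hj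
    | exact h.matching.inj hi hj
    | exact hg.inj hi hj
    | exact hg'.inj hi hj
    | exact hg''.inj hi hj
    | exact h.linkage.disj hi hj
    | (exfalso; grind)

theorem exists_walk (h : IsHubLinkage R φ x y W E f P s) {g g' g'' : Fin k → Option V}
    (hg : IsMaximalMatching (ReachesHub R x W f P) g)
    (hg' : IsMaximalMatching (IsExit R x W E f P s g) g')
    (hg'' : IsMaximalMatching (IsReturn R x f P s g g') g'') (i : Fin k) :
    ∃ l, IsWalk R l (x i) (y i) ∧ ∀ v ∈ l, Owns x f g g' g'' P i v := by
  have hcons : ∀ {a b}, Owns x f g g' g'' P i a → R a b →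
      (∃ l, IsWalk R l b (y i) ∧ ∀ v ∈ l, Owns x f g g' g'' P i v) →
      ∃ l, IsWalk R l a (y i) ∧ ∀ v ∈ l, Owns x f g g' g'' P i v := by
    rintro a b ha hab ⟨l, hl, hlo⟩
    exact ⟨a :: l, hl.cons hab, List.forall_mem_cons.2 ⟨ha, hlo⟩⟩
  have hP : ∃ l, IsWalk R l (s i) (y i) ∧ ∀ v ∈ l, Owns x f g g' g'' P i v := by
    obtain ⟨w, -, hw⟩ := h.linkage.walk i
    obtain ⟨l, hl, hsub⟩ := hw.exists_suffix (h.s_mem i)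
    exact ⟨_, hl, fun v hv => by simp [Owns, hsub hv]⟩
  have hz : Owns x f g g' g'' P i (base x g i) := by
    cases hi : g i <;> simp [Owns, base, hi]
  have hbase : ∃ l, IsWalk R l (base x g i) (y i) ∧ ∀ v ∈ l, Owns x f g g' g'' P i v := by
    obtain ⟨u, hu⟩ := h.exists_eq_some_of_isExit hg hg' i
    have huo : Owns x f g g' g'' P i u := by simp [Owns, hu]
    have hzu := (hg'.rel hu).rel
    by_cases hus : R u (s i)
    · exact hcons hz hzu (hcons huo hus hP)
    by_cases hφ : φ u = φ (s i)
    · exact hcons hz ((h.ext.right_iff _ hφ).1 hzu) hP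
    obtain ⟨v, hv⟩ := h.exists_eq_some_of_isReturn hg hg' hg'' hu hus hφ
    obtain ⟨⟨u', hu', huv⟩, hvs, -⟩ := hg''.rel hv
    obtain rfl : u = u' := Option.some.inj (hu.symm.trans hu')
    exact hcons hz hzu (hcons huo huv (hcons (by simp [Owns, hv]) hvs hP))
  cases hi : g i with
  | none => simpa [base, hi] using hbase
  | some w =>
    have hxo : Owns x f g g' g'' P i (x i) := .inl rfl
    simp only [base, hi, Option.getD_some] at hbase
    rcases (hg.rel hi).rel with hxw | ⟨a, ha, haw⟩
    · exact hcons hxo hxw hbase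
    · exact hcons hxo (h.matching.rel ha).1 (hcons (by simp [Owns, ha]) haw hbase)

end IsHubLinkage

/-- Disjoint walks from `x i` to `y i` in a highly connected extended semicomplete digraph of large
minimum out-degree. -/
theorem IsExtendedSemicomplete.exists_disjoint_walks {V ι : Type} {k : ℕ} [Fintype V]
    [DecidableEq V] {R : V → V → Prop} [DecidableRel R] {φ : V → ι}
    (hR : IsExtendedSemicomplete R φ) (hirr : ∀ v, ¬ R v v)
    {x y : Fin k → V} (hxy : Function.Injective (Sum.elim x y))
    (hdeg : ∀ v, 23 * k ≤ (Finset.univ.filter fun u => R v u).card)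
    (hconn : ∀ S : Finset V, S.card < 3 * k → ∀ u ∉ S, ∀ v ∉ S,
      ∃ l, IsWalk R l u v ∧ ∀ z ∈ l, z ∉ S) :
    ∃ Q : Fin k → List V, (∀ i, IsWalk R (Q i) (x i) (y i)) ∧
      ∀ {i j v}, v ∈ Q i → v ∈ Q j → i = j := by
  obtain ⟨W, E, f, P, s, h⟩ := exists_isHubLinkage hR hirr hxy hdeg hconn
  obtain ⟨g, hg⟩ := exists_isMaximalMatching (IsHubLinkage.ReachesHub R x W f P)
  obtain ⟨g', hg'⟩ := exists_isMaximalMatching (IsHubLinkage.IsExit R x W E f P s g)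
  obtain ⟨g'', hg''⟩ := exists_isMaximalMatching (IsHubLinkage.IsReturn R x f P s g g')
  choose Q hQ hown using h.exists_walk hg hg' hg''
  exact ⟨Q, hQ, fun hi hj => h.eq_of_owns hg hg' hg'' (hown _ _ hi) (hown _ _ hj)⟩

/-- Every 3k-strong extended semicomplete digraph with δ⁺ ≥ 23k
is k-linked (k ≥ 2).  An extended semicomplete digraph is a composition
H[S₁,…,S_h] with H semicomplete and every part Sᵢ arcless. -/
theorem extended_semicomplete_is_k_linked {V ι : Type} [Fintype V] [Fintype ι]
    (k : ℕ) (hk : 2 ≤ k) (G : Digr V) (H : Digr ι) (φ : V → ι)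
    (hι : 2 ≤ Fintype.card ι)
    (hcomp : Digr.IsCompositionOver G H φ) (hH : H.Semicomplete)
    (harcless : ∀ u v : V, φ u = φ v → ¬ G.Adj u v)
    (hstrong : G.KStrong (3 * k)) (hdeg : ∀ v : V, 23 * k ≤ G.outDeg v) :
    G.KLinked k := by
  classical
  refine ⟨by have := hstrong.1; omega, fun x y hxy => ?_⟩
  have hadj : ∀ u v, G.Adj u v ↔ φ u ≠ φ v ∧ H.Adj (φ u) (φ v) := by
    intro u v
    by_cases h : φ u = φ v
    · simp [h, harcless u v h]
    · simp [h, hcomp.2 u v h]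
  have hR : IsExtendedSemicomplete G.Adj φ :=
    { total := fun {u v} h => by
        rw [hcomp.2 u v h, hcomp.2 v u h.symm]
        exact hH _ _ h
      left_iff := fun {u v} z h => by rw [hadj, hadj, h]
      right_iff := fun {u v} z h => by rw [hadj, hadj, h] }
  obtain ⟨Q, hQ, hd⟩ := hR.exists_disjoint_walks G.irrefl hxy (fun v => by
    have := hdeg v
    rwa [Digr.outDeg, Set.ncard_eq_toFinset_card', Set.toFinset_ofPred] at this) (by
    intro S hS u hu v hv
    by_cases huv : u = v
    · subst huv
      exact ⟨[u], IsWalk.singleton _ _, by simpa using hu⟩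
    · obtain ⟨p, ⟨h₁, h₂, h₃, -⟩, hp⟩ := hstrong.2 S (by omega) u (by simpa using hu) v
        (by simpa using hv) huv
      exact ⟨p, ⟨h₃, h₁, h₂⟩, fun z hz => by simpa using hp z hz⟩)
  choose P hP hsub hnodup using fun i => (hQ i).exists_nodup
  exact ⟨P, fun i => ⟨(hP i).2.1, (hP i).2.2, (hP i).1, hnodup i⟩, fun i j hij v hi hj =>
    hij (hd (hsub i hi) (hsub j hj))⟩
end
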